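/- arXiv:2505.05902 — 5 statements merged into one kernel-verified Lean document; each statement's English description precedes it below -/
import Mathlib

section
/- Let p be a prime, F a field of characteristic p, G a finite p-group that can be generated by two elements and has nilpotency class exactly two, and H a finite group. If the group algebras F[G] and F[H] are isomorphic as F-algebras, then the groups G and H are isomorphic. -/
namespace ModularIsomorphism

section CommutatorSpan

open Polynomial

/-- The linear span of the additive commutators `a * b - b * a` of an algebra. -/
def commSpan (F A : Type*) [Field F] [Ring A] [Algebra F A] : Submodule F A :=
  Submodule.span F {z | ∃ a b : A, z = a * b - b * a}

variable {F A B : Type*} [Field F] [Ring A] [Algebra F A] [Ring B] [Algebra F B]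

lemma mul_sub_mul_mem_commSpan (a b : A) : a * b - b * a ∈ commSpan F A :=
  Submodule.subset_span ⟨a, b, rfl⟩

lemma coeff_mul_sub_mul_mem_commSpan (f g : A[X]) (k : ℕ) :
    (f * g - g * f).coeff k ∈ commSpan F A := by
  rw [coeff_sub, coeff_mul, coeff_mul, ← Finset.Nat.sum_antidiagonal_swap,
    ← Finset.sum_sub_distrib]
  exact Submodule.sum_mem _ fun i _ => mul_sub_mul_mem_commSpan _ _

lemma coeff_derivative_pow_mem_commSpan (f : A[X]) (n l k : ℕ) :
    (derivative (f ^ (n + 1)) * f ^ l - (n + 1) • (f ^ (n + l) * derivative f)).coeff k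
      ∈ commSpan F A := by
  induction n generalizing l with
  | zero =>
    have := coeff_mul_sub_mul_mem_commSpan (F := F) (derivative f) (f ^ l) k
    simpa using this
  | succ n ih =>
    have h1 := ih (l + 1)
    have h2 := coeff_mul_sub_mul_mem_commSpan (F := F) (f ^ (n + 1) * derivative f) (f ^ l) k
    have h3 := Submodule.add_mem _ h1 h2
    rw [← coeff_add] at h3
    convert h3 using 2
    rw [pow_succ f (n + 1), derivative_mul, add_smul _ 1, one_smul,
      show n + 1 + l = n + (l + 1) by ring]
    have e : f ^ l * (f ^ (n + 1) * derivative f) = f ^ (n + (l + 1)) * derivative f := by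
      rw [← mul_assoc, ← pow_add]; congr 2; ring
    rw [e, pow_succ' f l]
    noncomm_ring

lemma add_pow_char_sub_mem_commSpan (p : ℕ) [Fact p.Prime] [CharP F p] (a b : A) :
    (a + b) ^ p - (a ^ p + b ^ p) ∈ commSpan F A := by
  have hp := (Fact.out : p.Prime)
  obtain ⟨q, rfl⟩ : ∃ q, p = q + 1 := ⟨p - 1, (Nat.succ_pred_eq_of_pos hp.pos).symm⟩
  set f : A[X] := C a + C b * X with hf
  have hchar : ((q + 1 : ℕ) : A) = 0 := by
    rw [← map_natCast (algebraMap F A), CharP.cast_eq_zero, map_zero]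
  have hdeg : f.natDegree ≤ 1 := by
    rw [hf]; compute_degree
  have hmid : ∀ k, k < q → (f ^ (q + 1)).coeff (k + 1) ∈ commSpan F A := by
    intro k hk
    have h := coeff_derivative_pow_mem_commSpan (F := F) f q 0 k
    rw [pow_zero, mul_one, nsmul_eq_mul] at h
    have hz : ((q + 1 : ℕ) : A[X]) = 0 := by
      rw [← map_natCast (C : A →+* A[X]), hchar, map_zero]
    rw [hz, zero_mul, sub_zero, coeff_derivative] at h
    have hne : ((k + 1 : ℕ) : F) ≠ 0 := by
      rw [Ne, CharP.cast_eq_zero_iff F (q + 1)]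
      exact fun hd => absurd (Nat.le_of_dvd (Nat.succ_pos _) hd) (by omega)
    have h2 := Submodule.smul_mem _ (((k + 1 : ℕ) : F)⁻¹) h
    rwa [show ((k : A) + 1) = algebraMap F A ((k + 1 : ℕ) : F) by simp, ← Algebra.commutes,
      ← Algebra.smul_def, smul_smul, inv_mul_cancel₀ hne, one_smul] at h2
  have h0 : (f ^ (q + 1)).coeff 0 = a ^ (q + 1) := by
    have := map_pow (constantCoeff : A[X] →+* A) f (q + 1)
    simpa [constantCoeff_apply, hf] using this
  have hlast : (f ^ (q + 1)).coeff (q + 1) = b ^ (q + 1) := by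
    have := coeff_pow_of_natDegree_le (m := q + 1) hdeg
    simpa [hf, coeff_C] using this
  have heval : (a + b) ^ (q + 1) = ∑ i ∈ Finset.range (q + 2), (f ^ (q + 1)).coeff i := by
    have h1 := map_pow (eval₂RingHom' (RingHom.id A) 1 (fun a => Commute.one_right a)) f (q + 1)
    have h2 : eval₂RingHom' (RingHom.id A) 1 (fun a => Commute.one_right a) f = a + b := by
      simp [eval₂RingHom', hf, eval₂_mul_X]
    rw [h2] at h1
    rw [← h1]
    change eval₂ _ _ _ = _
    rw [eval₂_eq_sum_range' (n := q + 2)]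
    · simp
    · have := natDegree_pow_le_of_le (q + 1) hdeg
      omega
  rw [heval, Finset.sum_range_succ, Finset.sum_range_succ', h0, hlast]
  have : ∑ k ∈ Finset.range q, (f ^ (q + 1)).coeff (k + 1) ∈ commSpan F A :=
    Submodule.sum_mem _ fun k hk => hmid k (Finset.mem_range.1 hk)
  convert this using 1
  abel

lemma mul_pow_succ_eq (a b : A) (n : ℕ) : (a * b) ^ (n + 1) = a * ((b * a) ^ n * b) := by
  induction n with
  | zero => simp
  | succ n ih => rw [pow_succ, ih, pow_succ]; simp only [mul_assoc]

lemma pow_char_mem_commSpan (p : ℕ) [Fact p.Prime] [CharP F p] {x : A} (hx : x ∈ commSpan F A) :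
    x ^ p ∈ commSpan F A := by
  have hp := (Fact.out : p.Prime)
  induction hx using Submodule.span_induction with
  | mem x h =>
    obtain ⟨a, b, rfl⟩ := h
    have h1 := add_pow_char_sub_mem_commSpan (F := F) p (a * b) (-(b * a))
    have h2 : (-(b * a)) ^ p = - (b * a) ^ p := by
      rw [neg_pow]
      have : (-1 : A) ^ p = -1 := by
        have := congrArg (algebraMap F A) (neg_one_pow_char F p)
        simpa using this
      rw [this, neg_one_mul]
    have h3 : (a * b) ^ p - (b * a) ^ p ∈ commSpan F A := by
      obtain ⟨q, rfl⟩ : ∃ q, p = q + 1 := ⟨p - 1, (Nat.succ_pred_eq_of_pos hp.pos).symm⟩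
      have := mul_sub_mul_mem_commSpan (F := F) a ((b * a) ^ q * b)
      rwa [← mul_pow_succ_eq, mul_assoc, ← pow_succ] at this
    rw [h2, ← sub_eq_add_neg, ← sub_eq_add_neg] at h1
    simpa using Submodule.add_mem _ h1 h3
  | zero => rw [zero_pow hp.ne_zero]; exact Submodule.zero_mem _
  | add x y _ _ hx hy =>
    simpa using Submodule.add_mem _ (add_pow_char_sub_mem_commSpan (F := F) p x y)
      (Submodule.add_mem _ hx hy)
  | smul c x _ hx => rw [_root_.smul_pow]; exact Submodule.smul_mem _ _ hx

lemma add_pow_char_pow_sub_mem_commSpan (p : ℕ) [Fact p.Prime] [CharP F p] (n : ℕ) (a b : A) :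
    (a + b) ^ p ^ n - (a ^ p ^ n + b ^ p ^ n) ∈ commSpan F A := by
  induction n with
  | zero => simp
  | succ n ih =>
    have h1 := pow_char_mem_commSpan p ih
    have h2 := add_pow_char_sub_mem_commSpan (F := F) p
      (a ^ p ^ n + b ^ p ^ n) ((a + b) ^ p ^ n - (a ^ p ^ n + b ^ p ^ n))
    have h3 := add_pow_char_sub_mem_commSpan (F := F) p (a ^ p ^ n) (b ^ p ^ n)
    rw [add_sub_cancel] at h2
    have h4 := Submodule.add_mem _ (Submodule.add_mem _ h1 h2) h3
    simp only [← pow_mul, ← pow_succ] at h4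
    convert h4 using 1
    abel

lemma map_commSpan (e : A ≃ₐ[F] B) :
    (commSpan F A).map e.toLinearMap = commSpan F B := by
  rw [commSpan, Submodule.map_span, commSpan]
  congr 1
  ext z
  constructor
  · rintro ⟨_, ⟨a, b, rfl⟩, rfl⟩
    exact ⟨e a, e b, by simp⟩
  · rintro ⟨a, b, rfl⟩
    exact ⟨e.symm a * e.symm b - e.symm b * e.symm a, ⟨_, _, rfl⟩, by simp⟩

/-- The span of the `n`-th powers, enlarged by the span of the additive commutators. -/
def powSpan (F A : Type*) [Field F] [Ring A] [Algebra F A] (n : ℕ) : Submodule F A :=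
  Submodule.span F (Set.range fun w : A => w ^ n) ⊔ commSpan F A

lemma map_powSpan (e : A ≃ₐ[F] B) (n : ℕ) :
    (powSpan F A n).map e.toLinearMap = powSpan F B n := by
  rw [powSpan, Submodule.map_sup, map_commSpan, powSpan, Submodule.map_span]
  congr 2
  ext z
  constructor
  · rintro ⟨_, ⟨a, rfl⟩, rfl⟩
    exact ⟨e a, by simp⟩
  · rintro ⟨a, rfl⟩
    exact ⟨e.symm a ^ n, ⟨_, rfl⟩, by simp⟩

lemma finrank_powSpan_eq (e : A ≃ₐ[F] B) (n : ℕ) :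
    Module.finrank F (powSpan F A n) = Module.finrank F (powSpan F B n) := by
  rw [← map_powSpan e n]
  exact (LinearEquiv.finrank_map_eq e.toLinearEquiv _).symm

lemma finrank_commSpan_eq (e : A ≃ₐ[F] B) :
    Module.finrank F (commSpan F A) = Module.finrank F (commSpan F B) := by
  rw [← map_commSpan e]
  exact (LinearEquiv.finrank_map_eq e.toLinearEquiv _).symm

end CommutatorSpan

section GroupAlgebra

open MonoidAlgebra

variable {F : Type*} [Field F] {G : Type*} [Group G]

lemma coeff_eq_zero_of_mem_commSpan {z : G} (hz : z ∈ Subgroup.center G)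
    {w : MonoidAlgebra F G} (hw : w ∈ commSpan F (MonoidAlgebra F G)) : w.coeff z = 0 := by
  classical
  induction hw using Submodule.span_induction with
  | mem x h =>
    obtain ⟨a, b, rfl⟩ := h
    induction a using MonoidAlgebra.induction_linear with
    | zero => simp
    | add f g hf hg =>
      rw [add_mul, mul_add, add_sub_add_comm, coeff_add, Finsupp.add_apply, hf, hg, add_zero]
    | single g r =>
      induction b using MonoidAlgebra.induction_linear with
      | zero => simp
      | add f g hf hg =>
        rw [add_mul, mul_add, add_sub_add_comm, coeff_add, Finsupp.add_apply, hf, hg, add_zero]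
      | single h s =>
        have : g * h = z ↔ h * g = z := by
          rw [Subgroup.mem_center_iff] at hz
          constructor
          · rintro rfl
            exact mul_right_cancel (b := h) (by simpa only [mul_assoc] using hz h)
          · rintro rfl
            exact mul_right_cancel (b := g) (by simpa only [mul_assoc] using hz g)
        rw [single_mul_single, single_mul_single, coeff_sub, Finsupp.sub_apply,
          coeff_single, coeff_single, Finsupp.single_apply, Finsupp.single_apply, mul_comm s r]
        simp [this]
  | zero => simp
  | add x y _ _ hx hy => rw [coeff_add, Finsupp.add_apply, hx, hy, add_zero]
  | smul c x _ hx => rw [coeff_smul, Finsupp.smul_apply, hx, smul_zero]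

lemma coeff_eq_zero_of_mem_span_of {S : Set G} {z : G} (hz : z ∉ S)
    {w : MonoidAlgebra F G} (hw : w ∈ Submodule.span F (of F G '' S)) : w.coeff z = 0 := by
  classical
  induction hw using Submodule.span_induction with
  | mem x h =>
    obtain ⟨g, hg, rfl⟩ := h
    rw [of_apply, coeff_single, Finsupp.single_apply, if_neg]
    rintro rfl
    exact hz hg
  | zero => simp
  | add x y _ _ hx hy => rw [coeff_add, Finsupp.add_apply, hx, hy, add_zero]
  | smul c x _ hx => rw [coeff_smul, Finsupp.smul_apply, hx, smul_zero]

lemma finrank_span_of [Finite G] (S : Set G) :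
    Module.finrank F (Submodule.span F (of F G '' S)) = S.ncard := by
  classical
  have hli : LinearIndependent F (fun g : G => of F G g) := by
    have := (MonoidAlgebra.basis G F).linearIndependent
    convert this using 1
    ext1 g
    simp [MonoidAlgebra.basis_apply]
  have hli2 : LinearIndependent F (fun g : S => of F G g) :=
    hli.comp _ Subtype.val_injective
  have : Fintype S := Fintype.ofFinite _
  have h := finrank_span_eq_card hli2
  rw [Set.image_eq_range, h, ← Nat.card_eq_fintype_card, Nat.card_coe_set_eq]

instance finite_monoidAlgebra [Finite G] : Module.Finite F (MonoidAlgebra F G) :=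
  Module.Finite.of_basis (MonoidAlgebra.basis G F)

lemma finrank_span_of_sup_commSpan [Finite G] {S : Set G} (hS : S ⊆ Subgroup.center G) :
    Module.finrank F
        (Submodule.span F (of F G '' S) ⊔ commSpan F (MonoidAlgebra F G) : Submodule F _) =
      S.ncard + Module.finrank F (commSpan F (MonoidAlgebra F G)) := by
  rw [← finrank_span_of (F := F) S, ← Submodule.finrank_sup_add_finrank_inf_eq]
  have : Submodule.span F (of F G '' S) ⊓ commSpan F (MonoidAlgebra F G) = ⊥ := by
    rw [eq_bot_iff]
    rintro w ⟨h1, h2⟩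
    rw [Submodule.mem_bot]
    ext z
    by_cases hz : z ∈ S
    · exact coeff_eq_zero_of_mem_commSpan (hS hz) h2
    · exact coeff_eq_zero_of_mem_span_of hz h1
  rw [this, finrank_bot, add_zero]

lemma powSpan_eq (p : ℕ) [Fact p.Prime] [CharP F p] (n : ℕ) :
    powSpan F (MonoidAlgebra F G) (p ^ n) =
      Submodule.span F (of F G '' Set.range fun g : G => g ^ p ^ n) ⊔
        commSpan F (MonoidAlgebra F G) := by
  have hp := (Fact.out : p.Prime)
  rw [powSpan]
  apply le_antisymm
  · refine sup_le (Submodule.span_le.2 ?_) le_sup_right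
    rintro _ ⟨w, rfl⟩
    change w ^ p ^ n ∈ _
    induction w using MonoidAlgebra.induction_linear with
    | zero => rw [zero_pow (pow_pos hp.pos n).ne']; exact Submodule.zero_mem _
    | add f g hf hg =>
      have h := (le_sup_right : _ ≤ Submodule.span F
        (of F G '' Set.range fun g : G => g ^ p ^ n) ⊔ commSpan F (MonoidAlgebra F G))
        (add_pow_char_pow_sub_mem_commSpan p n f g)
      simpa using Submodule.add_mem _ h (Submodule.add_mem _ hf hg)
    | single g r =>
      refine Submodule.mem_sup_left ?_
      rw [single_pow, ← mul_one (r ^ p ^ n), ← smul_single']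
      exact Submodule.smul_mem _ _ (Submodule.subset_span ⟨_, ⟨g, rfl⟩, rfl⟩)
  · refine sup_le (Submodule.span_le.2 ?_) le_sup_right
    rintro _ ⟨_, ⟨g, rfl⟩, rfl⟩
    refine Submodule.mem_sup_left (Submodule.subset_span ⟨of F G g, ?_⟩)
    simp

lemma ncard_powers_eq {H : Type*} [Group H] [Finite G] [Finite H]
    (p : ℕ) [Fact p.Prime] [CharP F p] (e : MonoidAlgebra F G ≃ₐ[F] MonoidAlgebra F H) (n : ℕ)
    (hG : ∀ g : G, g ^ p ^ n ∈ Subgroup.center G) (hH : ∀ g : H, g ^ p ^ n ∈ Subgroup.center H) :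
    (Set.range fun g : G => g ^ p ^ n).ncard = (Set.range fun g : H => g ^ p ^ n).ncard := by
  have h := finrank_powSpan_eq e (p ^ n)
  rw [powSpan_eq, powSpan_eq, finrank_span_of_sup_commSpan, finrank_span_of_sup_commSpan,
    finrank_commSpan_eq e] at h
  · omega
  · rintro _ ⟨g, rfl⟩; exact hH g
  · rintro _ ⟨g, rfl⟩; exact hG g

omit [Group G] in
lemma finrank_monoidAlgebra [Finite G] : Module.finrank F (MonoidAlgebra F G) = Nat.card G := by
  exact Module.finrank_eq_nat_card_basis (MonoidAlgebra.basis G F)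

lemma card_eq_of_algEquiv {H : Type*} [Group H] [Finite G] [Finite H]
    (e : MonoidAlgebra F G ≃ₐ[F] MonoidAlgebra F H) : Nat.card G = Nat.card H := by
  rw [← finrank_monoidAlgebra (F := F), ← finrank_monoidAlgebra (F := F) (G := H)]
  exact e.toLinearEquiv.finrank_eq

/-- The projection of the group algebra onto the group algebra of the abelianization. -/
noncomputable def abProj (F : Type*) [Field F] (G : Type*) [Group G] :
    MonoidAlgebra F G →ₐ[F] MonoidAlgebra F (Abelianization G) :=
  mapDomainAlgHom F F Abelianization.of

@[simp] lemma abProj_single (g : G) (r : F) :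
    abProj F G (single g r) = single (Abelianization.of g) r := by
  simp [abProj]

/-- The factorization of a homomorphism to a commutative algebra through `abProj`. -/
noncomputable def abLift {R : Type*} [CommRing R] [Algebra F R] (f : MonoidAlgebra F G →ₐ[F] R) :
    MonoidAlgebra F (Abelianization G) →ₐ[F] R :=
  MonoidAlgebra.lift F R (Abelianization G) ((Units.coeHom R).comp
    (Abelianization.lift (((f : MonoidAlgebra F G →* R).comp (of F G)).toHomUnits)))

lemma abLift_single {R : Type*} [CommRing R] [Algebra F R] (f : MonoidAlgebra F G →ₐ[F] R)
    (g : G) : abLift f (single (Abelianization.of g) 1) = f (single g 1) := by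
  simp [abLift]

lemma abLift_abProj {R : Type*} [CommRing R] [Algebra F R] (f : MonoidAlgebra F G →ₐ[F] R)
    (w : MonoidAlgebra F G) : abLift f (abProj F G w) = f w := by
  have : (abLift f).comp (abProj F G) = f := by
    refine MonoidAlgebra.algHom_ext (fun g => ?_) (Subsingleton.elim _ _)
    simp [abLift_single]
  exact DFunLike.congr_fun this w

lemma abProj_surjective : Function.Surjective (abProj F G) := by
  intro w
  induction w using MonoidAlgebra.induction_linear with
  | zero => exact ⟨0, map_zero _⟩
  | add f g hf hg =>
    obtain ⟨a, rfl⟩ := hf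
    obtain ⟨b, rfl⟩ := hg
    exact ⟨a + b, map_add _ _ _⟩
  | single g r =>
    obtain ⟨g, rfl⟩ := QuotientGroup.mk_surjective g
    exact ⟨single g r, abProj_single g r⟩

lemma exists_algEquiv_abelianization {H : Type*} [Group H]
    (e : MonoidAlgebra F G ≃ₐ[F] MonoidAlgebra F H) :
    ∃ e' : MonoidAlgebra F (Abelianization G) ≃ₐ[F] MonoidAlgebra F (Abelianization H),
      ∀ w, e' (abProj F G w) = abProj F H (e w) := by
  let f := abLift ((abProj F H).comp (e : MonoidAlgebra F G →ₐ[F] MonoidAlgebra F H))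
  let g := abLift ((abProj F G).comp (e.symm : MonoidAlgebra F H →ₐ[F] MonoidAlgebra F G))
  have hf : ∀ w, f (abProj F G w) = abProj F H (e w) := fun w => abLift_abProj _ w
  have hg : ∀ w, g (abProj F H w) = abProj F G (e.symm w) := fun w => abLift_abProj _ w
  refine ⟨AlgEquiv.ofAlgHom f g ?_ ?_, hf⟩
  · apply AlgHom.ext
    intro w
    obtain ⟨w, rfl⟩ := abProj_surjective w
    simp [hf, hg]
  · apply AlgHom.ext
    intro w
    obtain ⟨w, rfl⟩ := abProj_surjective w
    simp [hf, hg]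

end GroupAlgebra

section Center

open MonoidAlgebra

variable {F : Type*} [Field F] {G : Type*} [Group G]

lemma single_mem_center {g : G} (hg : g ∈ Subgroup.center G) (r : F) :
    single g r ∈ Subalgebra.center F (MonoidAlgebra F G) := by
  rw [Subalgebra.mem_center_iff]
  intro w
  induction w using MonoidAlgebra.induction_linear with
  | zero => simp
  | add a b ha hb => rw [add_mul, mul_add, ha, hb]
  | single h s =>
    rw [single_mul_single, single_mul_single, Subgroup.mem_center_iff.1 hg h, mul_comm s]

lemma coeff_eq_of_isConj {w : MonoidAlgebra F G}
    (hw : w ∈ Subalgebra.center F (MonoidAlgebra F G)) {g h : G} (hgh : IsConj g h) :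
    w.coeff h = w.coeff g := by
  obtain ⟨c, rfl⟩ := isConj_iff.1 hgh
  have h1 := congrArg (fun v => v.coeff (c * g)) (Subalgebra.mem_center_iff.1 hw (single c 1))
  simpa [coeff_single_mul_apply, coeff_mul_single_apply] using h1.symm

lemma single_sub_single_mem_commSpan {g h : G} (hgh : IsConj g h) (r : F) :
    single h r - single g r ∈ commSpan F (MonoidAlgebra F G) := by
  obtain ⟨c, rfl⟩ := isConj_iff.1 hgh
  have := mul_sub_mul_mem_commSpan (F := F) (single (c * g) r) (single (c⁻¹) (1 : F))
  simpa [single_mul_single] using this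

lemma mem_span_center_sup_commSpan [Finite G] {p : ℕ} [Fact p.Prime] [CharP F p]
    (hG : IsPGroup p G) {w : MonoidAlgebra F G}
    (hw : w ∈ Subalgebra.center F (MonoidAlgebra F G)) :
    w ∈ Submodule.span F (of F G '' (Subgroup.center G : Set G)) ⊔
      commSpan F (MonoidAlgebra F G) := by
  classical
  have : Fintype G := Fintype.ofFinite G
  have hsum : w = ∑ g : G, single g (w.coeff g) := by
    conv_lhs => rw [← sum_coeff_single w]
    rw [Finsupp.sum_fintype]
    simp
  rw [hsum, ← Finset.sum_fiberwise _ ConjClasses.mk]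
  refine Submodule.sum_mem _ fun c _ => ?_
  obtain ⟨g, rfl⟩ := ConjClasses.mk_surjective c
  set S := {h ∈ (Finset.univ : Finset G) | ConjClasses.mk h = ConjClasses.mk g} with hS
  have hmem : ∀ h ∈ S, IsConj g h := fun h hh =>
    (ConjClasses.mk_eq_mk_iff_isConj.1 (Finset.mem_filter.1 hh).2).symm
  have h1 : ∑ h ∈ S, single h (w.coeff h) - (S.card : F) • single g (w.coeff g) ∈
      commSpan F (MonoidAlgebra F G) := by
    rw [Nat.cast_smul_eq_nsmul, ← Finset.sum_const, ← Finset.sum_sub_distrib]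
    refine Submodule.sum_mem _ fun h hh => ?_
    rw [coeff_eq_of_isConj hw (hmem h hh)]
    exact single_sub_single_mem_commSpan (hmem h hh) _
  have h2 : (S.card : F) • single g (w.coeff g) ∈
      Submodule.span F (of F G '' (Subgroup.center G : Set G)) := by
    obtain ⟨n, hn⟩ := (hG.of_equiv ConjAct.toConjAct).card_orbit (α := G) g
    have hcard : S.card = p ^ n := by
      rw [← hn, Nat.card_coe_set_eq, ← Set.ncard_coe_finset]
      congr 1
      ext h
      rw [ConjAct.mem_orbit_conjAct]
      simp [hS, ConjClasses.mk_eq_mk_iff_isConj]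
    rcases Nat.eq_zero_or_pos n with rfl | hn0
    · have hg : g ∈ Subgroup.center G := by
        rw [Subgroup.mem_center_iff]
        intro c
        have hc : c * g * c⁻¹ ∈ S := by
          simp only [hS, Finset.mem_filter, Finset.mem_univ, true_and]
          rw [ConjClasses.mk_eq_mk_iff_isConj]
          exact (isConj_iff.2 ⟨c, rfl⟩ : IsConj g _).symm
        have hgS : g ∈ S := by simp [hS]
        have := Finset.card_le_one.1 (hcard.trans (pow_zero p)).le _ hc _ hgS
        exact mul_inv_eq_iff_eq_mul.1 this
      refine Submodule.smul_mem _ _ ?_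
      rw [← mul_one (w.coeff g), ← smul_single']
      exact Submodule.smul_mem _ _ (Submodule.subset_span ⟨g, hg, rfl⟩)
    · have : (S.card : F) = 0 := by
        rw [hcard, CharP.cast_eq_zero_iff F p]
        exact dvd_pow_self p hn0.ne'
      rw [this, zero_smul]
      exact Submodule.zero_mem _
  have := Submodule.add_mem _ (Submodule.mem_sup_right h1) (Submodule.mem_sup_left h2)
  rwa [sub_add_cancel] at this

lemma center_sup_commSpan [Finite G] {p : ℕ} [Fact p.Prime] [CharP F p] (hG : IsPGroup p G) :
    Subalgebra.toSubmodule (Subalgebra.center F (MonoidAlgebra F G)) ⊔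
        commSpan F (MonoidAlgebra F G) =
      Submodule.span F (of F G '' (Subgroup.center G : Set G)) ⊔
        commSpan F (MonoidAlgebra F G) := by
  apply le_antisymm
  · exact sup_le (fun w hw => mem_span_center_sup_commSpan hG hw) le_sup_right
  · refine sup_le_sup_right (Submodule.span_le.2 ?_) _
    rintro _ ⟨g, hg, rfl⟩
    exact single_mem_center hg 1

lemma map_center {A B : Type*} [Ring A] [Algebra F A] [Ring B] [Algebra F B] (e : A ≃ₐ[F] B) :
    (Subalgebra.toSubmodule (Subalgebra.center F A)).map e.toLinearMap =
      Subalgebra.toSubmodule (Subalgebra.center F B) := by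
  ext z
  simp only [Submodule.mem_map, Subalgebra.mem_toSubmodule, Subalgebra.mem_center_iff]
  constructor
  · rintro ⟨a, ha, rfl⟩ b
    have := congrArg e (ha (e.symm b))
    simpa using this
  · intro hz
    refine ⟨e.symm z, fun b => ?_, by simp⟩
    have := congrArg e.symm (hz (e b))
    simpa using this

variable {H : Type*} [Group H] [Finite G] [Finite H] {p : ℕ} [Fact p.Prime] [CharP F p]

lemma card_center_eq (hG : IsPGroup p G) (hH : IsPGroup p H)
    (e : MonoidAlgebra F G ≃ₐ[F] MonoidAlgebra F H) :
    Nat.card (Subgroup.center G) = Nat.card (Subgroup.center H) := by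
  have h := congrArg (fun V : Submodule F _ => Module.finrank F V) (center_sup_commSpan (F := F) hH)
  rw [← map_center e, ← map_commSpan e, ← Submodule.map_sup, center_sup_commSpan hG,
    map_commSpan e, show (e.toLinearMap : _ →ₗ[F] _) = (e.toLinearEquiv : _ →ₗ[F] _) from rfl,
    LinearEquiv.finrank_map_eq e.toLinearEquiv,
    finrank_span_of_sup_commSpan le_rfl, finrank_span_of_sup_commSpan le_rfl,
    finrank_commSpan_eq e] at h
  have h' := Nat.add_right_cancel h
  rwa [← Nat.card_coe_set_eq, ← Nat.card_coe_set_eq] at h'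

omit [Finite G] in
lemma abProj_eq_zero_of_mem_commSpan {w : MonoidAlgebra F G}
    (hw : w ∈ commSpan F (MonoidAlgebra F G)) : abProj F G w = 0 := by
  induction hw using Submodule.span_induction with
  | mem x h =>
    obtain ⟨a, b, rfl⟩ := h
    rw [map_sub, map_mul, map_mul, mul_comm, sub_self]
  | zero => simp
  | add x y _ _ hx hy => rw [map_add, hx, hy, add_zero]
  | smul c x _ hx => rw [map_smul, hx, smul_zero]

lemma map_abProj_center (hG : IsPGroup p G) :
    (Subalgebra.toSubmodule (Subalgebra.center F (MonoidAlgebra F G))).map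
        (abProj F G).toLinearMap =
      Submodule.span F (of F (Abelianization G) ''
        (Abelianization.of '' (Subgroup.center G : Set G))) := by
  have hz : (commSpan F (MonoidAlgebra F G)).map (abProj F G).toLinearMap = ⊥ := by
    rw [eq_bot_iff]
    rintro _ ⟨w, hw, rfl⟩
    exact abProj_eq_zero_of_mem_commSpan hw
  have h := congrArg (Submodule.map (abProj F G).toLinearMap) (center_sup_commSpan (F := F) hG)
  rw [Submodule.map_sup, Submodule.map_sup, hz, sup_bot_eq, sup_bot_eq] at h
  rw [h, Submodule.map_span, ← Set.image_comp, ← Set.image_comp]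
  congr 1
  refine Set.image_congr fun g _ => ?_
  simp

lemma ncard_image_center_eq (hG : IsPGroup p G) (hH : IsPGroup p H)
    (e : MonoidAlgebra F G ≃ₐ[F] MonoidAlgebra F H) :
    (Abelianization.of '' (Subgroup.center G : Set G)).ncard =
      (Abelianization.of '' (Subgroup.center H : Set H)).ncard := by
  obtain ⟨e', he'⟩ := exists_algEquiv_abelianization e
  rw [← finrank_span_of (F := F), ← finrank_span_of (F := F), ← map_abProj_center hG,
    ← map_abProj_center hH, ← map_center e, ← Submodule.map_comp]
  rw [show (abProj F H).toLinearMap ∘ₗ e.toLinearMap =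
      (e'.toLinearEquiv : _ →ₗ[F] _) ∘ₗ (abProj F G).toLinearMap from
    LinearMap.ext fun w => (he' w).symm, Submodule.map_comp, LinearEquiv.finrank_map_eq]

end Center

section ClassTwo

open commutatorElement

variable {G : Type*} [Group G]

lemma card_abelianization_mul_card_commutator [Finite G] :
    Nat.card (Abelianization G) * Nat.card (commutator G) = Nat.card G :=
  (Subgroup.card_eq_card_quotient_mul_card_subgroup (commutator G)).symm

lemma ncard_image_center_mul [Finite G] :
    (Abelianization.of '' (Subgroup.center G : Set G)).ncard *
      Nat.card (commutator G ⊓ Subgroup.center G : Subgroup G) = Nat.card (Subgroup.center G) := by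
  set φ : Subgroup.center G →* Abelianization G :=
    Abelianization.of.comp (Subgroup.center G).subtype with hφ
  have h1 : Nat.card φ.range = (Abelianization.of '' (Subgroup.center G : Set G)).ncard := by
    rw [← Nat.card_coe_set_eq]
    congr 1
    rw [hφ, MonoidHom.range_comp, Subgroup.range_subtype]
    rfl
  have h2 : φ.ker.map (Subgroup.center G).subtype = commutator G ⊓ Subgroup.center G := by
    rw [hφ, ← MonoidHom.comap_ker, Abelianization.ker_of, Subgroup.map_comap_eq,
      Subgroup.range_subtype, inf_comm]
  have h3 : Nat.card φ.ker = Nat.card (commutator G ⊓ Subgroup.center G : Subgroup G) := by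
    rw [← h2]
    exact (Subgroup.card_map_of_injective (Subgroup.subtype_injective _)).symm
  rw [← h1, ← h3, ← Subgroup.index_ker, mul_comm, Subgroup.card_mul_index]

lemma commutator_le_center_iff [Finite G] :
    commutator G ≤ Subgroup.center G ↔
      (Abelianization.of '' (Subgroup.center G : Set G)).ncard * Nat.card (commutator G) =
        Nat.card (Subgroup.center G) := by
  rw [← ncard_image_center_mul (G := G)]
  constructor
  · intro h
    rw [inf_eq_left.2 h]
  · intro h
    have hpos : 0 < (Abelianization.of '' (Subgroup.center G : Set G)).ncard := by
      rw [Set.ncard_pos (Set.toFinite _)]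
      exact ⟨_, 1, Subgroup.one_mem _, rfl⟩
    have h2 := Nat.eq_of_mul_eq_mul_left hpos h
    have h3 := Subgroup.eq_of_le_of_card_ge
      (inf_le_left : commutator G ⊓ Subgroup.center G ≤ commutator G) h2.le
    exact inf_eq_left.1 h3

lemma eq_top_of_sup_commutator (hclass : commutator G ≤ Subgroup.center G) {K : Subgroup G}
    (hK : K ⊔ commutator G = ⊤) : K = ⊤ := by
  have key : ∀ g : G, ∃ k ∈ K, ∃ c ∈ Subgroup.center G, k * c = g := by
    intro g
    have : g ∈ K ⊔ commutator G := hK ▸ Subgroup.mem_top g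
    obtain ⟨k, hk, c, hc, rfl⟩ := Subgroup.mem_sup_of_normal_right.1 this
    exact ⟨k, hk, c, hclass hc, rfl⟩
  have hle : commutator G ≤ K := by
    rw [commutator_def, Subgroup.commutator_le]
    intro g _ h _
    obtain ⟨k, hk, c, hc, rfl⟩ := key g
    obtain ⟨l, hl, e, he, rfl⟩ := key h
    have hc' := Subgroup.mem_center_iff.1 hc
    have he' := Subgroup.mem_center_iff.1 he
    have : ⁅k * c, l * e⁆ = ⁅k, l⁆ := by
      rw [commutatorElement_def, commutatorElement_def]
      have e1 : (k * c) * (l * e) = (k * l) * (c * e) := by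
        rw [mul_assoc, ← mul_assoc c l e, ← hc' l]; simp only [mul_assoc]
      have e2 : (l * e) * (k * c) = (l * k) * (c * e) := by
        rw [mul_assoc, ← mul_assoc e k c, ← he' k, mul_assoc k e c, hc' e, mul_assoc]
      rw [mul_assoc _ (k * c)⁻¹, mul_assoc _ k⁻¹, ← mul_inv_rev, ← mul_inv_rev, e1, e2]
      group
    rw [this]
    exact K.mul_mem (K.mul_mem (K.mul_mem hk hl) (K.inv_mem hk)) (K.inv_mem hl)
  rwa [sup_eq_left.2 hle] at hK

lemma eq_top_of_map_abelianization (hclass : commutator G ≤ Subgroup.center G) {K : Subgroup G}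
    (hK : K.map Abelianization.of = ⊤) : K = ⊤ := by
  apply eq_top_of_sup_commutator hclass
  have := congrArg (Subgroup.comap Abelianization.of) hK
  rwa [Subgroup.comap_map_eq, Abelianization.ker_of, Subgroup.comap_top] at this

lemma card_commutator_eq_one_iff [Finite G] :
    Nat.card (commutator G) = 1 ↔ ∀ x y : G, x * y = y * x := by
  rw [Subgroup.card_eq_one, commutator_def, Subgroup.commutator_eq_bot_iff_le_centralizer]
  constructor
  · intro h x y
    exact (Subgroup.mem_centralizer_iff.1 (h (Subgroup.mem_top y)) x (Set.mem_univ _))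
  · intro h x _
    rw [Subgroup.mem_centralizer_iff]
    intro y _
    exact h y x

variable {p : ℕ} [Fact p.Prime]

lemma exists_pair_of_card_le {E : Type*} [CommGroup E] [Finite E] (hE : IsPGroup p E)
    (hcard : Nat.card E ≤ p ^ 2) : ∃ x y : E, Subgroup.closure {x, y} = ⊤ := by
  have hp := (Fact.out : p.Prime)
  by_cases h1 : ∀ x : E, x = 1
  · exact ⟨1, 1, (Subgroup.eq_top_iff' _).2 fun x => by rw [h1 x]; exact Subgroup.one_mem _⟩
  push Not at h1
  obtain ⟨x, hx⟩ := h1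
  by_cases h2 : ∀ y, y ∈ Subgroup.zpowers x
  · refine ⟨x, 1, (Subgroup.eq_top_iff' _).2 fun y => ?_⟩
    have : Subgroup.zpowers x ≤ Subgroup.closure {x, 1} := by
      rw [Subgroup.zpowers_le]
      exact Subgroup.subset_closure (by simp)
    exact this (h2 y)
  push Not at h2
  obtain ⟨y, hy⟩ := h2
  refine ⟨x, y, ?_⟩
  have hlt : Subgroup.zpowers x < Subgroup.closure {x, y} := by
    refine lt_of_le_of_ne ?_ ?_
    · rw [Subgroup.zpowers_le]
      exact Subgroup.subset_closure (by simp)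
    · intro h
      exact hy (h ▸ Subgroup.subset_closure (by simp))
  obtain ⟨k, hk⟩ := IsPGroup.iff_card.1 (hE.to_subgroup (Subgroup.zpowers x))
  obtain ⟨l, hl⟩ := IsPGroup.iff_card.1 (hE.to_subgroup (Subgroup.closure {x, y}))
  have hk0 : k ≠ 0 := by
    rintro rfl
    rw [pow_zero, Subgroup.card_eq_one, Subgroup.zpowers_eq_bot] at hk
    exact hx hk
  have hkl : p ^ k < p ^ l := by
    rw [← hk, ← hl]
    by_contra hcon
    exact hlt.ne (Subgroup.eq_of_le_of_card_ge hlt.le (not_lt.1 hcon))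
  have hkl' := (Nat.pow_lt_pow_iff_right hp.one_lt).1 hkl
  apply Subgroup.eq_top_of_le_card
  rw [hl]
  exact hcard.trans (Nat.pow_le_pow_right hp.pos (by omega))

lemma card_quotient_range_powMonoidHom_le {Q : Type*} [CommGroup Q] [Finite Q]
    (hgen : ∃ x y : Q, Subgroup.closure {x, y} = ⊤) :
    Nat.card (Q ⧸ (powMonoidHom p : Q →* Q).range) ≤ p ^ 2 := by
  have hp := (Fact.out : p.Prime)
  obtain ⟨x, y, hxy⟩ := hgen
  set P := (powMonoidHom p : Q →* Q).range with hP
  have hpow : ∀ q : Q ⧸ P, q ^ p = 1 := by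
    intro q
    obtain ⟨q, rfl⟩ := QuotientGroup.mk_surjective q
    rw [← QuotientGroup.mk_pow, QuotientGroup.eq_one_iff]
    exact ⟨q, rfl⟩
  have hz : ∀ q : Q ⧸ P, Nat.card (Subgroup.zpowers q) ≤ p := by
    intro q
    rw [Nat.card_zpowers]
    exact Nat.le_of_dvd hp.pos (orderOf_dvd_of_pow_eq_one (hpow q))
  have hsurj : Function.Surjective
      (fun a : Subgroup.zpowers (x : Q ⧸ P) × Subgroup.zpowers (y : Q ⧸ P) =>
        (a.1 : Q ⧸ P) * (a.2 : Q ⧸ P)) := by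
    intro q
    obtain ⟨q, rfl⟩ := QuotientGroup.mk_surjective q
    have hq : q ∈ Subgroup.closure {x, y} := hxy ▸ Subgroup.mem_top q
    obtain ⟨m, n, rfl⟩ := Subgroup.mem_closure_pair.1 hq
    exact ⟨(⟨_, m, rfl⟩, ⟨_, n, rfl⟩), rfl⟩
  calc Nat.card (Q ⧸ P) ≤ _ := Nat.card_le_card_of_surjective _ hsurj
    _ = _ := Nat.card_prod _ _
    _ ≤ p * p := Nat.mul_le_mul (hz _) (hz _)
    _ = p ^ 2 := (sq p).symm

lemma eq_top_of_sup_range_powMonoidHom {Q : Type*} [CommGroup Q] [Finite Q] (hQ : IsPGroup p Q)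
    {N : Subgroup Q} (hN : N ⊔ (powMonoidHom p : Q →* Q).range = ⊤) : N = ⊤ := by
  have h1 : ∀ q : Q ⧸ N, ∃ r : Q ⧸ N, r ^ p = q := by
    intro q
    obtain ⟨q, rfl⟩ := QuotientGroup.mk_surjective q
    have : q ∈ N ⊔ (powMonoidHom p : Q →* Q).range := hN ▸ Subgroup.mem_top q
    obtain ⟨n, hn, _, ⟨r, rfl⟩, rfl⟩ := Subgroup.mem_sup.1 this
    refine ⟨r, ?_⟩
    rw [powMonoidHom_apply, QuotientGroup.mk_mul, (QuotientGroup.eq_one_iff n).2 hn, one_mul,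
      QuotientGroup.mk_pow]
  have h2 : ∀ n : ℕ, ∀ q : Q ⧸ N, ∃ r : Q ⧸ N, r ^ p ^ n = q := by
    intro n
    induction n with
    | zero => exact fun q => ⟨q, by simp⟩
    | succ n ih =>
      intro q
      obtain ⟨r, rfl⟩ := h1 q
      obtain ⟨s, rfl⟩ := ih r
      exact ⟨s, by rw [pow_succ, pow_mul]⟩
  obtain ⟨n, hn⟩ := IsPGroup.iff_card.1 (hQ.to_quotient N)
  rw [Subgroup.eq_top_iff']
  intro q
  obtain ⟨r, hr⟩ := h2 n (q : Q ⧸ N)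
  rw [← hn, pow_card_eq_one'] at hr
  exact (QuotientGroup.eq_one_iff q).1 hr.symm

lemma exists_pair_of_card_quotient_le [Finite G] (hG : IsPGroup p G)
    (hclass : commutator G ≤ Subgroup.center G)
    (hcard : Nat.card (Abelianization G ⧸
      (powMonoidHom p : Abelianization G →* Abelianization G).range) ≤ p ^ 2) :
    ∃ x y : G, Subgroup.closure {x, y} = ⊤ := by
  have hQ : IsPGroup p (Abelianization G) := hG.to_quotient (commutator G)
  obtain ⟨x, y, hxy⟩ := exists_pair_of_card_le (hQ.to_quotient _) hcard
  obtain ⟨x, rfl⟩ := QuotientGroup.mk_surjective x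
  obtain ⟨y, rfl⟩ := QuotientGroup.mk_surjective y
  obtain ⟨x, rfl⟩ : ∃ z, Abelianization.of z = x := QuotientGroup.mk_surjective x
  obtain ⟨y, rfl⟩ : ∃ z, Abelianization.of z = y := QuotientGroup.mk_surjective y
  refine ⟨x, y, eq_top_of_map_abelianization hclass (eq_top_of_sup_range_powMonoidHom hQ ?_)⟩
  have h := congrArg (Subgroup.comap (QuotientGroup.mk'
    (powMonoidHom p : Abelianization G →* Abelianization G).range)) hxy
  rw [Subgroup.comap_top] at h
  rw [← h]
  have h2 : Subgroup.map (QuotientGroup.mk'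
    (powMonoidHom p : Abelianization G →* Abelianization G).range)
      (Subgroup.map Abelianization.of (Subgroup.closure {x, y})) =
    Subgroup.closure {((Abelianization.of x : Abelianization G) : Abelianization G ⧸
      (powMonoidHom p : Abelianization G →* Abelianization G).range),
      ((Abelianization.of y : Abelianization G) : Abelianization G ⧸
      (powMonoidHom p : Abelianization G →* Abelianization G).range)} := by
    rw [MonoidHom.map_closure, MonoidHom.map_closure, Set.image_pair, Set.image_pair]
    rfl
  rw [← h2, Subgroup.comap_map_eq, QuotientGroup.ker_mk']

end ClassTwo

section Transfer

variable {F : Type*} [Field F] {G H : Type*} [Group G] [Group H] [Finite G] [Finite H]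
  {p : ℕ} [Fact p.Prime] [CharP F p]

omit [CharP F p] in
lemma isPGroup_of_algEquiv (e : MonoidAlgebra F G ≃ₐ[F] MonoidAlgebra F H) (hG : IsPGroup p G) :
    IsPGroup p H := by
  rw [IsPGroup.iff_card] at hG ⊢
  rwa [← card_eq_of_algEquiv e]

lemma card_abelianization_eq (e : MonoidAlgebra F G ≃ₐ[F] MonoidAlgebra F H) :
    Nat.card (Abelianization G) = Nat.card (Abelianization H) := by
  obtain ⟨e', -⟩ := exists_algEquiv_abelianization e
  exact card_eq_of_algEquiv e'

lemma card_commutator_eq (e : MonoidAlgebra F G ≃ₐ[F] MonoidAlgebra F H) :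
    Nat.card (commutator G) = Nat.card (commutator H) := by
  have h1 := card_abelianization_mul_card_commutator (G := G)
  rw [card_abelianization_eq e, card_eq_of_algEquiv e,
    ← card_abelianization_mul_card_commutator (G := H)] at h1
  exact Nat.eq_of_mul_eq_mul_left Nat.card_pos h1

lemma commutator_le_center_of_algEquiv (e : MonoidAlgebra F G ≃ₐ[F] MonoidAlgebra F H)
    (hG : IsPGroup p G) (hclass : commutator G ≤ Subgroup.center G) :
    commutator H ≤ Subgroup.center H := by
  have hH := isPGroup_of_algEquiv e hG
  rw [commutator_le_center_iff] at hclass ⊢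
  rwa [← card_commutator_eq e, ← ncard_image_center_eq hG hH e, ← card_center_eq hG hH e]

lemma ncard_abelianization_powers_eq (e : MonoidAlgebra F G ≃ₐ[F] MonoidAlgebra F H) (n : ℕ) :
    (Set.range fun g : Abelianization G => g ^ p ^ n).ncard =
      (Set.range fun g : Abelianization H => g ^ p ^ n).ncard := by
  obtain ⟨e', -⟩ := exists_algEquiv_abelianization e
  refine ncard_powers_eq p e' n (fun g => ?_) fun g => ?_ <;>
  · rw [CommGroup.center_eq_top]
    exact Subgroup.mem_top _

lemma two_generated_of_algEquiv (e : MonoidAlgebra F G ≃ₐ[F] MonoidAlgebra F H)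
    (hG : IsPGroup p G) (hclass : commutator G ≤ Subgroup.center G)
    (hgen : ∃ x y : G, Subgroup.closure {x, y} = ⊤) :
    ∃ x y : H, Subgroup.closure {x, y} = ⊤ := by
  refine exists_pair_of_card_quotient_le (isPGroup_of_algEquiv e hG)
    (commutator_le_center_of_algEquiv e hG hclass) ?_
  have hgen' : ∃ x y : Abelianization G, Subgroup.closure {x, y} = ⊤ := by
    obtain ⟨x, y, hxy⟩ := hgen
    refine ⟨Abelianization.of x, Abelianization.of y, ?_⟩
    have := congrArg (Subgroup.map Abelianization.of) hxy
    rwa [MonoidHom.map_closure, Set.image_pair,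
      Subgroup.map_top_of_surjective _ QuotientGroup.mk_surjective] at this
  have h1 := card_quotient_range_powMonoidHom_le (p := p) hgen'
  have h2 := Subgroup.card_eq_card_quotient_mul_card_subgroup
    (powMonoidHom p : Abelianization G →* Abelianization G).range
  have h3 := Subgroup.card_eq_card_quotient_mul_card_subgroup
    (powMonoidHom p : Abelianization H →* Abelianization H).range
  have h4 : Nat.card (powMonoidHom p : Abelianization G →* Abelianization G).range =
      Nat.card (powMonoidHom p : Abelianization H →* Abelianization H).range := by
    have := ncard_abelianization_powers_eq e 1 (p := p)
    rw [pow_one, ← Nat.card_coe_set_eq, ← Nat.card_coe_set_eq] at this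
    exact this
  rw [card_abelianization_eq e, h4, h3] at h2
  rw [Nat.eq_of_mul_eq_mul_right Nat.card_pos h2]
  exact h1

end Transfer

section StandardForm

/-- The defining relations of the two-generated `p`-groups of class two: `d` is the commutator of
`y` and `x`, it is central of order dividing `p ^ m`, and `x ^ p ^ a`, `y ^ p ^ b` are
powers of `d`. -/
structure Rel (p a b m u v : ℕ) {K : Type*} [Monoid K] (x y d : K) : Prop where
  comm : y * x = x * y * d
  comm_x : x * d = d * x
  comm_y : y * d = d * y
  pow_d : d ^ p ^ m = 1
  pow_x : x ^ p ^ a = d ^ u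
  pow_y : y ^ p ^ b = d ^ v

/-- A generating triple satisfying the relations `Rel`, in a group of the maximal order
`p ^ (a + b + m)` allowed by these relations. -/
structure Std (p a b m u v : ℕ) {G : Type*} [Group G] (x y d : G) : Prop
    extends Rel p a b m u v x y d where
  gen : Subgroup.closure {x, y} = ⊤
  card : p ^ (a + b + m) ≤ Nat.card G

/-- The normal form `x ^ i * y ^ j * d ^ k`. -/
def nf {K : Type*} [Monoid K] (x y d : K) (i j k : ℕ) : K := x ^ i * y ^ j * d ^ k

namespace Rel

variable {p a b m u v : ℕ} {K : Type*} [Monoid K] {x y d : K} (h : Rel p a b m u v x y d)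

include h

lemma y_mul_pow (i : ℕ) : y * x ^ i = x ^ i * y * d ^ i := by
  have hx : ∀ n, Commute (d ^ n) x := fun n => (show Commute d x from h.comm_x.symm).pow_left n
  induction i with
  | zero => simp
  | succ i ih =>
    rw [pow_succ, ← mul_assoc, ih, mul_assoc _ (d ^ i) x, (hx i).eq, ← mul_assoc,
      mul_assoc (x ^ i) y x, h.comm, pow_succ' d]
    simp only [mul_assoc]

lemma pow_mul_pow (i j : ℕ) : y ^ j * x ^ i = x ^ i * y ^ j * d ^ (i * j) := by
  have hy : ∀ n, Commute (d ^ n) y := fun n => (show Commute d y from h.comm_y.symm).pow_left n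
  induction j with
  | zero => simp
  | succ j ih =>
    rw [pow_succ', mul_assoc, ih, ← mul_assoc, ← mul_assoc, h.y_mul_pow,
      mul_assoc (x ^ i * y), ((hy i).pow_right j).eq, ← mul_assoc, mul_assoc (x ^ i) y,
      mul_assoc _ (d ^ i), ← pow_add, mul_add, mul_one, add_comm i]

lemma commute_nf (n i j k : ℕ) : Commute (d ^ n) (nf x y d i j k) := by
  have hx : Commute d x := h.comm_x.symm
  have hy : Commute d y := h.comm_y.symm
  exact (((hx.pow_right i).mul_right (hy.pow_right j)).mul_right
    ((Commute.refl d).pow_right k)).pow_left n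

lemma nf_mul (i j k i' j' k' : ℕ) :
    nf x y d i j k * nf x y d i' j' k' = nf x y d (i + i') (j + j') (k + k' + i' * j) := by
  have hc := h.commute_nf k i' j' k'
  have hy : ∀ n, Commute (d ^ n) y := fun n => (show Commute d y from h.comm_y.symm).pow_left n
  calc nf x y d i j k * nf x y d i' j' k'
      = x ^ i * y ^ j * (d ^ k * nf x y d i' j' k') := by simp only [nf, mul_assoc]
    _ = x ^ i * (y ^ j * x ^ i') * (y ^ j' * d ^ k' * d ^ k) := by
        rw [hc.eq]; simp only [nf, mul_assoc]
    _ = x ^ i * x ^ i' * y ^ j * (d ^ (i' * j) * y ^ j') * d ^ k' * d ^ k := by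
        rw [h.pow_mul_pow]; simp only [mul_assoc]
    _ = (x ^ i * x ^ i') * (y ^ j * y ^ j') * (d ^ (i' * j) * d ^ k' * d ^ k) := by
        rw [((hy (i' * j)).pow_right j').eq]; simp only [mul_assoc]
    _ = _ := by
        rw [← pow_add, ← pow_add, ← pow_add, ← pow_add, nf]
        congr 2
        ring

lemma nf_pow (i j k n : ℕ) :
    nf x y d i j k ^ n = nf x y d (n * i) (n * j) (n * k + i * j * n.choose 2) := by
  induction n with
  | zero => simp [nf]
  | succ n ih =>
    rw [pow_succ, ih, h.nf_mul]
    have : (n + 1).choose 2 = n + n.choose 2 := by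
      rw [Nat.choose_succ_succ' n 1, Nat.choose_one_right]
    rw [this]
    congr 1 <;> ring

lemma pow_d_mod (k : ℕ) : d ^ k = d ^ (k % p ^ m) := by
  conv_lhs => rw [← Nat.div_add_mod k (p ^ m), pow_add, pow_mul, h.pow_d, one_pow, one_mul]

lemma nf_reduce (i j k : ℕ) : nf x y d i j k =
    nf x y d (i % p ^ a) (j % p ^ b) ((k + u * (i / p ^ a) + v * (j / p ^ b)) % p ^ m) := by
  have hx : x ^ i = x ^ (i % p ^ a) * d ^ (u * (i / p ^ a)) := by
    conv_lhs => rw [← Nat.mod_add_div i (p ^ a), pow_add, pow_mul x (p ^ a), h.pow_x, ← pow_mul]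
  have hy : y ^ j = y ^ (j % p ^ b) * d ^ (v * (j / p ^ b)) := by
    conv_lhs => rw [← Nat.mod_add_div j (p ^ b), pow_add, pow_mul y (p ^ b), h.pow_y, ← pow_mul]
  have hc : Commute (d ^ (u * (i / p ^ a))) (y ^ (j % p ^ b)) :=
    ((show Commute d y from h.comm_y.symm).pow_left _).pow_right _
  rw [nf, nf, ← h.pow_d_mod, hx, hy, mul_assoc (x ^ _), ← mul_assoc (d ^ _), hc.eq, pow_add,
    pow_add, (Commute.pow_pow_self d k _).eq, mul_assoc _ (d ^ k),
    (Commute.pow_pow_self d k _).eq]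
  simp only [mul_assoc]

end Rel

namespace Std

variable {p a b m u v : ℕ} {G : Type*} [Group G] {x y d : G}
  (h : Std p a b m u v x y d)

include h

lemma exists_nf [Finite G] (g : G) : ∃ i j k, g = nf x y d i j k := by
  have hg : g ∈ Subgroup.closure {x, y} := h.gen ▸ Subgroup.mem_top g
  induction hg using Subgroup.closure_induction with
  | mem z hz =>
    rcases hz with rfl | rfl
    · exact ⟨1, 0, 0, by simp [nf]⟩
    · exact ⟨0, 1, 0, by simp [nf]⟩
  | one => exact ⟨0, 0, 0, by simp [nf]⟩
  | mul g g' _ _ hg hg' =>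
    obtain ⟨i, j, k, rfl⟩ := hg
    obtain ⟨i', j', k', rfl⟩ := hg'
    exact ⟨_, _, _, h.toRel.nf_mul _ _ _ _ _ _⟩
  | inv g _ hg =>
    obtain ⟨i, j, k, hg⟩ := hg
    refine ⟨_, _, _, Eq.trans ?_ (h.toRel.nf_pow i j k (orderOf g - 1))⟩
    rw [← hg]
    apply inv_eq_of_mul_eq_one_left
    rw [← pow_succ, Nat.sub_add_cancel (orderOf_pos g), pow_orderOf_eq_one]

variable [Fact p.Prime] [Finite G]

lemma bijective_nf : Function.Bijective (fun t : Fin (p ^ a) × Fin (p ^ b) × Fin (p ^ m) =>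
    nf x y d t.1 t.2.1 t.2.2) := by
  have hp := (Fact.out : p.Prime)
  have hsurj : Function.Surjective (fun t : Fin (p ^ a) × Fin (p ^ b) × Fin (p ^ m) =>
      nf x y d t.1 t.2.1 t.2.2) := by
    intro g
    obtain ⟨i, j, k, rfl⟩ := h.exists_nf g
    exact ⟨(⟨_, Nat.mod_lt i (pow_pos hp.pos a)⟩, ⟨_, Nat.mod_lt j (pow_pos hp.pos b)⟩,
      ⟨_, Nat.mod_lt _ (pow_pos hp.pos m)⟩), (h.toRel.nf_reduce i j k).symm⟩
  refine hsurj.bijective_of_nat_card_le ?_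
  rw [Nat.card_prod, Nat.card_prod, Nat.card_fin, Nat.card_fin, Nat.card_fin]
  refine le_trans (le_of_eq ?_) h.card
  ring

lemma card_eq : Nat.card G = p ^ (a + b + m) := by
  rw [← Nat.card_congr (Equiv.ofBijective _ h.bijective_nf), Nat.card_prod, Nat.card_prod,
    Nat.card_fin, Nat.card_fin, Nat.card_fin]
  ring

lemma mod_eq_of_nf_eq {i j k i' j' k' : ℕ} (he : nf x y d i j k = nf x y d i' j' k') :
    i % p ^ a = i' % p ^ a ∧ j % p ^ b = j' % p ^ b ∧
      (k + u * (i / p ^ a) + v * (j / p ^ b)) % p ^ m =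
        (k' + u * (i' / p ^ a) + v * (j' / p ^ b)) % p ^ m := by
  have hp := (Fact.out : p.Prime)
  rw [h.toRel.nf_reduce, h.toRel.nf_reduce i'] at he
  have := h.bijective_nf.1 (a₁ := (⟨_, Nat.mod_lt i (pow_pos hp.pos a)⟩,
    ⟨_, Nat.mod_lt j (pow_pos hp.pos b)⟩, ⟨_, Nat.mod_lt _ (pow_pos hp.pos m)⟩))
    (a₂ := (⟨_, Nat.mod_lt i' (pow_pos hp.pos a)⟩,
    ⟨_, Nat.mod_lt j' (pow_pos hp.pos b)⟩, ⟨_, Nat.mod_lt _ (pow_pos hp.pos m)⟩)) he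
  simpa only [Prod.mk.injEq, Fin.mk.injEq] using this

lemma exists_hom {K : Type*} [Monoid K] {x' y' d' : K} (h' : Rel p a b m u v x' y' d') :
    ∃ f : G →* K, ∀ i j k, f (nf x y d i j k) = nf x' y' d' i j k := by
  have key : ∀ {i j k i' j' k'}, nf x y d i j k = nf x y d i' j' k' →
      nf x' y' d' i j k = nf x' y' d' i' j' k' := by
    intro i j k i' j' k' he
    obtain ⟨h1, h2, h3⟩ := h.mod_eq_of_nf_eq he
    rw [h'.nf_reduce, h1, h2, h3, ← h'.nf_reduce]
  choose I J L hIJL using h.exists_nf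
  have hf : ∀ i j k, nf x' y' d' (I (nf x y d i j k)) (J (nf x y d i j k)) (L (nf x y d i j k)) =
      nf x' y' d' i j k := fun i j k => key (hIJL _).symm
  refine ⟨⟨⟨fun g => nf x' y' d' (I g) (J g) (L g), ?_⟩, ?_⟩, hf⟩
  · have := hf 0 0 0
    simpa [nf] using this
  · intro g g'
    change nf x' y' d' (I (g * g')) (J (g * g')) (L (g * g')) = _
    rw [h'.nf_mul]
    exact key (by rw [← hIJL, ← h.toRel.nf_mul, ← hIJL, ← hIJL])

lemma nonempty_mulEquiv {H : Type*} [Group H] [Finite H] {x' y' d' : H}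
    (h' : Std p a b m u v x' y' d') : Nonempty (G ≃* H) := by
  obtain ⟨f, hf⟩ := h.exists_hom h'.toRel
  have hbij : Function.Bijective f := by
    rw [Nat.bijective_iff_surjective_and_card]
    refine ⟨fun g => ?_, h.card_eq.trans h'.card_eq.symm⟩
    obtain ⟨i, j, k, rfl⟩ := h'.exists_nf g
    exact ⟨_, hf i j k⟩
  exact ⟨MulEquiv.ofBijective f hbij⟩

end Std

end StandardForm

section Existence

open commutatorElement

variable {G : Type*} [Group G]

lemma mem_center_of_closure_pair {x y z : G} (hgen : Subgroup.closure {x, y} = ⊤)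
    (hx : x * z = z * x) (hy : y * z = z * y) : z ∈ Subgroup.center G := by
  rw [Subgroup.mem_center_iff]
  intro g
  have hle : Subgroup.closure {x, y} ≤ Subgroup.centralizer {z} := by
    rw [Subgroup.closure_le]
    rintro w (rfl | rfl)
    · exact Subgroup.mem_centralizer_singleton_iff.2 hx
    · exact Subgroup.mem_centralizer_singleton_iff.2 hy
  exact Subgroup.mem_centralizer_singleton_iff.1 (hle (hgen ▸ Subgroup.mem_top g))

lemma mul_comm_of_closure_pair {x y : G} (hgen : Subgroup.closure {x, y} = ⊤)
    (hxy : y * x = x * y) (g h : G) : g * h = h * g := by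
  have hx := Subgroup.mem_center_iff.1 (mem_center_of_closure_pair hgen rfl hxy)
  have hy := Subgroup.mem_center_iff.1 (mem_center_of_closure_pair hgen hxy.symm rfl)
  exact (Subgroup.mem_center_iff.1 (mem_center_of_closure_pair hgen (hx g).symm (hy g).symm) h).symm

lemma commutator_eq_zpowers {x y d : G} (hgen : Subgroup.closure {x, y} = ⊤)
    (hxy : y * x = x * y * d) (hx : x * d = d * x) (hy : y * d = d * y) :
    commutator G = Subgroup.zpowers d := by
  apply le_antisymm
  · have hd := mem_center_of_closure_pair hgen hx hy
    have hN : (Subgroup.zpowers d).Normal := by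
      refine ⟨fun n hn g => ?_⟩
      have hn' : n ∈ Subgroup.center G := (Subgroup.zpowers_le.2 hd) hn
      rw [Subgroup.mem_center_iff.1 hn' g, mul_inv_cancel_right]
      exact hn
    rw [← Subgroup.Normal.quotient_commutative_iff_commutator_le]
    refine ⟨⟨mul_comm_of_closure_pair (x := (x : G ⧸ Subgroup.zpowers d)) (y := y) ?_ ?_⟩⟩
    · have := congrArg (Subgroup.map (QuotientGroup.mk' (Subgroup.zpowers d))) hgen
      rwa [MonoidHom.map_closure, Set.image_pair,
        Subgroup.map_top_of_surjective _ (QuotientGroup.mk'_surjective _)] at this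
    · rw [← QuotientGroup.mk_mul, hxy, QuotientGroup.mk_mul,
        (QuotientGroup.eq_one_iff d).2 (Subgroup.mem_zpowers d), mul_one, QuotientGroup.mk_mul]
  · rw [Subgroup.zpowers_le]
    have : d = ⁅y⁻¹, x⁻¹⁆ := by
      rw [commutatorElement_def, inv_inv, inv_inv, mul_assoc, hxy]
      group
    rw [this, commutator_def]
    exact Subgroup.commutator_mem_commutator (Subgroup.mem_top _) (Subgroup.mem_top _)

lemma mem_commutator_iff [Finite G] {x y d : G} (hgen : Subgroup.closure {x, y} = ⊤)
    (hxy : y * x = x * y * d) (hx : x * d = d * x) (hy : y * d = d * y) {g : G} :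
    g ∈ commutator G ↔ ∃ k : ℕ, g = d ^ k := by
  rw [commutator_eq_zpowers hgen hxy hx hy, ← mem_powers_iff_mem_zpowers, Submonoid.mem_powers_iff]
  exact exists_congr fun k => eq_comm

variable {p : ℕ} [Fact p.Prime]

lemma exists_abelian_basis_of_le {Q : Type*} [CommGroup Q] [Finite Q] (hQ : IsPGroup p Q)
    {x y : Q} (hgen : Subgroup.closure {x, y} = ⊤) (hle : orderOf y ≤ orderOf x) :
    ∃ (x y : Q) (a b : ℕ), b ≤ a ∧ x ^ p ^ a = 1 ∧ y ^ p ^ b = 1 ∧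
      Subgroup.closure {x, y} = ⊤ ∧ p ^ (a + b) ≤ Nat.card Q := by
  have hp := (Fact.out : p.Prime)
  obtain ⟨a, ha⟩ := IsPGroup.iff_orderOf.1 hQ x
  obtain ⟨c, hc⟩ := IsPGroup.iff_orderOf.1 hQ y
  obtain ⟨b, hb⟩ := IsPGroup.iff_orderOf.1 (hQ.to_quotient (Subgroup.zpowers x))
    (y : Q ⧸ Subgroup.zpowers x)
  have hca : c ≤ a := by
    rw [ha, hc] at hle
    exact (Nat.pow_le_pow_iff_right hp.one_lt).1 hle
  have hbc : b ≤ c := by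
    have : orderOf (y : Q ⧸ Subgroup.zpowers x) ∣ orderOf y :=
      orderOf_map_dvd (QuotientGroup.mk' (Subgroup.zpowers x)) y
    rw [hb, hc] at this
    exact (Nat.pow_dvd_pow_iff_le_right hp.one_lt).1 this
  have hxa : x ^ p ^ a = 1 := by rw [← ha, pow_orderOf_eq_one]
  have hyk : y ^ p ^ b ∈ Subgroup.zpowers x := by
    rw [← QuotientGroup.eq_one_iff, QuotientGroup.mk_pow, ← hb, pow_orderOf_eq_one]
  rw [← mem_powers_iff_mem_zpowers] at hyk
  obtain ⟨k, hk⟩ := hyk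
  simp only at hk
  have hya : y ^ p ^ a = 1 := by
    rw [← orderOf_dvd_iff_pow_eq_one, hc]
    exact pow_dvd_pow p hca
  have hk' : p ^ b ∣ k := by
    have h1 : x ^ (k * p ^ (a - b)) = 1 := by
      rw [pow_mul, hk, ← pow_mul, ← pow_add, Nat.add_sub_cancel' (hbc.trans hca), hya]
    rw [← orderOf_dvd_iff_pow_eq_one, ha] at h1
    rw [← Nat.mul_dvd_mul_iff_right (pow_pos hp.pos (a - b)), ← pow_add,
      Nat.add_sub_cancel' (hbc.trans hca)]
    exact h1
  obtain ⟨l, rfl⟩ := hk'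
  refine ⟨x, y * x ^ (l * (p ^ a - 1)), a, b, hbc.trans hca, hxa, ?_, ?_, ?_⟩
  · rw [mul_pow, ← hk, ← pow_mul, ← pow_add]
    have : p ^ b * l + l * (p ^ a - 1) * p ^ b = p ^ a * (p ^ b * l) := by
      obtain ⟨q, hq⟩ : ∃ q, p ^ a = q + 1 := ⟨p ^ a - 1, by have := pow_pos hp.pos a; omega⟩
      rw [hq, Nat.add_sub_cancel]
      ring
    rw [this, pow_mul, hxa, one_pow]
  · rw [eq_top_iff, ← hgen, Subgroup.closure_le]
    have hx : x ∈ Subgroup.closure {x, y * x ^ (l * (p ^ a - 1))} :=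
      Subgroup.subset_closure (by simp)
    have hy : y * x ^ (l * (p ^ a - 1)) ∈ Subgroup.closure {x, y * x ^ (l * (p ^ a - 1))} :=
      Subgroup.subset_closure (by simp)
    rintro w (rfl | rfl)
    · exact hx
    · have := Subgroup.mul_mem _ hy (Subgroup.inv_mem _ (Subgroup.pow_mem _ hx (l * (p ^ a - 1))))
      rwa [mul_inv_cancel_right] at this
  · rw [Subgroup.card_eq_card_quotient_mul_card_subgroup (Subgroup.zpowers x), Nat.card_zpowers, ha,
      add_comm, pow_add, ← hb, ← Nat.card_zpowers]
    exact Nat.mul_le_mul_right _ (Subgroup.card_le_card_group _)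

lemma exists_abelian_basis {Q : Type*} [CommGroup Q] [Finite Q] (hQ : IsPGroup p Q)
    (hgen : ∃ x y : Q, Subgroup.closure {x, y} = ⊤) :
    ∃ (x y : Q) (a b : ℕ), b ≤ a ∧ x ^ p ^ a = 1 ∧ y ^ p ^ b = 1 ∧
      Subgroup.closure {x, y} = ⊤ ∧ p ^ (a + b) ≤ Nat.card Q := by
  obtain ⟨x, y, hxy⟩ := hgen
  rcases le_total (orderOf y) (orderOf x) with h | h
  · exact exists_abelian_basis_of_le hQ hxy h
  · exact exists_abelian_basis_of_le hQ (Set.pair_comm x y ▸ hxy) h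

lemma closure_pair_abelianization {x y : G} (hxy : Subgroup.closure {x, y} = ⊤) :
    Subgroup.closure {Abelianization.of x, Abelianization.of y} = ⊤ := by
  have := congrArg (Subgroup.map Abelianization.of) hxy
  rwa [MonoidHom.map_closure, Set.image_pair,
    Subgroup.map_top_of_surjective _ QuotientGroup.mk_surjective] at this

lemma abelianization_of_eq_one_iff {g : G} : Abelianization.of g = 1 ↔ g ∈ commutator G := by
  rw [← MonoidHom.mem_ker, Abelianization.ker_of]

lemma exists_std [Finite G] (hG : IsPGroup p G) (hgen : ∃ x y : G, Subgroup.closure {x, y} = ⊤)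
    (hnonab : ¬ ∀ x y : G, x * y = y * x) (hclass : commutator G ≤ Subgroup.center G) :
    ∃ (a b m u v : ℕ) (x y d : G), m ≠ 0 ∧ m ≤ b ∧ b ≤ a ∧ Std p a b m u v x y d := by
  have hp := (Fact.out : p.Prime)
  have hgen' : ∃ x y : Abelianization G, Subgroup.closure {x, y} = ⊤ := by
    obtain ⟨x, y, hxy⟩ := hgen
    exact ⟨_, _, closure_pair_abelianization hxy⟩
  obtain ⟨x, y, a, b, hba, hx, hy, hxy, hcard⟩ :=
    exists_abelian_basis (hG.to_quotient (commutator G) : IsPGroup p (Abelianization G)) hgen'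
  obtain ⟨x, rfl⟩ : ∃ z, Abelianization.of z = x := QuotientGroup.mk_surjective x
  obtain ⟨y, rfl⟩ : ∃ z, Abelianization.of z = y := QuotientGroup.mk_surjective y
  rw [← map_pow, abelianization_of_eq_one_iff] at hx hy
  have htop : Subgroup.closure {x, y} = ⊤ := by
    apply eq_top_of_map_abelianization hclass
    rw [MonoidHom.map_closure, Set.image_pair, hxy]
  set d : G := ⁅y⁻¹, x⁻¹⁆ with hd
  have hdc : d ∈ Subgroup.center G := hclass
    (Subgroup.commutator_mem_commutator (Subgroup.mem_top _) (Subgroup.mem_top _))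
  have hdc' := Subgroup.mem_center_iff.1 hdc
  have hcomm : y * x = x * y * d := by
    rw [hd, commutatorElement_def]; group
  obtain ⟨u, hu⟩ := (mem_commutator_iff htop hcomm (hdc' x) (hdc' y)).1 hx
  obtain ⟨v, hv⟩ := (mem_commutator_iff htop hcomm (hdc' x) (hdc' y)).1 hy
  obtain ⟨m, hm⟩ := IsPGroup.iff_orderOf.1 hG d
  have hrel : Rel p a b m u v x y d :=
    ⟨hcomm, hdc' x, hdc' y, by rw [← hm, pow_orderOf_eq_one], hu, hv⟩
  refine ⟨a, b, m, u, v, x, y, d, ?_, ?_, hba, hrel, htop, ?_⟩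
  · rintro rfl
    have : d = 1 := by simpa using hrel.pow_d
    rw [this, mul_one] at hcomm
    exact hnonab (mul_comm_of_closure_pair htop hcomm)
  · have h1 := hrel.pow_mul_pow 1 (p ^ b)
    rw [pow_one, hv, one_mul] at h1
    have h2 : d ^ v * x = x * d ^ v := ((show Commute d x from (hdc' x).symm).pow_left v).eq
    rw [h2] at h1
    have h3 := left_eq_mul.1 h1
    rw [← orderOf_dvd_iff_pow_eq_one, hm] at h3
    exact (Nat.pow_dvd_pow_iff_le_right hp.one_lt).1 h3
  · rw [← card_abelianization_mul_card_commutator,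
      commutator_eq_zpowers htop hcomm (hdc' x) (hdc' y), Nat.card_zpowers, hm, pow_add]
    exact Nat.mul_le_mul_right _ hcard

end Existence

namespace Std

variable {p a b m u v : ℕ} {G : Type*} [Group G] {x y d : G}
  (h : Std p a b m u v x y d)

include h

lemma d_mem_center : d ∈ Subgroup.center G := mem_center_of_closure_pair h.gen h.comm_x h.comm_y

variable [Fact p.Prime] [Finite G]

lemma orderOf_d : orderOf d = p ^ m := by
  have hp := (Fact.out : p.Prime)
  apply Nat.dvd_antisymm
  · exact orderOf_dvd_of_pow_eq_one h.pow_d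
  · have h1 : nf x y d 0 0 (orderOf d) = nf x y d 0 0 0 := by simp [nf, pow_orderOf_eq_one]
    obtain ⟨-, -, h3⟩ := h.mod_eq_of_nf_eq h1
    simpa [Nat.dvd_iff_mod_eq_zero] using h3

lemma card_commutator : Nat.card (commutator G) = p ^ m := by
  rw [commutator_eq_zpowers h.gen h.comm h.comm_x h.comm_y, Nat.card_zpowers, h.orderOf_d]

lemma card_abelianization : Nat.card (Abelianization G) = p ^ (a + b) := by
  have hp := (Fact.out : p.Prime)
  have h1 := card_abelianization_mul_card_commutator (G := G)
  rw [h.card_commutator, h.card_eq, pow_add _ (a + b)] at h1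
  exact Nat.eq_of_mul_eq_mul_right (pow_pos hp.pos m) h1

omit [Fact p.Prime] in
lemma mem_commutator_iff {g : G} : g ∈ commutator G ↔ ∃ k : ℕ, g = d ^ k :=
  ModularIsomorphism.mem_commutator_iff h.gen h.comm h.comm_x h.comm_y

lemma pow_mem_commutator_iff (hba : b ≤ a) (n : ℕ) :
    (∀ g : G, g ^ p ^ n ∈ commutator G) ↔ a ≤ n := by
  have hp := (Fact.out : p.Prime)
  constructor
  · intro hall
    obtain ⟨k, hk⟩ := h.mem_commutator_iff.1 (hall x)
    have h1 : nf x y d (p ^ n) 0 0 = nf x y d 0 0 k := by simp [nf, hk]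
    obtain ⟨h2, -, -⟩ := h.mod_eq_of_nf_eq h1
    rw [Nat.zero_mod, ← Nat.dvd_iff_mod_eq_zero] at h2
    exact (Nat.pow_dvd_pow_iff_le_right hp.one_lt).1 h2
  · intro han g
    obtain ⟨i, j, k, rfl⟩ := h.exists_nf g
    rw [h.toRel.nf_pow, h.toRel.nf_reduce,
      (Nat.dvd_iff_mod_eq_zero).1 ((pow_dvd_pow p han).mul_right i),
      (Nat.dvd_iff_mod_eq_zero).1 ((pow_dvd_pow p (hba.trans han)).mul_right j)]
    exact h.mem_commutator_iff.2 ⟨_, by simp only [nf, pow_zero, one_mul]; rfl⟩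

lemma ncard_abelianization_powers_eq_one_iff (hba : b ≤ a) (n : ℕ) :
    (Set.range fun g : Abelianization G => g ^ p ^ n).ncard = 1 ↔ a ≤ n := by
  have hp := (Fact.out : p.Prime)
  rw [← h.pow_mem_commutator_iff hba, Set.ncard_eq_one]
  constructor
  · rintro ⟨z, hz⟩ g
    have h1 : (1 : Abelianization G) ∈ ({z} : Set _) := hz ▸ ⟨1, one_pow _⟩
    have h2 : (Abelianization.of g) ^ p ^ n ∈ ({z} : Set _) := hz ▸ ⟨_, rfl⟩
    rw [Set.mem_singleton_iff] at h1 h2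
    rw [← abelianization_of_eq_one_iff, map_pow, h2, h1]
  · intro hall
    refine ⟨1, Set.eq_singleton_iff_unique_mem.2 ⟨⟨1, one_pow _⟩, ?_⟩⟩
    rintro _ ⟨g, rfl⟩
    obtain ⟨g, rfl⟩ : ∃ z, Abelianization.of z = g := QuotientGroup.mk_surjective g
    simp only
    rw [← map_pow, abelianization_of_eq_one_iff]
    exact hall g

lemma params_eq {F : Type*} [Field F] [CharP F p] {H : Type*} [Group H] [Finite H]
    {a' b' m' u' v' : ℕ} {x' y' d' : H} (h' : Std p a' b' m' u' v' x' y' d')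
    (hba : b ≤ a) (hba' : b' ≤ a') (e : MonoidAlgebra F G ≃ₐ[F] MonoidAlgebra F H) :
    a = a' ∧ b = b' ∧ m = m' := by
  have hp := (Fact.out : p.Prime)
  have h1 := card_commutator_eq e
  rw [h.card_commutator, h'.card_commutator] at h1
  have h2 := card_abelianization_eq e
  rw [h.card_abelianization, h'.card_abelianization] at h2
  have h3 : ∀ n, a ≤ n ↔ a' ≤ n := fun n => by
    rw [← h.ncard_abelianization_powers_eq_one_iff hba, ncard_abelianization_powers_eq e,
      h'.ncard_abelianization_powers_eq_one_iff hba']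
  have ha : a = a' := le_antisymm ((h3 a').2 le_rfl) ((h3 a).1 le_rfl)
  have hm := Nat.pow_right_injective hp.two_le h1
  have hab := Nat.pow_right_injective hp.two_le h2
  omega

end Std

lemma Rel.pow_d_congr {p a b m u v : ℕ} {K : Type*} [Monoid K] {x y d : K}
    (h : Rel p a b m u v x y d) {k l : ℕ} (hkl : k ≡ l [MOD p ^ m]) : d ^ k = d ^ l := by
  rw [h.pow_d_mod k, h.pow_d_mod l, hkl]

lemma exists_coprime_modEq {p : ℕ} [Fact p.Prime] (m u : ℕ) :
    ∃ r ≤ m, ∃ l, p.Coprime l ∧ u ≡ l * p ^ r [MOD p ^ m] := by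
  have hp := (Fact.out : p.Prime)
  by_cases hu : p ^ m ∣ u
  · refine ⟨m, le_rfl, 1, Nat.coprime_one_right p, ?_⟩
    rw [one_mul]
    exact ((Nat.modEq_zero_iff_dvd).2 hu).trans ((Nat.modEq_zero_iff_dvd).2 dvd_rfl).symm
  · have hu0 : u ≠ 0 := by rintro rfl; exact hu (dvd_zero _)
    obtain ⟨r, l, hl, rfl⟩ := Nat.exists_eq_pow_mul_and_not_dvd hu0 p hp.ne_one
    refine ⟨r, ?_, l, (Nat.Prime.coprime_iff_not_dvd hp).2 hl, ?_⟩
    · by_contra hr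
      exact hu ((pow_dvd_pow p (not_le.1 hr).le).mul_right l)
    · rw [mul_comm]

lemma dvd_choose_two {p a m : ℕ} (hp : p.Prime) (hma : m ≤ a) (hreg : p ≠ 2 ∨ m < a) :
    p ^ m ∣ (p ^ a).choose 2 := by
  rcases hp.eq_two_or_odd' with rfl | hodd
  · have hma' : m < a := by simpa using hreg
    obtain ⟨c, rfl⟩ : ∃ c, a = c + 1 := ⟨a - 1, by omega⟩
    rw [Nat.choose_two_right, pow_succ, mul_comm (2 ^ c), mul_assoc,
      Nat.mul_div_cancel_left _ two_pos]
    exact (pow_dvd_pow 2 (by omega)).mul_right _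
  · have h2 : p ^ a ∣ (p ^ a).choose 2 * 2 := by
      rw [Nat.choose_two_right, Nat.div_mul_cancel (Nat.even_mul_pred_self _).two_dvd]
      exact dvd_mul_right _ _
    refine (pow_dvd_pow p hma).trans (Nat.Coprime.dvd_of_dvd_mul_right ?_ h2)
    exact (Nat.coprime_two_right.2 hodd).pow_left a

namespace Std

variable {p a b m u v : ℕ} {G : Type*} [Group G] {x y d : G}
  (h : Std p a b m u v x y d)

include h

lemma scale [Fact p.Prime] [Finite G] (hG : IsPGroup p G) {i l u' v' : ℕ} (hi : p.Coprime i)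
    (hl : p.Coprime l) (hu : u * i ≡ i * l * u' [MOD p ^ m]) (hv : v * l ≡ i * l * v' [MOD p ^ m]) :
    Std p a b m u' v' (x ^ i) (y ^ l) (d ^ (i * l)) := by
  refine ⟨⟨?_, ?_, ?_, ?_, ?_, ?_⟩, ?_, h.card⟩
  · exact h.toRel.pow_mul_pow i l
  · exact ((show Commute x d from h.comm_x).pow_pow _ _).eq
  · exact ((show Commute y d from h.comm_y).pow_pow _ _).eq
  · rw [← pow_mul, mul_comm, pow_mul, h.pow_d, one_pow]
  · rw [← pow_mul, mul_comm, pow_mul, h.pow_x, ← pow_mul, ← pow_mul]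
    exact h.toRel.pow_d_congr hu
  · rw [← pow_mul, mul_comm, pow_mul, h.pow_y, ← pow_mul, ← pow_mul]
    exact h.toRel.pow_d_congr hv
  · have key : ∀ (g : G) (n : ℕ), p.Coprime n → ∃ k, (g ^ n) ^ k = g := by
      intro g n hn
      obtain ⟨c, hc⟩ := IsPGroup.iff_orderOf.1 hG g
      apply exists_pow_eq_self_of_coprime
      rw [hc]
      exact (hn.pow_left c).symm
    rw [eq_top_iff, ← h.gen, Subgroup.closure_le]
    rintro w (rfl | rfl)
    · obtain ⟨k, hk⟩ := key w i hi
      have := Subgroup.pow_mem _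
        (Subgroup.subset_closure (by simp) : w ^ i ∈ Subgroup.closure {w ^ i, y ^ l}) k
      rwa [hk] at this
    · obtain ⟨k, hk⟩ := key w l hl
      have := Subgroup.pow_mem _
        (Subgroup.subset_closure (by simp) : w ^ l ∈ Subgroup.closure {x ^ i, w ^ l}) k
      rwa [hk] at this

lemma exists_scale [Fact p.Prime] [Finite G] (hG : IsPGroup p G) :
    ∃ r ≤ m, ∃ s ≤ m, ∃ x y d : G, Std p a b m (p ^ r) (p ^ s) x y d := by
  obtain ⟨r, hr, l, hl, hu⟩ := exists_coprime_modEq (p := p) m u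
  obtain ⟨s, hs, i, hi, hv⟩ := exists_coprime_modEq (p := p) m v
  refine ⟨r, hr, s, hs, _, _, _, h.scale hG hi hl ?_ ?_⟩
  · have := hu.mul_right i
    rwa [show l * p ^ r * i = i * l * p ^ r by ring] at this
  · have := hv.mul_right l
    rwa [show i * p ^ s * l = i * l * p ^ s by ring] at this

lemma shift_y (hba : b ≤ a) {k v' : ℕ}
    (hv : u * k + v + p ^ (a - b) * k * (p ^ b).choose 2 ≡ v' [MOD p ^ m]) :
    Std p a b m u v' x (nf x y d (p ^ (a - b) * k) 1 0) d := by
  set y' := nf x y d (p ^ (a - b) * k) 1 0 with hy'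
  have hx1 : x = nf x y d 1 0 0 := by simp [nf]
  have hd1 : d = nf x y d 0 0 1 := by simp [nf]
  refine ⟨⟨?_, h.comm_x, ?_, h.pow_d, h.pow_x, ?_⟩, ?_, h.card⟩
  · have h1 : y' * x = nf x y d (p ^ (a - b) * k + 1) 1 1 := by
      conv_lhs => rw [hx1, hy', h.toRel.nf_mul]
    have h2 : x * y' * d = nf x y d (p ^ (a - b) * k + 1) 1 1 := by
      have e1 : x * y' = nf x y d (1 + p ^ (a - b) * k) 1 0 := by
        conv_lhs => rw [hx1, hy', h.toRel.nf_mul]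
        simp
      rw [e1, add_comm 1]
      simp [nf]
    rw [h1, h2]
  · have := h.toRel.commute_nf 1 (p ^ (a - b) * k) 1 0
    rw [pow_one] at this
    exact this.eq.symm
  · rw [hy', h.toRel.nf_pow, ← h.toRel.pow_d_congr hv, nf, ← mul_assoc (p ^ b), ← pow_add,
      Nat.add_sub_cancel' hba, pow_mul, h.pow_x, mul_one, h.pow_y, ← pow_mul, ← pow_add, ← pow_add]
    congr 1
    ring
  · rw [eq_top_iff, ← h.gen, Subgroup.closure_le]
    have hx : x ∈ Subgroup.closure {x, y'} := Subgroup.subset_closure (by simp)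
    have hy : y' ∈ Subgroup.closure {x, y'} := Subgroup.subset_closure (by simp)
    rintro w (rfl | rfl)
    · exact hx
    · have := Subgroup.mul_mem _
        (Subgroup.inv_mem _ (Subgroup.pow_mem _ hx (p ^ (a - b) * k))) hy
      simpa [hy', nf] using this

lemma shift_x (hba : b ≤ a) {j u' : ℕ}
    (hu : u + v * p ^ (a - b) * j + j * (p ^ a).choose 2 ≡ u' [MOD p ^ m]) :
    Std p a b m u' v (nf x y d 1 j 0) y d := by
  set x' := nf x y d 1 j 0 with hx'
  have hy1 : y = nf x y d 0 1 0 := by simp [nf]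
  refine ⟨⟨?_, ?_, h.comm_y, h.pow_d, ?_, h.pow_y⟩, ?_, h.card⟩
  · have h1 : y * x' = nf x y d 1 (1 + j) 1 := by
      conv_lhs => rw [hy1, hx', h.toRel.nf_mul]
    have e1 : x' * y = nf x y d 1 (j + 1) 0 := by
      conv_lhs => rw [hy1, hx', h.toRel.nf_mul]
      simp
    rw [h1, e1, add_comm 1 j]
    simp [nf]
  · have := h.toRel.commute_nf 1 1 j 0
    rw [pow_one] at this
    exact this.eq.symm
  · have hab : p ^ a * j = p ^ b * (p ^ (a - b) * j) := by
      rw [← mul_assoc, ← pow_add, Nat.add_sub_cancel' hba]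
    rw [hx', h.toRel.nf_pow, ← h.toRel.pow_d_congr hu, nf, mul_one, h.pow_x, hab, pow_mul, h.pow_y,
      ← pow_mul, ← pow_add, ← pow_add]
    congr 1
    ring
  · rw [eq_top_iff, ← h.gen, Subgroup.closure_le]
    have hx : x' ∈ Subgroup.closure {x', y} := Subgroup.subset_closure (by simp)
    have hy : y ∈ Subgroup.closure {x', y} := Subgroup.subset_closure (by simp)
    rintro w (rfl | rfl)
    · have := Subgroup.mul_mem _ hx (Subgroup.inv_mem _ (Subgroup.pow_mem _ hy j))
      simpa [hx', nf] using this
    · exact hy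

end Std

lemma Std.swap {p a m u v : ℕ} {G : Type*} [Group G] {x y d : G} (hp : 0 < p)
    (h : Std p a a m u v x y d) :
    Std p a a m (v * (p ^ m - 1)) (u * (p ^ m - 1)) y x (d ^ (p ^ m - 1)) := by
  have hd : d * d ^ (p ^ m - 1) = 1 := by
    rw [← pow_succ', Nat.sub_add_cancel (pow_pos hp m), h.pow_d]
  have hsq : ∀ w, d ^ w = (d ^ (p ^ m - 1)) ^ (w * (p ^ m - 1)) := by
    intro w
    rw [← pow_mul]
    apply h.toRel.pow_d_congr
    obtain ⟨q, hq⟩ : ∃ q, p ^ m = q + 1 := ⟨p ^ m - 1, by have := pow_pos hp m; omega⟩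
    rw [hq, Nat.add_sub_cancel]
    have h1 : q * q ≡ 1 [MOD q + 1] := by
      rcases Nat.eq_zero_or_pos q with rfl | hq0
      · exact Nat.modEq_one
      · refine ((Nat.modEq_iff_dvd' ?_).2 ?_).symm
        · nlinarith
        · exact ⟨q - 1, by
            obtain ⟨t, rfl⟩ : ∃ t, q = t + 1 := ⟨q - 1, by omega⟩
            have : (t + 1) * (t + 1) = (t + 1 + 1) * t + 1 := by ring
            rw [Nat.add_sub_cancel, this, Nat.add_sub_cancel]⟩
    have := (h1.mul_left w).symm
    rw [mul_one] at this
    rwa [show q * (w * q) = w * (q * q) by ring]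
  refine ⟨⟨?_, ?_, ?_, ?_, ?_, ?_⟩, ?_, h.card⟩
  · rw [h.comm, mul_assoc, hd, mul_one]
  · exact ((show Commute y d from h.comm_y).pow_right _).eq
  · exact ((show Commute x d from h.comm_x).pow_right _).eq
  · rw [← pow_mul, mul_comm, pow_mul, h.pow_d, one_pow]
  · rw [h.pow_y]; exact hsq v
  · rw [h.pow_x]; exact hsq u
  · rw [Set.pair_comm]; exact h.gen

section Normalize

variable {p a b m : ℕ} [Fact p.Prime] {G : Type*} [Group G] {x y d : G}

lemma Std.normalize_of_regular {r s : ℕ} (h : Std p a b m (p ^ r) (p ^ s) x y d)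
    (hr : r ≤ m) (hmb : m ≤ b) (hba : b ≤ a) (hreg : p ≠ 2 ∨ m < a) :
    ∃ r s, ∃ x y d : G, s ≤ r ∧ r ≤ m ∧ r ≤ s + (a - b) ∧ Std p a b m (p ^ r) (p ^ s) x y d := by
  have hp := (Fact.out : p.Prime)
  have hca : p ^ m ∣ (p ^ a).choose 2 := dvd_choose_two hp (hmb.trans hba) hreg
  have hcb : p ^ m ∣ p ^ (a - b) * (p ^ b).choose 2 := by
    rcases lt_or_eq_of_le hmb with hlt | rfl
    · exact (dvd_choose_two hp hmb (Or.inr hlt)).mul_left _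
    · rcases hp.eq_two_or_odd' with rfl | hodd
      · have hma : m < a := by simpa using hreg
        obtain ⟨c, hc⟩ : ∃ c, a - m = c + 1 := ⟨a - m - 1, by omega⟩
        have h2 : (2 ^ m).choose 2 * 2 = 2 ^ m * (2 ^ m - 1) := by
          rw [Nat.choose_two_right, Nat.div_mul_cancel (Nat.even_mul_pred_self _).two_dvd]
        rw [hc, pow_succ, mul_assoc, mul_comm 2, h2]
        exact (dvd_mul_right _ _).mul_left _
      · have hp2 : p ≠ 2 := by
          rintro rfl
          exact absurd hodd (by decide)
        exact (dvd_choose_two hp le_rfl (Or.inl hp2)).mul_left _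
  obtain ⟨q, hq⟩ : ∃ q, p ^ m = q + 1 :=
    ⟨p ^ m - 1, by have := pow_pos hp.pos m; omega⟩
  rcases le_or_gt r s with hrs | hrs
  · refine ⟨r, r, _, _, _, le_rfl, hr, by omega,
      h.shift_y hba (k := 1 + q * p ^ (s - r)) ?_⟩
    have h1 : p ^ r * (1 + q * p ^ (s - r)) + p ^ s = p ^ r + p ^ m * p ^ s := by
      rw [hq, mul_add, mul_one, mul_left_comm, ← pow_add, Nat.add_sub_cancel' hrs]
      ring
    rw [h1, mul_right_comm, add_assoc]
    exact Nat.ModEq.symm ((Nat.modEq_iff_dvd' (by omega)).2 (by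
      rw [Nat.add_sub_cancel_left]
      exact dvd_add (dvd_mul_right _ _) (hcb.mul_right _)))
  rcases le_or_gt (s + (a - b)) r with hrs' | hrs'
  · refine ⟨s + (a - b), s, _, _, _, by omega, by omega, le_rfl,
      h.shift_x hba (j := 1 + q * p ^ (r - (s + (a - b)))) ?_⟩
    have h1 : p ^ r + p ^ s * p ^ (a - b) * (1 + q * p ^ (r - (s + (a - b)))) =
        p ^ (s + (a - b)) + p ^ m * p ^ r := by
      rw [hq, mul_add, mul_one, mul_left_comm, ← pow_add, ← pow_add, Nat.add_sub_cancel' hrs']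
      ring
    rw [h1, add_assoc]
    exact Nat.ModEq.symm ((Nat.modEq_iff_dvd' (by omega)).2 (by
      rw [Nat.add_sub_cancel_left]
      exact dvd_add (dvd_mul_right _ _) (hca.mul_left _)))
  · exact ⟨r, s, x, y, d, hrs.le, hr, hrs'.le, h⟩

lemma Std.normalize_of_irregular {G : Type*} [Group G] [Finite G] {x y d : G} {r s m : ℕ}
    (h : Std 2 m m m (2 ^ r) (2 ^ s) x y d) (hm : m ≠ 0) (hrs : r ≤ s) (hs : s ≤ m) :
    ∃ r, ∃ x y d : G, r ≤ m ∧ Std 2 m m m (2 ^ r) (2 ^ r) x y d := by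
  obtain ⟨n, rfl⟩ : ∃ n, m = n + 1 := ⟨m - 1, by omega⟩
  have hch : (2 ^ (n + 1)).choose 2 = 2 ^ n * (2 ^ (n + 1) - 1) := by
    rw [Nat.choose_two_right, pow_succ, mul_comm (2 ^ n), mul_assoc,
      Nat.mul_div_cancel_left _ two_pos]
  obtain ⟨q, hq⟩ : ∃ q, 2 ^ (n + 1) = q + 1 :=
    ⟨2 ^ (n + 1) - 1, by have := pow_pos two_pos (n + 1) (M₀ := ℕ); omega⟩
  rcases lt_or_ge r n with hrn | hrn
  · set c := 2 ^ (n - r) * q with hc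
    have hodd : Nat.Coprime (1 + c) (2 ^ (n + 1)) := by
      apply Nat.Coprime.pow_right
      rw [Nat.coprime_two_right]
      obtain ⟨e, he⟩ : ∃ e, n - r = e + 1 := ⟨n - r - 1, by omega⟩
      rw [hc, he, pow_succ]
      exact ⟨2 ^ e * q, by ring⟩
    obtain ⟨t, -, ht⟩ := Nat.exists_mul_mod_eq_one_of_coprime hodd (by
      exact Nat.one_lt_two_pow (by omega))
    have ht' : (1 + c) * t ≡ 1 [MOD 2 ^ (n + 1)] := by
      rw [Nat.ModEq, ht, Nat.mod_eq_of_lt (Nat.one_lt_two_pow (by omega))]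
    refine ⟨r, _, _, _, by omega, h.shift_y le_rfl (k := t * (1 + q * 2 ^ (s - r))) ?_⟩
    have h1 : 2 ^ r * (t * (1 + q * 2 ^ (s - r))) + 2 ^ s +
        2 ^ (n + 1 - (n + 1)) * (t * (1 + q * 2 ^ (s - r))) * (2 ^ (n + 1)).choose 2 =
        (1 + c) * t * (2 ^ r * (1 + q * 2 ^ (s - r))) + 2 ^ s := by
      rw [hch, Nat.sub_self, hq, Nat.add_sub_cancel, hc, ← Nat.add_sub_cancel' hrn.le, pow_add]
      rw [Nat.add_sub_cancel_left]
      ring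
    have h2 : 2 ^ r * (1 + q * 2 ^ (s - r)) + 2 ^ s = 2 ^ r + 2 ^ (n + 1) * 2 ^ s := by
      rw [hq, mul_add, mul_one, mul_left_comm, ← pow_add, Nat.add_sub_cancel' hrs]
      ring
    rw [h1]
    have h3 := (ht'.mul_right (2 ^ r * (1 + q * 2 ^ (s - r)))).add_right (2 ^ s)
    rw [one_mul, h2] at h3
    refine h3.trans (Nat.ModEq.symm ((Nat.modEq_iff_dvd' (by omega)).2 ?_))
    rw [Nat.add_sub_cancel_left]
    exact dvd_mul_right _ _
  · rcases eq_or_lt_of_le hrs with rfl | hlt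
    · exact ⟨r, x, y, d, hs, h⟩
    · obtain rfl : r = n := by omega
      obtain rfl : s = r + 1 := by omega
      refine ⟨r + 1, _, _, _, le_rfl, h.shift_x le_rfl (j := 1) ?_⟩
      have h1 : 2 ^ r + 2 ^ (r + 1) * 2 ^ (r + 1 - (r + 1)) * 1 + 1 * (2 ^ (r + 1)).choose 2 =
          2 ^ (r + 1) + 2 ^ (r + 1) * 2 ^ r := by
        rw [hch, Nat.sub_self, hq, Nat.add_sub_cancel]
        ring
      rw [h1]
      refine Nat.ModEq.symm ((Nat.modEq_iff_dvd' (by omega)).2 ?_)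
      rw [Nat.add_sub_cancel_left]
      exact dvd_mul_right _ _

lemma exists_normalized_std [Finite G] (hG : IsPGroup p G)
    (hgen : ∃ x y : G, Subgroup.closure {x, y} = ⊤)
    (hnonab : ¬ ∀ x y : G, x * y = y * x) (hclass : commutator G ≤ Subgroup.center G) :
    ∃ a b m r s, ∃ x y d : G, m ≠ 0 ∧ m ≤ b ∧ b ≤ a ∧ s ≤ r ∧ r ≤ m ∧ r ≤ s + (a - b) ∧
      Std p a b m (p ^ r) (p ^ s) x y d := by
  have hp := (Fact.out : p.Prime)
  obtain ⟨a, b, m, u, v, x, y, d, hm, hmb, hba, h⟩ := exists_std hG hgen hnonab hclass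
  obtain ⟨r, hr, s, hs, x, y, d, h⟩ := h.exists_scale hG
  by_cases hreg : p ≠ 2 ∨ m < a
  · obtain ⟨r, s, x, y, d, h1, h2, h3, h4⟩ := h.normalize_of_regular hr hmb hba hreg
    exact ⟨a, b, m, r, s, x, y, d, hm, hmb, hba, h1, h2, h3, h4⟩
  · push Not at hreg
    obtain ⟨rfl, ham⟩ := hreg
    obtain rfl : b = m := by omega
    obtain rfl : a = b := by omega
    have key : ∃ r, ∃ x y d : G, r ≤ a ∧ Std 2 a a a (2 ^ r) (2 ^ r) x y d := by
      rcases le_total r s with hrs | hrs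
      · exact h.normalize_of_irregular hm hrs hs
      · have hco : Nat.Coprime 2 (2 ^ a - 1) := by
          rw [Nat.coprime_two_left]
          exact Nat.Even.sub_odd Nat.one_le_two_pow ((Nat.even_pow).2 ⟨even_two, hm⟩) odd_one
        have h2 := (h.swap two_pos).scale hG (u' := 2 ^ s) (v' := 2 ^ r) hco hco
          (by rw [show 2 ^ s * (2 ^ a - 1) * (2 ^ a - 1) =
            (2 ^ a - 1) * (2 ^ a - 1) * 2 ^ s by ring])
          (by rw [show 2 ^ r * (2 ^ a - 1) * (2 ^ a - 1) =
            (2 ^ a - 1) * (2 ^ a - 1) * 2 ^ r by ring])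
        exact h2.normalize_of_irregular hm hrs hr
    obtain ⟨r, x, y, d, hr, h⟩ := key
    exact ⟨a, a, a, r, r, x, y, d, hm, le_rfl, le_rfl, le_rfl, hr, by omega, h⟩

end Normalize

section PowerCounts

namespace Std

variable {p a b m u v : ℕ} {G : Type*} [Group G] [Finite G] {x y d : G}

lemma nf_mem_center (h : Std p a b m u v x y d) {i j : ℕ} (hi : p ^ m ∣ i) (hj : p ^ m ∣ j)
    (k : ℕ) : nf x y d i j k ∈ Subgroup.center G := by
  rw [Subgroup.mem_center_iff]
  intro g
  obtain ⟨i', j', k', rfl⟩ := h.exists_nf g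
  rw [h.toRel.nf_mul, h.toRel.nf_mul, nf, nf, add_comm i', add_comm j']
  congr 1
  apply h.toRel.pow_d_congr
  rw [add_comm k' k]
  exact ((Nat.modEq_zero_iff_dvd.2 (hi.mul_right j')).trans
    (Nat.modEq_zero_iff_dvd.2 (hj.mul_left i')).symm).add_left _

lemma pow_mem_center (h : Std p a b m u v x y d) {n : ℕ} (hmn : m ≤ n) (g : G) :
    g ^ p ^ n ∈ Subgroup.center G := by
  obtain ⟨i, j, k, rfl⟩ := h.exists_nf g
  rw [h.toRel.nf_pow]
  exact h.nf_mem_center ((pow_dvd_pow p hmn).mul_right i) ((pow_dvd_pow p hmn).mul_right j) _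

variable [Fact p.Prime]

lemma pow_eq_one_iff {r s : ℕ} (h : Std p a b m (p ^ r) (p ^ s) x y d) {n : ℕ} (hmb : m ≤ b)
    (hba : b ≤ a) (han : a ≤ n) (hrs : r ≤ s + (a - b)) (hreg : p ≠ 2 ∨ m < n) :
    (∀ g : G, g ^ p ^ n = 1) ↔ a + m ≤ n + r := by
  have hp := (Fact.out : p.Prime)
  have hx : x ^ p ^ n = d ^ p ^ (r + (n - a)) := by
    rw [← Nat.add_sub_cancel' han, pow_add, pow_mul, h.pow_x, ← pow_mul, ← pow_add,
      Nat.add_sub_cancel_left]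
  have hy : y ^ p ^ n = d ^ p ^ (s + (n - b)) := by
    rw [← Nat.add_sub_cancel' (hba.trans han), pow_add, pow_mul, h.pow_y, ← pow_mul, ← pow_add,
      Nat.add_sub_cancel_left]
  constructor
  · intro hall
    have h1 := hx.symm.trans (hall x)
    rw [← orderOf_dvd_iff_pow_eq_one, h.orderOf_d, Nat.pow_dvd_pow_iff_le_right hp.one_lt] at h1
    omega
  · intro hle g
    have hd : ∀ k, p ^ m ∣ k → d ^ k = 1 := by
      rintro _ ⟨k, rfl⟩
      rw [pow_mul, h.pow_d, one_pow]
    obtain ⟨i, j, k, rfl⟩ := h.exists_nf g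
    rw [h.toRel.nf_pow, nf, pow_mul, hx, pow_mul, hy, hd _ (pow_dvd_pow p (by omega)),
      hd _ (pow_dvd_pow p (by omega)), hd, one_pow, one_pow, one_mul, one_mul]
    exact dvd_add ((pow_dvd_pow p ((hmb.trans hba).trans han)).mul_right _)
      ((dvd_choose_two hp ((hmb.trans hba).trans han) hreg).mul_left _)

omit [Finite G] [Fact p.Prime] in
lemma ncard_range_pow_eq_one_iff (n : ℕ) :
    (Set.range fun g : G => g ^ n).ncard = 1 ↔ ∀ g : G, g ^ n = 1 := by
  rw [Set.ncard_eq_one]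
  constructor
  · rintro ⟨z, hz⟩ g
    have h1 : (1 : G) ∈ ({z} : Set _) := hz ▸ ⟨1, one_pow _⟩
    have h2 : g ^ n ∈ ({z} : Set _) := hz ▸ ⟨_, rfl⟩
    rw [Set.mem_singleton_iff] at h1 h2
    rw [h2, h1]
  · intro hall
    refine ⟨1, Set.eq_singleton_iff_unique_mem.2 ⟨⟨1, one_pow _⟩, ?_⟩⟩
    rintro _ ⟨g, rfl⟩
    exact hall g

/-- The elements `x ^ (p ^ b * i) * d ^ (p ^ t * k)`. -/
def powSet (p b t : ℕ) (x d : G) : Set G :=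
  Set.range fun w : ℕ × ℕ => x ^ (p ^ b * w.1) * d ^ (p ^ t * w.2)

lemma ncard_powSet {r t : ℕ} (h : Std p a b m (p ^ r) v x y d) (hba : b ≤ a) (htr : t ≤ r)
    (htm : t ≤ m) : (powSet p b t x d).ncard = p ^ (a - b + (m - t)) := by
  have hp := (Fact.out : p.Prime)
  have hpa : p ^ a = p ^ b * p ^ (a - b) := by rw [← pow_add, Nat.add_sub_cancel' hba]
  have hpm : p ^ m = p ^ t * p ^ (m - t) := by rw [← pow_add, Nat.add_sub_cancel' htm]
  have hpr : p ^ r = p ^ t * p ^ (r - t) := by rw [← pow_add, Nat.add_sub_cancel' htr]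
  set f : Fin (p ^ (a - b)) × Fin (p ^ (m - t)) → G :=
    fun w => x ^ (p ^ b * w.1) * d ^ (p ^ t * w.2) with hf
  have hinj : Function.Injective f := by
    rintro ⟨i, k⟩ ⟨i', k'⟩ he
    have he' : nf x y d (p ^ b * i) 0 (p ^ t * k) = nf x y d (p ^ b * i') 0 (p ^ t * k') := by
      simpa [nf, hf] using he
    obtain ⟨h1, -, h3⟩ := h.mod_eq_of_nf_eq he'
    rw [hpa, Nat.mul_mod_mul_left, Nat.mul_mod_mul_left, Nat.mod_eq_of_lt i.2,
      Nat.mod_eq_of_lt i'.2] at h1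
    have h1' := Nat.eq_of_mul_eq_mul_left (pow_pos hp.pos b) h1
    rw [h1'] at h3
    have h4 : p ^ t * k ≡ p ^ t * k' [MOD p ^ m] :=
      Nat.ModEq.add_right_cancel' _ (Nat.ModEq.add_right_cancel' _ h3)
    rw [Nat.ModEq, hpm, Nat.mul_mod_mul_left, Nat.mul_mod_mul_left, Nat.mod_eq_of_lt k.2,
      Nat.mod_eq_of_lt k'.2] at h4
    have h4' := Nat.eq_of_mul_eq_mul_left (pow_pos hp.pos t) h4
    exact Prod.ext (Fin.ext h1') (Fin.ext h4')
  have hrange : powSet p b t x d = Set.range f := by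
    apply Set.Subset.antisymm
    · rintro _ ⟨⟨i, k⟩, rfl⟩
      refine ⟨(⟨i % p ^ (a - b), Nat.mod_lt _ (pow_pos hp.pos _)⟩,
        ⟨(k + p ^ (r - t) * (i / p ^ (a - b))) % p ^ (m - t), Nat.mod_lt _ (pow_pos hp.pos _)⟩), ?_⟩
      have hx : x ^ (p ^ b * i) =
          x ^ (p ^ b * (i % p ^ (a - b))) * d ^ (p ^ r * (i / p ^ (a - b))) := by
        conv_lhs => rw [← Nat.mod_add_div i (p ^ (a - b)), mul_add, ← mul_assoc, ← hpa, pow_add,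
          pow_mul x (p ^ a), h.pow_x, ← pow_mul]
      simp only [hf]
      rw [hx, mul_assoc, ← pow_add, ← Nat.mul_mod_mul_left (p ^ t), ← hpm, ← h.toRel.pow_d_mod, hpr]
      congr 2
      ring
    · rintro _ ⟨⟨i, k⟩, rfl⟩
      exact ⟨(i, k), rfl⟩
  rw [hrange, ← Nat.card_coe_set_eq, Nat.card_range_of_injective hinj, Nat.card_prod, Nat.card_fin,
    Nat.card_fin, pow_add]

omit [Fact p.Prime] in
lemma range_pow_subset {s t : ℕ} (h : Std p a b m u (p ^ s) x y d) (hmb : m ≤ b) (hts : t ≤ s)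
    (htm : t ≤ m) (hC : p ^ t ∣ (p ^ b).choose 2) :
    (Set.range fun g : G => g ^ p ^ b) ⊆ powSet p b t x d := by
  rintro _ ⟨g, rfl⟩
  obtain ⟨i, j, k, rfl⟩ := h.exists_nf g
  obtain ⟨c, hc⟩ : p ^ t ∣ p ^ s * j + (p ^ b * k + i * j * (p ^ b).choose 2) :=
    dvd_add ((pow_dvd_pow p hts).mul_right _)
      (dvd_add ((pow_dvd_pow p (htm.trans hmb)).mul_right _) (hC.mul_left _))
  refine ⟨(i, c), ?_⟩
  simp only
  rw [h.toRel.nf_pow, nf, ← hc, pow_mul y, h.pow_y, ← pow_mul, mul_assoc (x ^ _), ← pow_add]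

omit [Finite G] in
lemma powSet_subset_range_pow {s : ℕ} (h : Std p a b m u (p ^ s) x y d) (hmb : m ≤ b)
    (hC : s = m ∨ p ^ (s + 1) ∣ (p ^ b).choose 2) :
    powSet p b s x d ⊆ Set.range fun g : G => g ^ p ^ b := by
  have hp := (Fact.out : p.Prime)
  rintro _ ⟨⟨i, k⟩, rfl⟩
  rcases hC with rfl | ⟨e, he⟩
  · refine ⟨x ^ i, ?_⟩
    simp only
    rw [pow_mul d, h.pow_d, one_pow, mul_one, ← pow_mul, mul_comm]
  · have hco : (1 + i * p * e).Coprime (p ^ m) := by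
      apply Nat.Coprime.pow_right
      rw [mul_right_comm, Nat.coprime_add_mul_right_left]
      exact Nat.coprime_one_left p
    obtain ⟨t, ht⟩ : ∃ t, (1 + i * p * e) * t ≡ 1 [MOD p ^ m] := by
      rcases Nat.lt_or_ge 1 (p ^ m) with h1 | h1
      · obtain ⟨t, -, ht⟩ := Nat.exists_mul_mod_eq_one_of_coprime hco h1
        exact ⟨t, ht.trans (Nat.mod_eq_of_lt h1).symm⟩
      · obtain h2 : p ^ m = 1 := le_antisymm h1 (pow_pos hp.pos m)
        exact ⟨0, h2 ▸ Nat.modEq_one⟩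
    refine ⟨nf x y d i (t * k) 0, ?_⟩
    simp only
    rw [h.toRel.nf_pow, nf, he, pow_mul y, h.pow_y, ← pow_mul, mul_assoc (x ^ _), ← pow_add,
      mul_comm i]
    congr 1
    apply h.toRel.pow_d_congr
    have h1 := (ht.mul_left (p ^ s * k))
    rw [mul_one] at h1
    refine Eq.trans ?_ h1
    congr 1
    ring

end Std

end PowerCounts

section Comparison

namespace Std

variable {p a b m : ℕ} [Fact p.Prime] {G : Type*} [Group G] [Finite G] {x y d : G}

lemma ncard_range_pow_eq {r s : ℕ} (h : Std p a b m (p ^ r) (p ^ s) x y d)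
    (hmb : m ≤ b) (hba : b ≤ a) (hsr : s ≤ r) (hrm : r ≤ m)
    (hreg : p ≠ 2 ∨ m < b ∨ s + 2 ≤ m) :
    (Set.range fun g : G => g ^ p ^ b).ncard = p ^ (a - b + (m - s)) := by
  have hp := (Fact.out : p.Prime)
  have hC : p ^ s ∣ (p ^ b).choose 2 ∧ (s = m ∨ p ^ (s + 1) ∣ (p ^ b).choose 2) := by
    by_cases hreg' : p ≠ 2 ∨ m < b
    · have h1 := dvd_choose_two hp hmb hreg'
      refine ⟨(pow_dvd_pow p (hsr.trans hrm)).trans h1, ?_⟩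
      rcases eq_or_lt_of_le (hsr.trans hrm) with h2 | h2
      · exact Or.inl h2
      · exact Or.inr ((pow_dvd_pow p h2).trans h1)
    · have h1 := dvd_choose_two (a := b) (m := b - 1) hp (by omega) (by omega)
      exact ⟨(pow_dvd_pow p (by omega)).trans h1, Or.inr ((pow_dvd_pow p (by omega)).trans h1)⟩
  rw [← h.ncard_powSet hba hsr (hsr.trans hrm)]
  congr 1
  exact (h.range_pow_subset hmb le_rfl (hsr.trans hrm) hC.1).antisymm
    (h.powSet_subset_range_pow hmb hC.2)

lemma ncard_range_pow_le {r s : ℕ} (h : Std p a b m (p ^ r) (p ^ s) x y d) (hm : m ≠ 0)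
    (hmb : m ≤ b) (hba : b ≤ a) (hsr : s ≤ r) (hms : m ≤ s + 1) :
    (Set.range fun g : G => g ^ p ^ b).ncard ≤ p ^ (a - b + 1) := by
  have hp := (Fact.out : p.Prime)
  have h1 := dvd_choose_two (a := b) (m := m - 1) hp (by omega) (by omega)
  have h2 := h.ncard_powSet (t := m - 1) hba (by omega) (by omega)
  rw [show m - (m - 1) = 1 by omega] at h2
  rw [← h2]
  exact Set.ncard_le_ncard (h.range_pow_subset hmb (by omega) (by omega) h1) (Set.toFinite _)

variable {F : Type*} [Field F] [CharP F p] {H : Type*} [Group H] [Finite H]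
  {r s r' s' : ℕ} {x' y' d' : H}

lemma le_of_algEquiv (h : Std p a b m (p ^ r) (p ^ s) x y d)
    (h' : Std p a b m (p ^ r') (p ^ s') x' y' d')
    (e : MonoidAlgebra F G ≃ₐ[F] MonoidAlgebra F H) (hmb : m ≤ b) (hba : b ≤ a) (hrm' : r' ≤ m)
    (hrs : r ≤ s + (a - b)) (hrs' : r' ≤ s' + (a - b)) :
    r' ≤ r ∨ (p = 2 ∧ a = m ∧ r' = m ∧ r + 1 = m) := by
  have key : ∀ n, a ≤ n → (p ≠ 2 ∨ m < n) → (a + m ≤ n + r ↔ a + m ≤ n + r') := by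
    intro n han hreg
    have hmn : m ≤ n := (hmb.trans hba).trans han
    rw [← h.pow_eq_one_iff hmb hba han hrs hreg, ← h'.pow_eq_one_iff hmb hba han hrs' hreg,
      ← ncard_range_pow_eq_one_iff, ← ncard_range_pow_eq_one_iff,
      ncard_powers_eq p e n (h.pow_mem_center hmn) (h'.pow_mem_center hmn)]
  by_cases hreg : p ≠ 2 ∨ m < a + m - r'
  · have := key (a + m - r') (by omega) hreg
    omega
  · have := key (a + 1) (by omega) (by omega)
    omega

lemma eq_or_exceptional (h : Std p a b m (p ^ r) (p ^ s) x y d)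
    (h' : Std p a b m (p ^ r') (p ^ s') x' y' d')
    (e : MonoidAlgebra F G ≃ₐ[F] MonoidAlgebra F H) (hm : m ≠ 0) (hmb : m ≤ b) (hba : b ≤ a)
    (hrm : r ≤ m) (hrm' : r' ≤ m) (hsr : s ≤ r) (hsr' : s' ≤ r')
    (hrs : r ≤ s + (a - b)) (hrs' : r' ≤ s' + (a - b)) :
    (r = r' ∧ s = s') ∨ (p = 2 ∧ b = m ∧
      ((r = m ∧ s = m ∧ s' + 1 = m ∧ (r' = m ∨ a = m)) ∨
        (r' = m ∧ s' = m ∧ s + 1 = m ∧ (r = m ∨ a = m)))) := by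
  have hp := (Fact.out : p.Prime)
  have h1 := h.le_of_algEquiv h' e hmb hba hrm' hrs hrs'
  have h2 := h'.le_of_algEquiv h e.symm hmb hba hrm hrs' hrs
  by_cases hr : r = r'
  swap
  · omega
  subst hr
  have hcard := ncard_powers_eq p e b (h.pow_mem_center hmb) (h'.pow_mem_center hmb)
  have hle : ∀ {i j : ℕ}, p ^ i ≤ p ^ j ↔ i ≤ j := fun {i j} => Nat.pow_le_pow_iff_right hp.one_lt
  by_cases hreg : p ≠ 2 ∨ m < b ∨ s + 2 ≤ m <;> by_cases hreg' : p ≠ 2 ∨ m < b ∨ s' + 2 ≤ m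
  · rw [h.ncard_range_pow_eq hmb hba hsr hrm hreg,
      h'.ncard_range_pow_eq hmb hba hsr' hrm hreg'] at hcard
    have := Nat.pow_right_injective hp.two_le hcard
    omega
  · have h3 := h'.ncard_range_pow_le hm hmb hba hsr' (by omega)
    rw [← hcard, h.ncard_range_pow_eq hmb hba hsr hrm hreg, hle] at h3
    omega
  · have h3 := h.ncard_range_pow_le hm hmb hba hsr (by omega)
    rw [hcard, h'.ncard_range_pow_eq hmb hba hsr' hrm hreg', hle] at h3
    omega
  · omega

end Std

end Comparison

section Frobenius

open MonoidAlgebra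

lemma charTwo_eq_of_add_add_eq {A : Type*} [Ring A] [CharP A 2] {a b c e : A} (h : a + b + c = e) :
    a = b + c + e := by
  rw [← h, show b + c + (a + b + c) = a + ((b + b) + (c + c)) by abel,
    CharTwo.add_self_eq_zero, CharTwo.add_self_eq_zero, add_zero, add_zero]

lemma add_mul_sq {A : Type*} [Ring A] {z : A} (hz : ∀ a, Commute z a) (u v : A) :
    (u + z * v) ^ 2 = u ^ 2 + z * (u * v + v * u) + z ^ 2 * v ^ 2 := by
  have h1 : u * (z * v) = z * (u * v) := by rw [← mul_assoc, ← (hz u).eq, mul_assoc]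
  have h2 : z * v * (z * v) = z * z * (v * v) := by
    rw [mul_assoc, ← mul_assoc v, ← (hz v).eq]; simp only [mul_assoc]
  rw [sq, add_mul, mul_add, mul_add, h1, h2, sq, sq, sq, mul_add, mul_assoc z v u]
  abel

variable {F : Type*} [Field F] [CharP F 2] {G : Type*} [Group G]

instance : CharP (MonoidAlgebra F G) 2 :=
  charP_of_injective_algebraMap (algebraMap F (MonoidAlgebra F G)).injective 2

/-- The additive map raising each coefficient and each group element to its `2 ^ k`-th power. -/
noncomputable def frob (k : ℕ) (w : MonoidAlgebra F G) : MonoidAlgebra F G :=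
  w.coeff.sum fun g r => single (g ^ 2 ^ k) (r ^ 2 ^ k)

omit [CharP F 2] in
lemma frob_single (k : ℕ) (g : G) (r : F) :
    frob k (single g r) = single (g ^ 2 ^ k) (r ^ 2 ^ k) := by
  rw [frob, coeff_single, Finsupp.sum_single_index]
  rw [zero_pow (pow_ne_zero k two_ne_zero), single_zero]

lemma frob_add (k : ℕ) (u v : MonoidAlgebra F G) : frob k (u + v) = frob k u + frob k v := by
  rw [frob, coeff_add, Finsupp.sum_add_index']
  · rfl
  · intro g
    rw [zero_pow (pow_ne_zero k two_ne_zero), single_zero]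
  · intro g r t
    rw [add_pow_char_pow, single_add]

omit [CharP F 2] in
lemma frob_zero (k : ℕ) : frob k (0 : MonoidAlgebra F G) = 0 := by
  rw [frob, coeff_zero, Finsupp.sum_zero_index]

omit [CharP F 2] in
lemma frob_zero_left (w : MonoidAlgebra F G) : frob 0 w = w := by
  simp [frob]

lemma single_add_one_pow (d : G) (j : ℕ) :
    (single d (1 : F) + 1) ^ 2 ^ j = single (d ^ 2 ^ j) 1 + 1 := by
  rw [add_pow_char_pow_of_commute 2 j (Commute.one_right _), single_pow, one_pow, one_pow]

lemma pow_dvd_single_add_one (d : G) (j e : ℕ) :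
    (single d (1 : F) + 1) ^ 2 ^ j ∣ single (d ^ (2 ^ j * e)) 1 + 1 := by
  refine ⟨∑ i ∈ Finset.range e, (single (d ^ 2 ^ j) 1) ^ i, ?_⟩
  rw [single_add_one_pow, ← CharTwo.sub_eq_add, ← CharTwo.sub_eq_add, mul_geom_sum, single_pow,
    one_pow, ← pow_mul]

variable {d : G}

omit [CharP F 2] in
lemma commute_single_add_one (hd : ∀ g, Commute d g) (w : MonoidAlgebra F G) :
    Commute (single d (1 : F) + 1) w := by
  refine Commute.add_left ?_ (Commute.one_left _)
  induction w using MonoidAlgebra.induction_linear with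
  | zero => exact Commute.zero_right _
  | add u v hu hv => exact hu.add_right hv
  | single g r =>
    rw [Commute, SemiconjBy, single_mul_single, single_mul_single, (hd g).eq, one_mul, mul_one]

lemma pow_dvd_commutator_frob (hd : ∀ g, Commute d g)
    (hcomm : ∀ g h : G, ∃ e : ℕ, g * h = h * g * d ^ e) (j k : ℕ) (u v : MonoidAlgebra F G) :
    (single d (1 : F) + 1) ^ 2 ^ (j + k) ∣ frob j u * frob k v + frob k v * frob j u := by
  induction u using MonoidAlgebra.induction_linear with
  | zero => simp [frob_zero]
  | add u u' hu hu' =>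
    rw [frob_add, add_mul, mul_add, add_add_add_comm]
    exact dvd_add hu hu'
  | single g r =>
    induction v using MonoidAlgebra.induction_linear with
    | zero => simp [frob_zero]
    | add v v' hv hv' =>
      rw [frob_add, add_mul, mul_add, add_add_add_comm]
      exact dvd_add hv hv'
    | single h t =>
      obtain ⟨e, he⟩ := hcomm g h
      have hrel : Rel 0 1 1 1 0 0 h g (d ^ e) :=
        ⟨he, ((hd h).pow_left e).eq.symm, ((hd g).pow_left e).eq.symm, by simp, by simp, by simp⟩
      have h1 := hrel.pow_mul_pow (2 ^ k) (2 ^ j)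
      have h2 : single (g ^ 2 ^ j * h ^ 2 ^ k) (r ^ 2 ^ j * t ^ 2 ^ k) =
          single (h ^ 2 ^ k * g ^ 2 ^ j) (t ^ 2 ^ k * r ^ 2 ^ j) *
            single (d ^ (2 ^ (j + k) * e)) (1 : F) := by
        rw [single_mul_single, h1, ← pow_mul, mul_one, mul_comm (r ^ _)]
        congr 3
        ring
      rw [frob_single, frob_single, single_mul_single, single_mul_single, h2,
        ← mul_add_one]
      obtain ⟨c, hc⟩ := pow_dvd_single_add_one (F := F) d (j + k) e
      rw [hc, ← mul_assoc, ← ((commute_single_add_one hd _).pow_left _).eq, mul_assoc]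
      exact dvd_mul_right _ _

lemma pow_dvd_frob_sq_add (hd : ∀ g, Commute d g)
    (hcomm : ∀ g h : G, ∃ e : ℕ, g * h = h * g * d ^ e) (k : ℕ) (u : MonoidAlgebra F G) :
    (single d (1 : F) + 1) ^ 2 ^ (k + k) ∣ frob k u ^ 2 + frob (k + 1) u := by
  induction u using MonoidAlgebra.induction_linear with
  | zero => simp [frob_zero]
  | add u v hu hv =>
    have h1 : (frob k u + frob k v) ^ 2 + (frob (k + 1) u + frob (k + 1) v) =
        (frob k u ^ 2 + frob (k + 1) u) + (frob k v ^ 2 + frob (k + 1) v) +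
          (frob k u * frob k v + frob k v * frob k u) := by
      rw [sq, add_mul, mul_add, mul_add, sq, sq]
      abel
    rw [frob_add, frob_add, h1]
    exact dvd_add (dvd_add hu hv) (pow_dvd_commutator_frob hd hcomm k k u v)
  | single g r =>
    rw [frob_single, frob_single, single_pow, ← pow_mul, ← pow_mul, ← pow_succ]
    exact (CharTwo.add_self_eq_zero (_ : MonoidAlgebra F G)).symm ▸ dvd_zero _

lemma pow_dvd_pow_add_frob (hd : ∀ g, Commute d g)
    (hcomm : ∀ g h : G, ∃ e : ℕ, g * h = h * g * d ^ e) {w b : MonoidAlgebra F G}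
    (hwb : w ^ 2 = frob 1 w + (single d (1 : F) + 1) * b) (j : ℕ) :
    (single d (1 : F) + 1) ^ (2 ^ j + 1) ∣
      w ^ 2 ^ (j + 1) + frob (j + 1) w + (single d (1 : F) + 1) ^ 2 ^ j * frob j b := by
  set Z := single d (1 : F) + 1 with hZ
  have hZc : ∀ a, Commute Z a := commute_single_add_one hd
  induction j with
  | zero =>
    rw [zero_add, pow_one, hwb, frob_zero_left, pow_zero, pow_one,
      show ∀ s t : MonoidAlgebra F G, s + t + s + t = (s + t) + (s + t) by intros; abel]
    exact (CharTwo.add_self_eq_zero (_ : MonoidAlgebra F G)).symm ▸ dvd_zero _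
  | succ j ih =>
    obtain ⟨r, hr⟩ := ih
    have h1 := charTwo_eq_of_add_add_eq hr
    rw [pow_succ Z, mul_assoc, add_assoc, ← mul_add] at h1
    set B := frob j b + Z * r with hB
    have hpos : 1 ≤ 2 ^ j := Nat.one_le_two_pow
    have hs : 2 ^ (j + 1) = 2 ^ j + 2 ^ j := by ring
    have hBdvd : Z ∣ B ^ 2 + frob (j + 1) b := by
      have h2 := pow_dvd_frob_sq_add hd hcomm j b
      rw [hB, add_mul_sq hZc, add_right_comm, add_right_comm (frob j b ^ 2)]
      refine dvd_add (dvd_add ((dvd_pow_self Z ?_).trans h2) (dvd_mul_right _ _)) ?_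
      · positivity
      · exact (dvd_pow_self Z two_ne_zero).mul_right _
    have h3 : w ^ 2 ^ (j + 1 + 1) + frob (j + 1 + 1) w + Z ^ 2 ^ (j + 1) * frob (j + 1) b =
        (frob (j + 1) w ^ 2 + frob (j + 1 + 1) w) +
          Z ^ 2 ^ j * (frob (j + 1) w * B + B * frob (j + 1) w) +
          Z ^ 2 ^ (j + 1) * (B ^ 2 + frob (j + 1) b) := by
      rw [pow_succ 2 (j + 1), pow_mul w, h1, add_mul_sq fun a => (hZc a).pow_left _, ← pow_mul Z,
        ← pow_succ 2 j, mul_add (Z ^ 2 ^ (j + 1))]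
      abel
    rw [h3]
    refine dvd_add (dvd_add ((pow_dvd_pow Z ?_).trans
      (pow_dvd_frob_sq_add hd hcomm (j + 1) w)) ?_) ?_
    · have h4 : 2 ^ (j + 1 + (j + 1)) = 2 ^ (j + 1) * 2 ^ (j + 1) := pow_add _ _ _
      nlinarith
    · have h4 := pow_dvd_commutator_frob hd hcomm (j + 1) 0 w B
      rw [frob_zero_left, add_zero] at h4
      obtain ⟨c, hc⟩ := h4
      rw [hc, ← mul_assoc, ← pow_add]
      exact (pow_dvd_pow Z (by omega)).mul_right _
    · obtain ⟨c, hc⟩ := hBdvd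
      rw [hc, ← mul_assoc, ← pow_succ]
      exact dvd_mul_right _ _

end Frobenius

section ParitySums

open MonoidAlgebra

variable {F : Type*} [Field F] {G : Type*} [Group G] {χ : G → ZMod 2 × ZMod 2}

/-- The sum of the coefficients of `w` at the group elements `g` with `χ g = c`. -/
noncomputable def paritySum (χ : G → ZMod 2 × ZMod 2) (c : ZMod 2 × ZMod 2)
    (w : MonoidAlgebra F G) : F :=
  w.coeff.sum fun g r => if χ g = c then r else 0

omit [Group G] in
lemma paritySum_single (c : ZMod 2 × ZMod 2) (g : G) (r : F) :
    paritySum χ c (single g r) = if χ g = c then r else 0 := by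
  rw [paritySum, coeff_single, Finsupp.sum_single_index]
  rw [ite_self]

lemma paritySum_add (c : ZMod 2 × ZMod 2) (u v : MonoidAlgebra F G) :
    paritySum χ c (u + v) = paritySum χ c u + paritySum χ c v := by
  rw [paritySum, coeff_add, Finsupp.sum_add_index']
  · rfl
  · intro g
    rw [ite_self]
  · intro g r t
    split_ifs <;> simp

lemma paritySum_zero (c : ZMod 2 × ZMod 2) : paritySum χ c (0 : MonoidAlgebra F G) = 0 := by
  rw [paritySum, coeff_zero, Finsupp.sum_zero_index]

lemma paritySum_sum {ι : Type*} (c : ZMod 2 × ZMod 2) (s : Finset ι) (f : ι → MonoidAlgebra F G) :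
    paritySum χ c (∑ i ∈ s, f i) = ∑ i ∈ s, paritySum χ c (f i) :=
  map_sum (AddMonoidHom.mk' (paritySum χ c) (paritySum_add c)) f s

lemma eq_mod_two_cases (c : ZMod 2 × ZMod 2) :
    c = (0, 0) ∨ c = (1, 0) ∨ c = (0, 1) ∨ c = (1, 1) := by
  revert c
  decide

lemma map_one_eq_paritySum (w : MonoidAlgebra F G) :
    MonoidAlgebra.lift F F G 1 w = paritySum χ (0, 0) w + paritySum χ (1, 0) w +
      paritySum χ (0, 1) w + paritySum χ (1, 1) w := by
  induction w using MonoidAlgebra.induction_linear with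
  | zero => simp [paritySum_zero]
  | add u v hu hv =>
    rw [map_add, hu, hv]
    simp only [paritySum_add]
    ring
  | single g r =>
    simp only [paritySum_single, lift_single]
    generalize χ g = c
    rcases eq_mod_two_cases c with rfl | rfl | rfl | rfl <;> simp

lemma natCast_parity [CharP F 2] (i : ℕ) :
    ((i : ZMod 2) = 0 ∧ (i : F) = 0 ∧ i % 2 = 0) ∨
      ((i : ZMod 2) = 1 ∧ (i : F) = 1 ∧ i % 2 = 1) := by
  rcases Nat.even_or_odd' i with ⟨k, rfl | rfl⟩
  · left
    have h1 : (2 : ZMod 2) = 0 := by decide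
    have h2 : (2 : F) = 0 := CharTwo.two_eq_zero
    simp [h1, h2]
  · right
    have h1 : (2 : ZMod 2) = 0 := by decide
    have h2 : (2 : F) = 0 := CharTwo.two_eq_zero
    simp [h1, h2]

lemma Std.mul_comm_nf {p a b m u v : ℕ} {x y d : G} (h : Std p a b m u v x y d) (hp : 0 < p)
    (i j k i' j' k' : ℕ) :
    nf x y d i j k * nf x y d i' j' k' =
      nf x y d i' j' k' * nf x y d i j k * d ^ (i' * j + (p ^ m - 1) * (i * j')) := by
  have h1 : nf x y d (i' + i) (j' + j) (k' + k + i * j') *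
      d ^ (i' * j + (p ^ m - 1) * (i * j')) = nf x y d (i' + i) (j' + j)
        (k' + k + i * j' + (i' * j + (p ^ m - 1) * (i * j'))) := by
    simp only [nf, mul_assoc, ← pow_add]
  rw [h.toRel.nf_mul, h.toRel.nf_mul, h1, nf, nf, add_comm i, add_comm j]
  congr 1
  obtain ⟨q, hq⟩ : ∃ q, p ^ m = q + 1 := ⟨p ^ m - 1, by have := pow_pos hp m; omega⟩
  have h2 : k' + k + i * j' + (i' * j + (p ^ m - 1) * (i * j')) =
      k + k' + i' * j + p ^ m * (i * j') := by
    rw [hq, Nat.add_sub_cancel]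
    ring
  rw [h2, pow_add _ _ (p ^ m * _), pow_mul d (p ^ m), h.pow_d, one_pow, mul_one]

variable [CharP F 2] {m u v : ℕ} {x y d : G}

lemma Std.exists_commutator_eq [Finite G] (h : Std 2 m m m u v x y d) (hm : m ≠ 0)
    (hχ : ∀ i j k, χ (nf x y d i j k) = ((i : ZMod 2), (j : ZMod 2))) (w w' : MonoidAlgebra F G) :
    ∃ b, w * w' + w' * w = (single d (1 : F) + 1) * b ∧ paritySum χ (0, 0) b = 0 ∧
      paritySum χ (1, 0) b = paritySum χ (0, 1) w * paritySum χ (1, 1) w' +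
        paritySum χ (1, 1) w * paritySum χ (0, 1) w' ∧
      paritySum χ (0, 1) b = paritySum χ (1, 0) w * paritySum χ (1, 1) w' +
        paritySum χ (1, 1) w * paritySum χ (1, 0) w' ∧
      paritySum χ (1, 1) b = paritySum χ (1, 0) w * paritySum χ (0, 1) w' +
        paritySum χ (0, 1) w * paritySum χ (1, 0) w' := by
  induction w using MonoidAlgebra.induction_linear with
  | zero => exact ⟨0, by simp [paritySum_zero]⟩
  | add w₁ w₂ h₁ h₂ =>
    obtain ⟨b₁, e₁, f₁, f₂, f₃, f₄⟩ := h₁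
    obtain ⟨b₂, e₂, g₁, g₂, g₃, g₄⟩ := h₂
    refine ⟨b₁ + b₂, ?_, ?_, ?_, ?_, ?_⟩
    · rw [mul_add (_ + 1), ← e₁, ← e₂, add_mul, mul_add]
      abel
    all_goals simp only [paritySum_add, f₁, f₂, f₃, f₄, g₁, g₂, g₃, g₄]; ring
  | single g r =>
    induction w' using MonoidAlgebra.induction_linear with
    | zero => exact ⟨0, by simp [paritySum_zero]⟩
    | add w₁ w₂ h₁ h₂ =>
      obtain ⟨b₁, e₁, f₁, f₂, f₃, f₄⟩ := h₁
      obtain ⟨b₂, e₂, g₁, g₂, g₃, g₄⟩ := h₂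
      refine ⟨b₁ + b₂, ?_, ?_, ?_, ?_, ?_⟩
      · rw [mul_add (_ + 1), ← e₁, ← e₂, add_mul, mul_add]
        abel
      all_goals simp only [paritySum_add, f₁, f₂, f₃, f₄, g₁, g₂, g₃, g₄]; ring
    | single g' t =>
      obtain ⟨i, j, k, rfl⟩ := h.exists_nf g
      obtain ⟨i', j', k', rfl⟩ := h.exists_nf g'
      set e := i' * j + (2 ^ m - 1) * (i * j') with he
      have heF : (e : F) = i' * j + i * j' := by
        have h2 : (2 : F) = 0 := CharTwo.two_eq_zero
        have h3 : (1 : F) = -1 := by rw [CharTwo.neg_eq]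
        rw [he, Nat.cast_add, Nat.cast_mul, Nat.cast_mul, Nat.cast_mul,
          Nat.cast_sub Nat.one_le_two_pow, Nat.cast_pow, Nat.cast_ofNat, h2, zero_pow hm,
          Nat.cast_one, zero_sub, ← h3, one_mul]
      have hd : ∀ g, Commute d g := fun g => (Subgroup.mem_center_iff.1 h.d_mem_center g).symm
      set b : MonoidAlgebra F G := ∑ κ ∈ Finset.range e,
        single (nf x y d (i' + i) (j' + j) (k' + k + i * j' + κ)) (r * t) with hb
      have hT : ∀ c, paritySum χ c b = (i' * j + i * j') *
          if ((i' : ZMod 2) + i, (j' : ZMod 2) + j) = c then r * t else 0 := by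
        intro c
        rw [hb, paritySum_sum]
        simp only [paritySum_single, hχ, Nat.cast_add, Finset.sum_const, Finset.card_range,
          nsmul_eq_mul, heF]
      refine ⟨b, ?_, ?_⟩
      · have hb' : b = single (nf x y d i' j' k' * nf x y d i j k) (r * t) *
            ∑ κ ∈ Finset.range e, (single d 1) ^ κ := by
          rw [hb, Finset.mul_sum]
          refine Finset.sum_congr rfl fun κ _ => ?_
          rw [single_pow, one_pow, single_mul_single, mul_one, h.toRel.nf_mul]
          simp only [nf, mul_assoc, ← pow_add]
        rw [hb', ← mul_assoc, (commute_single_add_one hd _).eq, mul_assoc, ← CharTwo.sub_eq_add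
          (single d 1), mul_geom_sum, single_mul_single, single_mul_single, single_pow, one_pow,
          h.mul_comm_nf two_pos, mul_sub, single_mul_single, mul_one, mul_one, CharTwo.sub_eq_add,
          mul_comm t]
      · simp only [hT, paritySum_single, hχ]
        rcases natCast_parity (F := F) i with ⟨a1, b1, -⟩ | ⟨a1, b1, -⟩ <;>
        rcases natCast_parity (F := F) j with ⟨a2, b2, -⟩ | ⟨a2, b2, -⟩ <;>
        rcases natCast_parity (F := F) i' with ⟨a3, b3, -⟩ | ⟨a3, b3, -⟩ <;>
        rcases natCast_parity (F := F) j' with ⟨a4, b4, -⟩ | ⟨a4, b4, -⟩ <;>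
        simp [a1, a2, a3, a4, b1, b2, b3, b4, CharTwo.add_self_eq_zero]

lemma Std.exists_sq_eq [Finite G] (h : Std 2 m m m u v x y d) (hm : m ≠ 0)
    (hχ : ∀ i j k, χ (nf x y d i j k) = ((i : ZMod 2), (j : ZMod 2))) (w : MonoidAlgebra F G) :
    ∃ b, w ^ 2 = frob 1 w + (single d (1 : F) + 1) * b ∧ paritySum χ (0, 0) b = 0 ∧
      paritySum χ (1, 0) b = paritySum χ (0, 1) w * paritySum χ (1, 1) w ∧
      paritySum χ (0, 1) b = paritySum χ (1, 0) w * paritySum χ (1, 1) w ∧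
      paritySum χ (1, 1) b = paritySum χ (1, 0) w * paritySum χ (0, 1) w := by
  induction w using MonoidAlgebra.induction_linear with
  | zero => exact ⟨0, by simp [paritySum_zero, frob_zero]⟩
  | add w₁ w₂ h₁ h₂ =>
    obtain ⟨b₁, e₁, f₁, f₂, f₃, f₄⟩ := h₁
    obtain ⟨b₂, e₂, g₁, g₂, g₃, g₄⟩ := h₂
    obtain ⟨b₃, e₃, k₁, k₂, k₃, k₄⟩ := h.exists_commutator_eq hm hχ w₁ w₂
    refine ⟨b₁ + b₂ + b₃, ?_, ?_, ?_, ?_, ?_⟩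
    · have h1 : (w₁ + w₂) ^ 2 = w₁ ^ 2 + w₂ ^ 2 + (w₁ * w₂ + w₂ * w₁) := by
        rw [sq, add_mul, mul_add, mul_add, sq, sq]
        abel
      rw [h1, e₁, e₂, e₃, frob_add, mul_add, mul_add]
      abel
    all_goals simp only [paritySum_add, f₁, f₂, f₃, f₄, g₁, g₂, g₃, g₄, k₁, k₂, k₃, k₄]; ring
  | single g r =>
    refine ⟨0, ?_, ?_⟩
    · rw [frob_single, single_pow, mul_zero, add_zero, pow_one]
    · simp only [paritySum_single, paritySum_zero]
      rcases eq_mod_two_cases (χ g) with hg | hg | hg | hg <;> simp [hg]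

end ParitySums

section ParityVanishing

open MonoidAlgebra

lemma add_one_pow_two_pow_sub_one {A : Type*} [Ring A] [CharP A 2] (z : A) (j : ℕ) :
    (z + 1) ^ (2 ^ j - 1) = ∑ κ ∈ Finset.range (2 ^ j), z ^ κ := by
  induction j with
  | zero => simp
  | succ j ih =>
    have h1 : 2 ^ (j + 1) - 1 = 2 ^ j + (2 ^ j - 1) := by
      have := Nat.one_le_two_pow (n := j)
      rw [pow_succ]
      omega
    rw [h1, pow_add, ih, add_pow_char_pow_of_commute 2 j (Commute.one_right _), one_pow,
      show 2 ^ (j + 1) = 2 ^ j + 2 ^ j by ring, Finset.sum_range_add, add_mul, one_mul, add_comm,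
      Finset.mul_sum]
    simp only [pow_add]

variable {F : Type*} [Field F] {G : Type*} [Group G] {χ : G → ZMod 2 × ZMod 2} [CharP F 2]
  {n u v : ℕ} {x y d : G}

lemma frob_eq (h : Std 2 (n + 1) (n + 1) (n + 1) (2 ^ n) (2 ^ n) x y d) [Finite G]
    (hχ : ∀ i j k, χ (nf x y d i j k) = ((i : ZMod 2), (j : ZMod 2))) (w : MonoidAlgebra F G) :
    frob (n + 1) w = single 1 (paritySum χ (0, 0) w ^ 2 ^ (n + 1)) + single (d ^ 2 ^ n)
      ((paritySum χ (1, 0) w + paritySum χ (0, 1) w + paritySum χ (1, 1) w) ^ 2 ^ (n + 1)) := by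
  induction w using MonoidAlgebra.induction_linear with
  | zero => simp [frob_zero, paritySum_zero]
  | add w₁ w₂ h₁ h₂ =>
    rw [frob_add, h₁, h₂]
    simp only [paritySum_add, add_pow_char_pow, single_add]
    abel
  | single g r =>
    obtain ⟨i, j, k, rfl⟩ := h.exists_nf g
    have hC : (2 ^ (n + 1)).choose 2 = 2 ^ n * (2 ^ (n + 1) - 1) := by
      rw [Nat.choose_two_right, pow_succ, mul_comm (2 ^ n), mul_assoc,
        Nat.mul_div_cancel_left _ two_pos]
    have hz : ∀ t, (d ^ 2 ^ n) ^ t = (d ^ 2 ^ n) ^ (t % 2) := by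
      intro t
      have h2 : (d ^ 2 ^ n) ^ 2 = 1 := by rw [← pow_mul, ← pow_succ, h.pow_d]
      conv_lhs => rw [← Nat.div_add_mod t 2, pow_add, pow_mul, h2, one_pow, one_mul]
    have hpow : nf x y d i j k ^ 2 ^ (n + 1) = (d ^ 2 ^ n) ^ ((i + j + i * j) % 2) := by
      rw [← hz, h.toRel.nf_pow, nf, pow_mul x, h.pow_x, pow_mul y, h.pow_y, hC, pow_add,
        pow_mul d (2 ^ (n + 1)), h.pow_d, one_pow, one_mul,
        show i * j * (2 ^ n * (2 ^ (n + 1) - 1)) = 2 ^ n * (i * j * (2 ^ (n + 1) - 1)) by ring,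
        pow_mul d (2 ^ n), hz (i * j * _), pow_add (d ^ 2 ^ n), pow_add (d ^ 2 ^ n), hz (i * j)]
      congr 2
      have : (2 ^ (n + 1) - 1) % 2 = 1 := by
        rw [pow_succ]
        have := Nat.one_le_two_pow (n := n)
        omega
      rw [Nat.mul_mod, this, mul_one, Nat.mod_mod]
    rw [frob_single, hpow]
    simp only [paritySum_single, hχ]
    rcases natCast_parity (F := F) i with ⟨a1, -, c1⟩ | ⟨a1, -, c1⟩ <;>
    rcases natCast_parity (F := F) j with ⟨a2, -, c2⟩ | ⟨a2, -, c2⟩ <;>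
    simp [a1, a2, c1, c2, Nat.add_mod, Nat.mul_mod]

lemma coeff_mul_single_nf (h : Std 2 (n + 1) (n + 1) (n + 1) u v x y d) [Finite G] {i j i' j' : ℕ}
    (hi : i < 2 ^ (n + 1)) (hj : j < 2 ^ (n + 1)) (hi' : i' < 2 ^ (n + 1)) (hj' : j' < 2 ^ (n + 1))
    (r : F) :
    (((single d (1 : F) + 1) ^ (2 ^ (n + 1) - 1) * single (nf x y d i j 0) r).coeff
      (nf x y d i' j' 0)) = if i = i' ∧ j = j' then r else 0 := by
  classical
  have hd : ∀ κ, d ^ κ * nf x y d i j 0 = nf x y d i j κ := by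
    intro κ
    rw [(h.toRel.commute_nf κ i j 0).eq]
    simp [nf]
  have hc : ∀ κ ∈ Finset.range (2 ^ (n + 1)),
      (single (d ^ κ * nf x y d i j 0) ((1 : F) ^ κ * r)).coeff
      (nf x y d i' j' 0) = if κ = 0 then if i = i' ∧ j = j' then r else 0 else 0 := by
    intro κ hκ
    rw [coeff_single, Finsupp.single_apply, hd, one_pow, one_mul, ← ite_and]
    congr 1
    rw [eq_iff_iff]
    constructor
    · intro he
      obtain ⟨h1, h2, h3⟩ := h.mod_eq_of_nf_eq he
      rw [Nat.mod_eq_of_lt hi, Nat.mod_eq_of_lt hi'] at h1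
      rw [Nat.mod_eq_of_lt hj, Nat.mod_eq_of_lt hj'] at h2
      rw [Nat.div_eq_of_lt hi, Nat.div_eq_of_lt hi', Nat.div_eq_of_lt hj,
        Nat.div_eq_of_lt hj'] at h3
      simp only [mul_zero, add_zero, Nat.zero_mod] at h3
      rw [Nat.mod_eq_of_lt (Finset.mem_range.1 hκ)] at h3
      exact ⟨h3, h1, h2⟩
    · rintro ⟨rfl, rfl, rfl⟩
      rfl
  rw [add_one_pow_two_pow_sub_one, Finset.sum_mul]
  simp only [single_pow, single_mul_single]
  rw [coeff_sum, Finsupp.finsetSum_apply, Finset.sum_congr rfl hc, Finset.sum_ite_eq' _ 0,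
    if_pos (Finset.mem_range.2 (by positivity))]

lemma mul_single_nf (h : Std 2 (n + 1) (n + 1) (n + 1) u v x y d) [Finite G] (i j k : ℕ) (r : F) :
    (single d (1 : F) + 1) ^ (2 ^ (n + 1) - 1) * single (nf x y d i j k) r =
      (single d (1 : F) + 1) ^ (2 ^ (n + 1) - 1) *
        single (nf x y d (i % 2 ^ (n + 1)) (j % 2 ^ (n + 1)) 0) r := by
  have hN : (single d (1 : F) + 1) ^ (2 ^ (n + 1) - 1) * single d 1 =
      (single d (1 : F) + 1) ^ (2 ^ (n + 1) - 1) := by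
    have h1 : (single d (1 : F) + 1) ^ (2 ^ (n + 1) - 1) * (single d 1 + 1) = 0 := by
      rw [← pow_succ, Nat.sub_add_cancel Nat.one_le_two_pow, single_add_one_pow, h.pow_d]
      exact CharTwo.add_self_eq_zero _
    rw [mul_add, mul_one] at h1
    exact CharTwo.add_eq_zero.1 h1
  have hNk : ∀ k, (single d (1 : F) + 1) ^ (2 ^ (n + 1) - 1) * single (d ^ k) 1 =
      (single d (1 : F) + 1) ^ (2 ^ (n + 1) - 1) := by
    intro k
    induction k with
    | zero => rw [pow_zero, ← one_def, mul_one]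
    | succ k ih =>
      have : single (d ^ (k + 1)) (1 : F) = single (d ^ k) 1 * single d 1 := by
        rw [single_mul_single, mul_one, pow_succ]
      rw [this, ← mul_assoc, ih, hN]
  rw [h.toRel.nf_reduce]
  generalize (k + u * (i / 2 ^ (n + 1)) + v * (j / 2 ^ (n + 1))) % 2 ^ (n + 1) = l
  have h2 : single (nf x y d (i % 2 ^ (n + 1)) (j % 2 ^ (n + 1)) l) r =
      single (d ^ l) (1 : F) * single (nf x y d (i % 2 ^ (n + 1)) (j % 2 ^ (n + 1)) 0) r := by
    rw [single_mul_single, one_mul, (h.toRel.commute_nf l _ _ 0).eq]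
    simp [nf]
  rw [h2, ← mul_assoc, hNk]

lemma mul_frob_eq (h : Std 2 (n + 1) (n + 1) (n + 1) u v x y d) [Finite G]
    (hχ : ∀ i j k, χ (nf x y d i j k) = ((i : ZMod 2), (j : ZMod 2))) (b : MonoidAlgebra F G) :
    (single d (1 : F) + 1) ^ (2 ^ (n + 1) - 1) * frob n b =
      (single d (1 : F) + 1) ^ (2 ^ (n + 1) - 1) *
        (single (nf x y d 0 0 0) (paritySum χ (0, 0) b ^ 2 ^ n) +
          single (nf x y d (2 ^ n) 0 0) (paritySum χ (1, 0) b ^ 2 ^ n) +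
          single (nf x y d 0 (2 ^ n) 0) (paritySum χ (0, 1) b ^ 2 ^ n) +
          single (nf x y d (2 ^ n) (2 ^ n) 0) (paritySum χ (1, 1) b ^ 2 ^ n)) := by
  induction b using MonoidAlgebra.induction_linear with
  | zero => simp [frob_zero, paritySum_zero]
  | add w₁ w₂ h₁ h₂ =>
    rw [frob_add, mul_add, h₁, h₂, ← mul_add]
    simp only [paritySum_add, add_pow_char_pow, single_add]
    congr 1
    abel
  | single g r =>
    obtain ⟨i, j, k, rfl⟩ := h.exists_nf g
    rw [frob_single, h.toRel.nf_pow, mul_single_nf h, pow_succ, Nat.mul_mod_mul_left,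
      Nat.mul_mod_mul_left]
    simp only [paritySum_single, hχ]
    rcases natCast_parity (F := F) i with ⟨a1, -, c1⟩ | ⟨a1, -, c1⟩ <;>
    rcases natCast_parity (F := F) j with ⟨a2, -, c2⟩ | ⟨a2, -, c2⟩ <;>
    simp [a1, a2, c1, c2]

lemma paritySum_eq_zero (h : Std 2 (n + 1) (n + 1) (n + 1) (2 ^ n) (2 ^ n) x y d) [Finite G]
    (hχ : ∀ i j k, χ (nf x y d i j k) = ((i : ZMod 2), (j : ZMod 2))) {w : MonoidAlgebra F G}
    (hw : w ^ 2 ^ (n + 1) = 0) (c : ZMod 2 × ZMod 2) : paritySum χ c w = 0 := by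
  obtain ⟨b, hwb, hb0, hb1, hb2, hb3⟩ := h.exists_sq_eq (Nat.succ_ne_zero n) hχ w
  have hd : ∀ g, Commute d g := fun g => (Subgroup.mem_center_iff.1 h.d_mem_center g).symm
  have hcomm : ∀ g g' : G, ∃ e : ℕ, g * g' = g' * g * d ^ e := by
    intro g g'
    obtain ⟨i, j, k, rfl⟩ := h.exists_nf g
    obtain ⟨i', j', k', rfl⟩ := h.exists_nf g'
    exact ⟨_, h.mul_comm_nf two_pos _ _ _ _ _ _⟩
  have hdvd := pow_dvd_pow_add_frob hd hcomm hwb n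
  have haug := map_one_eq_paritySum (χ := χ) w
  have haug0 : MonoidAlgebra.lift F F G 1 w = 0 := by
    have := congrArg (MonoidAlgebra.lift F F G 1) hw
    rw [map_pow, map_zero] at this
    exact pow_eq_zero_iff (by positivity) |>.1 this
  rw [haug0] at haug
  set Z := single d (1 : F) + 1 with hZ
  set s := paritySum χ (1, 0) w + paritySum χ (0, 1) w + paritySum χ (1, 1) w with hs
  have h0 : paritySum χ (0, 0) w = s := by
    rw [← CharTwo.add_eq_zero, haug, hs]
    ring
  have hfrob : frob (n + 1) w = Z ^ 2 ^ n * single 1 (s ^ 2 ^ (n + 1)) := by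
    rw [frob_eq h hχ, ← hs, h0, hZ, single_add_one_pow, add_mul, one_mul, single_mul_single,
      mul_one, one_mul, add_comm]
  rw [hw, zero_add, hfrob, ← mul_add] at hdvd
  have hzero : Z ^ (2 ^ (n + 1) - 1) * frob n b =
      Z ^ (2 ^ (n + 1) - 1) * single (nf x y d 0 0 0) (s ^ 2 ^ (n + 1)) := by
    have hZ0 : Z ^ 2 ^ (n + 1) = 0 := by
      rw [hZ, single_add_one_pow, h.pow_d]
      exact CharTwo.add_self_eq_zero _
    obtain ⟨r, hr⟩ := hdvd
    have h1 := congrArg (Z ^ (2 ^ n - 1) * ·) hr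
    simp only [← mul_assoc, ← pow_add] at h1
    have hpos := Nat.one_le_two_pow (n := n)
    rw [show 2 ^ n - 1 + 2 ^ n = 2 ^ (n + 1) - 1 by rw [pow_succ]; omega,
      show 2 ^ n - 1 + (2 ^ n + 1) = 2 ^ (n + 1) by rw [pow_succ]; omega, hZ0, zero_mul, mul_add,
      add_comm] at h1
    have h2 := CharTwo.add_eq_zero.1 h1
    rw [h2]
    simp [nf]
  rw [mul_frob_eq h hχ, hb0] at hzero
  have hlt : 2 ^ n < 2 ^ (n + 1) := Nat.pow_lt_pow_right one_lt_two (Nat.lt_succ_self n)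
  have hpos : 0 < 2 ^ (n + 1) := by positivity
  have hne : 2 ^ n ≠ 0 := by positivity
  have hcoeff := fun i j => congrArg (fun t => t.coeff (nf x y d i j 0)) hzero
  simp only [mul_add, coeff_add, Finsupp.add_apply] at hcoeff
  have e00 := hcoeff 0 0
  have e10 := hcoeff (2 ^ n) 0
  have e01 := hcoeff 0 (2 ^ n)
  have e11 := hcoeff (2 ^ n) (2 ^ n)
  simp only [hZ, coeff_mul_single_nf h, hlt, hpos, hne, hne.symm, hb1, hb2, hb3] at e00 e10 e01 e11
  simp at e00 e10 e01 e11
  have hs0 : s = 0 := pow_eq_zero_iff (by positivity) |>.1 e00.symm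
  rw [hs0] at hs h0
  rcases eq_mod_two_cases c with rfl | rfl | rfl | rfl
  · exact h0
  all_goals
    clear * - hs e10 e01 e11
    grind

end ParityVanishing

section DualNumbers

open MonoidAlgebra

variable {F : Type*} [Field F]

/-- The algebra `A` has an element killed by the `N`-th power map which is not killed by some
algebra homomorphism to the dual numbers. -/
def HasDualNilpotent (F : Type*) [Field F] (N : ℕ) (A : Type*) [Ring A] [Algebra F A] : Prop :=
  ∃ w : A, w ^ N = 0 ∧ ∃ f : A →ₐ[F] DualNumber F, f w ≠ 0

lemma HasDualNilpotent.of_algEquiv {N : ℕ} {A B : Type*} [Ring A] [Ring B] [Algebra F A]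
    [Algebra F B] (e : A ≃ₐ[F] B) (hA : HasDualNilpotent F N A) : HasDualNilpotent F N B := by
  obtain ⟨w, hw, f, hf⟩ := hA
  exact ⟨e w, by rw [← map_pow, hw, map_zero], f.comp e.symm.toAlgHom, by simpa using hf⟩

variable [CharP F 2] {G : Type*} [Group G] [Finite G] {a b m u v n : ℕ} {x y d : G}

lemma sq_eq_one_of_fst_eq_one {e : DualNumber F} (he : TrivSqZeroExt.fst e = 1) : e ^ 2 = 1 := by
  rw [sq]
  refine TrivSqZeroExt.ext ?_ ?_
  · simp [he]
  · rw [DualNumber.snd_mul, he, one_mul, mul_one, CharTwo.add_self_eq_zero, TrivSqZeroExt.snd_one]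

lemma Std.hasDualNilpotent (h : Std 2 a m m (2 ^ m) (2 ^ m) x y d) (hm : m ≠ 0) :
    HasDualNilpotent F (2 ^ m) (MonoidAlgebra F G) := by
  have h1 : (1 + DualNumber.eps : DualNumber F) ^ 2 ^ m = 1 := by
    obtain ⟨k, rfl⟩ := Nat.exists_eq_succ_of_ne_zero hm
    rw [pow_succ', pow_mul, sq_eq_one_of_fst_eq_one (by simp), one_pow]
  obtain ⟨φ, hφ⟩ := h.exists_hom (K := DualNumber F) (x' := 1) (y' := 1 + DualNumber.eps) (d' := 1)
    ⟨by simp, by simp, by simp, by simp, by simp, by simp [h1]⟩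
  have hy : φ y = 1 + DualNumber.eps := by simpa [nf] using hφ 0 1 0
  refine ⟨single y 1 + 1, ?_, lift F (DualNumber F) G φ, ?_⟩
  · rw [single_add_one_pow, h.pow_y, h.pow_d]
    exact CharTwo.add_self_eq_zero _
  · rw [map_add, lift_single, map_one, hy, one_smul]
    intro h0
    have := congrArg TrivSqZeroExt.snd h0
    simp at this

lemma Std.map_sq_eq_one (h : Std 2 a b m u v x y d) (φ : G →* DualNumber F) (g : G) :
    φ g ^ 2 = 1 := by
  apply sq_eq_one_of_fst_eq_one
  have h1 : φ g ^ 2 ^ (a + b + m) = 1 := by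
    rw [← map_pow, ← h.card_eq, pow_card_eq_one', map_one]
  have h2 := congrArg TrivSqZeroExt.fst h1
  rw [TrivSqZeroExt.fst_pow, TrivSqZeroExt.fst_one] at h2
  have h3 : (TrivSqZeroExt.fst (φ g) + 1) ^ 2 ^ (a + b + m) = 0 := by
    rw [add_pow_char_pow, h2, one_pow, CharTwo.add_self_eq_zero]
  exact CharTwo.add_eq_zero.1 (pow_eq_zero_iff (by positivity) |>.1 h3)

lemma Std.map_nf (h : Std 2 a b m u v x y d) (φ : G →* DualNumber F) (i j k : ℕ) :
    φ (nf x y d i j k) = φ x ^ (i % 2) * φ y ^ (j % 2) := by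
  have hd : φ d = 1 := by
    have h1 := congrArg φ h.comm
    rw [map_mul, map_mul, map_mul, mul_comm (φ y)] at h1
    have hu : IsUnit (φ x * φ y) := by
      rw [← map_mul]
      exact (Group.isUnit (x * y)).map φ
    exact (hu.mul_eq_left.1 h1.symm)
  have hmod : ∀ (g : G) (i : ℕ), φ g ^ i = φ g ^ (i % 2) := by
    intro g i
    conv_lhs => rw [← Nat.div_add_mod i 2, pow_add, pow_mul, h.map_sq_eq_one, one_pow, one_mul]
  rw [nf, map_mul, map_mul, map_pow, map_pow, map_pow, hd, one_pow, mul_one, hmod, hmod y]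

lemma Std.exists_parity (h : Std 2 a b m u v x y d) (ha : a ≠ 0) (hb : b ≠ 0) :
    ∃ χ : G → ZMod 2 × ZMod 2, ∀ i j k, χ (nf x y d i j k) = ((i : ZMod 2), (j : ZMod 2)) := by
  have h2 : (2 : ZMod 2) = 0 := by decide
  obtain ⟨f, hf⟩ := h.exists_hom (K := Multiplicative (ZMod 2 × ZMod 2))
    (x' := Multiplicative.ofAdd (1, 0)) (y' := Multiplicative.ofAdd (0, 1)) (d' := 1)
    ⟨by rw [mul_one, mul_comm], by simp, by simp, by simp, by
      rw [← ofAdd_nsmul]; simp [h2, ha], by rw [← ofAdd_nsmul]; simp [h2, hb]⟩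
  refine ⟨fun g => (f g).toAdd, fun i j k => ?_⟩
  change Multiplicative.toAdd (f _) = _
  rw [hf, nf]
  simp

lemma Std.map_eq_of_parity (h : Std 2 a b m u v x y d) {Γ : Type*} [Group Γ] (π : G →* Γ)
    {χ : Γ → ZMod 2 × ZMod 2}
    (hχ : ∀ i j k, χ (nf (π x) (π y) (π d) i j k) = ((i : ZMod 2), (j : ZMod 2)))
    (f : MonoidAlgebra F G →ₐ[F] DualNumber F) (w : MonoidAlgebra F G) :
    f w = paritySum χ (0, 0) (mapDomainAlgHom F F π w) • 1 +
      paritySum χ (1, 0) (mapDomainAlgHom F F π w) • f (single x 1) +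
      paritySum χ (0, 1) (mapDomainAlgHom F F π w) • f (single y 1) +
      paritySum χ (1, 1) (mapDomainAlgHom F F π w) • (f (single x 1) * f (single y 1)) := by
  induction w using MonoidAlgebra.induction_linear with
  | zero => simp [paritySum_zero]
  | add w₁ w₂ h₁ h₂ =>
    rw [map_add, h₁, h₂]
    simp only [map_add, paritySum_add, add_smul]
    abel
  | single g r =>
    obtain ⟨i, j, k, rfl⟩ := h.exists_nf g
    have hf : f (single (nf x y d i j k) r) =
        r • (f (single x 1) ^ (i % 2) * f (single y 1) ^ (j % 2)) := by
      have := h.map_nf ((f : MonoidAlgebra F G →* DualNumber F).comp (MonoidAlgebra.of F G)) i j k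
      simp only [MonoidHom.comp_apply, of_apply] at this
      rw [← mul_one r, ← smul_eq_mul, ← smul_single, map_smul, smul_eq_mul, mul_one]
      exact congrArg (r • ·) this
    have hπ : mapDomainAlgHom F F π (single (nf x y d i j k) r) =
        single (nf (π x) (π y) (π d) i j k) r := by
      simp [nf]
    rw [hf, hπ]
    simp only [paritySum_single, hχ]
    rcases natCast_parity (F := F) i with ⟨a1, -, c1⟩ | ⟨a1, -, c1⟩ <;>
    rcases natCast_parity (F := F) j with ⟨a2, -, c2⟩ | ⟨a2, -, c2⟩ <;>
    simp [a1, a2, c1, c2]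

lemma Std.not_hasDualNilpotent_of_hom (h : Std 2 a b m u v x y d) {Γ : Type*} [Group Γ] [Finite Γ]
    (π : G →* Γ) (hΓ : Std 2 (n + 1) (n + 1) (n + 1) (2 ^ n) (2 ^ n) (π x) (π y) (π d)) :
    ¬ HasDualNilpotent F (2 ^ (n + 1)) (MonoidAlgebra F G) := by
  rintro ⟨w, hw, f, hf⟩
  obtain ⟨χ, hχ⟩ := hΓ.exists_parity n.succ_ne_zero n.succ_ne_zero
  have hw' : mapDomainAlgHom F F π w ^ 2 ^ (n + 1) = 0 := by rw [← map_pow, hw, map_zero]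
  apply hf
  rw [h.map_eq_of_parity π hχ f w]
  simp only [paritySum_eq_zero hΓ hχ hw', zero_smul, add_zero]

lemma Std.not_hasDualNilpotent_of_lt
    (h : Std 2 a (n + 1) (n + 1) (2 ^ (n + 1)) (2 ^ n) x y d) (ha : n + 1 < a) :
    ¬ HasDualNilpotent F (2 ^ (n + 1)) (MonoidAlgebra F G) := by
  set t := x ^ 2 ^ (n + 1) * d ^ 2 ^ n with ht
  have htc : t ∈ Subgroup.center G := by
    have := h.nf_mem_center (dvd_refl (2 ^ (n + 1))) (dvd_zero _) (2 ^ n)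
    simpa [nf] using this
  have hz2 : (d ^ 2 ^ n) ^ 2 = 1 := by rw [← pow_mul, ← pow_succ, h.pow_d]
  obtain ⟨c, hc⟩ : ∃ c, a = n + 1 + (c + 1) := ⟨a - (n + 2), by omega⟩
  have htpow : t ^ 2 ^ (c + 1) = 1 := by
    have hcomm : Commute (x ^ 2 ^ (n + 1)) (d ^ 2 ^ n) :=
      Commute.pow_pow (show Commute x d from h.comm_x) _ _
    rw [ht, hcomm.mul_pow, ← pow_mul, ← pow_add, ← hc, h.pow_x, h.pow_d, pow_succ', pow_mul, hz2,
      one_pow, one_mul]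
  have hnormal : (Subgroup.zpowers t).Normal := by
    refine ⟨fun g hg k => ?_⟩
    have hgc : g ∈ Subgroup.center G := (Subgroup.zpowers_le.2 htc) hg
    rwa [Subgroup.mem_center_iff.1 hgc k, mul_inv_cancel_right]
  refine h.not_hasDualNilpotent_of_hom (QuotientGroup.mk' (Subgroup.zpowers t))
    ⟨⟨?_, ?_, ?_, ?_, ?_, ?_⟩, ?_, ?_⟩
  · simp only [← map_mul, h.comm]
  · simp only [← map_mul, h.comm_x]
  · simp only [← map_mul, h.comm_y]
  · rw [← map_pow, h.pow_d, map_one]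
  · rw [← map_pow, ← map_pow, ← mul_left_inj (QuotientGroup.mk' (Subgroup.zpowers t) (d ^ 2 ^ n)),
      ← map_mul, ← map_mul, ← ht, ← sq, hz2, map_one]
    exact (QuotientGroup.eq_one_iff t).2 (Subgroup.mem_zpowers t)
  · rw [← map_pow, ← map_pow, h.pow_y]
  · have := congrArg (Subgroup.map (QuotientGroup.mk' (Subgroup.zpowers t))) h.gen
    rwa [MonoidHom.map_closure, Set.image_pair,
      Subgroup.map_top_of_surjective _ (QuotientGroup.mk'_surjective _)] at this
  · have h1 := Subgroup.card_eq_card_quotient_mul_card_subgroup (Subgroup.zpowers t)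
    have h2 : Nat.card (Subgroup.zpowers t) ≤ 2 ^ (c + 1) := by
      rw [Nat.card_zpowers]
      exact Nat.le_of_dvd (by positivity) (orderOf_dvd_of_pow_eq_one htpow)
    rw [h.card_eq] at h1
    have h3 : 2 ^ (n + 1 + (n + 1) + (n + 1)) * 2 ^ (c + 1) ≤
        Nat.card (G ⧸ Subgroup.zpowers t) * 2 ^ (c + 1) := by
      rw [← pow_add, show n + 1 + (n + 1) + (n + 1) + (c + 1) = a + (n + 1) + (n + 1) by omega, h1]
      exact Nat.mul_le_mul_left _ h2
    exact Nat.le_of_mul_le_mul_right h3 (by positivity)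

lemma Std.not_hasDualNilpotent {r s : ℕ} (h : Std 2 a m m (2 ^ r) (2 ^ s) x y d) (hma : m ≤ a)
    (hs : s + 1 = m) (hsr : s ≤ r) (hrs : r ≤ s + (a - m)) (hr : r = m ∨ a = m) :
    ¬ HasDualNilpotent F (2 ^ m) (MonoidAlgebra F G) := by
  subst hs
  rcases hma.eq_or_lt with rfl | hlt
  · obtain rfl : r = s := by omega
    exact h.not_hasDualNilpotent_of_hom (MonoidHom.id G) h
  · obtain rfl : r = s + 1 := by omega
    exact h.not_hasDualNilpotent_of_lt hlt

end DualNumbers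

end ModularIsomorphism

/-- The Modular Isomorphism Problem has a positive answer for finite two-generated
`p`-groups of nilpotency class exactly two, over any field of characteristic `p`. -/
theorem mip_two_generated_class_two (p : ℕ) [Fact p.Prime]
    (F : Type*) [Field F] [CharP F p]
    (G H : Type*) [Group G] [Finite G] [Group H] [Finite H]
    (hG : IsPGroup p G)
    (hgen : ∃ x y : G, Subgroup.closure {x, y} = ⊤)
    (hnonab : ¬ ∀ x y : G, x * y = y * x)
    (hclass : commutator G ≤ Subgroup.center G)
    (hiso : Nonempty (MonoidAlgebra F G ≃ₐ[F] MonoidAlgebra F H)) :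
    Nonempty (G ≃* H) := by
  obtain ⟨e⟩ := hiso
  have hH := ModularIsomorphism.isPGroup_of_algEquiv e hG
  have hclassH := ModularIsomorphism.commutator_le_center_of_algEquiv e hG hclass
  have hgenH := ModularIsomorphism.two_generated_of_algEquiv e hG hclass hgen
  have hnonabH : ¬ ∀ x y : H, x * y = y * x := by
    rwa [← ModularIsomorphism.card_commutator_eq_one_iff,
      ← ModularIsomorphism.card_commutator_eq e, ModularIsomorphism.card_commutator_eq_one_iff]
  obtain ⟨a, b, m, r, s, x, y, d, hm, hmb, hba, hsr, hrm, hrs, h⟩ :=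
    ModularIsomorphism.exists_normalized_std hG hgen hnonab hclass
  obtain ⟨a', b', m', r', s', x', y', d', hm', hmb', hba', hsr', hrm', hrs', h'⟩ :=
    ModularIsomorphism.exists_normalized_std hH hgenH hnonabH hclassH
  obtain ⟨rfl, rfl, rfl⟩ := h.params_eq h' hba hba' e
  rcases h.eq_or_exceptional h' e hm hmb hba hrm hrm' hsr hsr' hrs hrs' with
    ⟨rfl, rfl⟩ | ⟨rfl, rfl, ⟨rfl, rfl, hs, hr⟩ | ⟨rfl, rfl, hs, hr⟩⟩
  · exact h.nonempty_mulEquiv h'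
  · exact absurd ((h.hasDualNilpotent hm).of_algEquiv e)
      (h'.not_hasDualNilpotent hba hs hsr' hrs' hr)
  · exact absurd ((h'.hasDualNilpotent hm).of_algEquiv e.symm)
      (h.not_hasDualNilpotent hba hs hsr hrs hr)
end

section
/- Let p be a prime, G a finite p-group, and K, L normal subgroups of G such that L is contained in the Frattini subgroup of K. Then for every subgroup H of G containing K, the minimal number of generators of H equals the minimal number of generators of the quotient group H/L (note L ≤ K ≤ H and L is normal in H). -/
/-- The minimal number of generators of a group: the least cardinality of a
generating subset. -/
noncomputable def minNumGen (G : Type*) [Group G] : ℕ :=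
  sInf {n | ∃ S : Finset G, S.card = n ∧ Subgroup.closure (S : Set G) = ⊤}

theorem minNumGen_eq_rank (G : Type*) [Group G] [Group.FG G] : minNumGen G = Group.rank G := by
  refine le_antisymm (Nat.sInf_le (Group.rank_spec G)) ?_
  refine le_csInf ⟨_, Group.rank_spec G⟩ ?_
  rintro _ ⟨S, rfl, hS⟩
  exact Group.rank_le hS

/-- The rank does not drop along a surjection whose kernel consists of non-generators. -/
theorem rank_eq_of_surjective_of_nongenerating {G Q : Type*} [Group G] [Group Q]
    [Group.FG G] [Group.FG Q] (f : G →* Q) (hf : Function.Surjective f)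
    (hker : ∀ T : Subgroup G, T.map f = ⊤ → T = ⊤) : Group.rank G = Group.rank Q := by
  classical
  refine le_antisymm ?_ (Group.rank_le_of_surjective f hf)
  obtain ⟨S, hcard, hS⟩ := Group.rank_spec Q
  have himage : f '' (S.image (Function.surjInv hf) : Finset G) = (S : Set Q) := by
    rw [Finset.coe_image, ← Set.image_comp, Function.comp_def]
    simp [Function.surjInv_eq hf]
  rw [← hcard]
  refine (Group.rank_le (hker _ ?_)).trans (Finset.card_image_le (f := Function.surjInv hf))
  rw [MonoidHom.map_closure, himage, hS]

/-- If `L` lies in the Frattini subgroup of `K ≤ H`, then a subgroup of `H` which covers `H / L`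
is all of `H`. -/
theorem eq_top_of_map_mk_eq_top_of_le_frattini {G : Type*} [Group G] {K L H : Subgroup G}
    [IsCoatomic (Subgroup K)] [L.Normal] (hLK : L ≤ (frattini K).map K.subtype) (hKH : K ≤ H)
    {T : Subgroup H} (hT : T.map (QuotientGroup.mk' (L.subgroupOf H)) = ⊤) : T = ⊤ := by
  have cover : ∀ h : H, ∃ t ∈ T, ((t : G)⁻¹ * h) ∈ L := by
    intro h
    have hmem : QuotientGroup.mk' (L.subgroupOf H) h ∈ T.map (QuotientGroup.mk' _) := by
      rw [hT]; trivial
    obtain ⟨t, ht, hth⟩ := hmem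
    exact ⟨t, ht, Subgroup.mem_subgroupOf.mp (QuotientGroup.eq.mp hth)⟩
  have hLleK : L ≤ K := hLK.trans (Subgroup.map_subtype_le _)
  have hKT : T.comap (Subgroup.inclusion hKH) = ⊤ := by
    refine frattini_nongenerating (eq_top_iff.mpr fun k _ => ?_)
    obtain ⟨t, ht, htk⟩ := cover (Subgroup.inclusion hKH k)
    obtain ⟨l, hl, hlk⟩ := hLK htk
    have htl : (t : G) * l = k := by
      simp only [Subgroup.coe_subtype, Subgroup.coe_inclusion] at hlk
      rw [hlk, mul_inv_cancel_left]
    have htK : (t : G) ∈ K := by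
      rw [eq_mul_inv_of_mul_eq htl]
      exact K.mul_mem k.2 (K.inv_mem l.2)
    have hk : k = ⟨t, htK⟩ * l := Subtype.ext htl.symm
    rw [hk]
    exact Subgroup.mul_mem_sup ht hl
  refine eq_top_iff.mpr fun h _ => ?_
  obtain ⟨t, ht, hth⟩ := cover h
  have hmem : (⟨(t : G)⁻¹ * h, hLleK hth⟩ : K) ∈ T.comap (Subgroup.inclusion hKH) := by
    rw [hKT]; trivial
  have hmem' : t⁻¹ * h ∈ T := hmem
  exact (T.mul_mem_cancel_left (T.inv_mem ht)).mp hmem'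

/-- If `K` and `L` are normal subgroups of a finite `p`-group `G` with `L` contained in the
Frattini subgroup of `K`, then for every subgroup `H` of `G` containing `K` the minimal number
of generators of `H` equals that of `H / L`. -/
theorem minNumGen_quotient_eq (p : ℕ) [Fact p.Prime]
    (G : Type*) [Group G] [Finite G] (hG : IsPGroup p G)
    (K L : Subgroup G) [K.Normal] [L.Normal]
    (hLK : L ≤ (frattini K).map K.subtype) :
    ∀ H : Subgroup G, K ≤ H →
      minNumGen H = minNumGen (↥H ⧸ L.subgroupOf H) := by
  intro H hKH
  rw [minNumGen_eq_rank, minNumGen_eq_rank]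
  exact rank_eq_of_surjective_of_nongenerating (QuotientGroup.mk' (L.subgroupOf H))
    (QuotientGroup.mk'_surjective _)
    fun _ hT => eq_top_of_map_mk_eq_top_of_le_frattini hLK hKH hT
end

section
/- Let p be a prime and G a finite p-group. Then G is metacyclic if and only if the quotient group G/Frat(G') is metacyclic, where Frat(G') denotes the Frattini subgroup of the derived subgroup G' of G (which is a normal subgroup of G). -/
/-- A group is *metacyclic* if it has a cyclic normal subgroup with cyclic quotient. -/
def IsMetacyclic (G : Type*) [Group G] : Prop :=
  ∃ N : Subgroup G, ∃ h : N.Normal, IsCyclic N ∧ (haveI := h; IsCyclic (G ⧸ N))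

theorem IsMetacyclic.of_surjective {G H : Type*} [Group G] [Group H] (hG : IsMetacyclic G)
    {f : G →* H} (hf : Function.Surjective f) : IsMetacyclic H := by
  obtain ⟨N, hN, hcyc, hquot⟩ := hG
  have hmap : (N.map f).Normal := hN.map f hf
  refine ⟨N.map f, hmap, ?_, ?_⟩
  · exact isCyclic_of_surjective (f.subgroupMap N) (f.subgroupMap_surjective N)
  · refine isCyclic_of_surjective
      (QuotientGroup.map N (N.map f) f (Subgroup.le_comap_map f N)) ?_
    exact QuotientGroup.map_surjective_of_surjective _ _ _
      ((QuotientGroup.mk'_surjective _).comp hf) _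

/-- The Frattini subgroup of `K` consists of nongenerators of every subgroup containing `K`. -/
theorem le_of_le_sup_map_frattini {G : Type*} [Group G] {K : Subgroup G} [Finite K]
    [((frattini K).map K.subtype).Normal] {H : Subgroup G}
    (h : K ≤ H ⊔ (frattini K).map K.subtype) : K ≤ H := by
  have htop : H.subgroupOf K ⊔ frattini K = ⊤ := by
    refine eq_top_iff.2 fun k _ => ?_
    obtain ⟨x, hx, _, ⟨y, hy, rfl⟩, hxy⟩ := Subgroup.mem_sup_of_normal_right.1 (h k.2)
    have hk : k * y⁻¹ ∈ H.subgroupOf K := by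
      rw [Subgroup.mem_subgroupOf]
      simpa [← hxy] using hx
    simpa using Subgroup.mul_mem_sup hk hy
  exact Subgroup.subgroupOf_eq_top.1 (frattini_nongenerating htop)

theorem IsMetacyclic.of_quotient_frattini_commutator {G : Type*} [Group G] [Finite G]
    (h : IsMetacyclic (G ⧸ (frattini (commutator G)).map (commutator G).subtype)) :
    IsMetacyclic G := by
  set F := (frattini (commutator G)).map (commutator G).subtype
  obtain ⟨N, hN, hcyc, hquot⟩ := h
  let M := N.comap (QuotientGroup.mk' F)
  have hM : IsCyclic (G ⧸ M) := by
    refine isCyclic_of_injective (QuotientGroup.map M N (QuotientGroup.mk' F) le_rfl) ?_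
    rw [injective_iff_map_eq_one]
    intro x hx
    induction x using QuotientGroup.induction_on with
    | H g =>
      rw [QuotientGroup.map_mk, QuotientGroup.eq_one_iff] at hx
      exact (QuotientGroup.eq_one_iff g).2 hx
  have hcomm : commutator G ≤ M :=
    Subgroup.Normal.quotient_commutative_iff_commutator_le.1 hM.isMulCommutative
  obtain ⟨y, hy⟩ := (Subgroup.isCyclic_iff_exists_zpowers_eq_top N).1 hcyc
  obtain ⟨x, rfl⟩ := QuotientGroup.mk'_surjective F y
  have hsup : Subgroup.zpowers x ⊔ F = M := by
    simp only [M]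
    rw [← hy, ← MonoidHom.map_zpowers, Subgroup.comap_map_eq, QuotientGroup.ker_mk']
  have hle : commutator G ≤ Subgroup.zpowers x :=
    le_of_le_sup_map_frattini (hcomm.trans hsup.ge)
  have hxM : Subgroup.zpowers x = M := by
    rw [← hsup]
    exact (sup_eq_left.2 ((Subgroup.map_subtype_le _).trans hle)).symm
  exact ⟨M, inferInstance, (Subgroup.isCyclic_iff_exists_zpowers_eq_top M).2 ⟨x, hxM⟩, hM⟩

/-- A finite `p`-group `G` is metacyclic if and only if `G / Frat(G')` is metacyclic. -/
theorem isMetacyclic_iff_quotient_frattini_commutator (p : ℕ) [Fact p.Prime]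
    (G : Type*) [Group G] [Finite G] (hG : IsPGroup p G) :
    IsMetacyclic G ↔
      IsMetacyclic (G ⧸ (frattini (commutator G)).map (commutator G).subtype) :=
  ⟨fun h => h.of_surjective (QuotientGroup.mk'_surjective _),
    IsMetacyclic.of_quotient_frattini_commutator⟩
end

section
/- Let p be a prime and G a finite p-group whose derived subgroup G' has order exactly p and which can be generated by two elements. Then G/Z(G) is elementary abelian of rank 2, that is, G/Z(G) is isomorphic to the direct product of two cyclic groups of order p. -/
open scoped commutatorElement

/-- A normal subgroup of prime order `p` in a `p`-group is central. -/
theorem IsPGroup.le_center_of_normal_of_card_eq_prime {p : ℕ} [Fact p.Prime] {G : Type*} [Group G]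
    (hG : IsPGroup p G) (N : Subgroup G) [N.Normal] (hN : Nat.card N = p) :
    N ≤ Subgroup.center G := by
  have hp : p.Prime := Fact.out
  have : Finite N := Nat.finite_of_card_ne_zero (hN ▸ hp.ne_zero)
  have hG' : IsPGroup p (ConjAct G) := hG.of_equiv ConjAct.toConjAct
  obtain ⟨z, hz, hz1⟩ := hG'.exists_fixed_point_of_prime_dvd_card_of_fixed_point N hN.symm.dvd
    (a := 1) fun g => smul_one g
  have hzc : (z : G) ∈ Subgroup.center G := Subgroup.mem_center_iff.2 fun g => by
    have h := congrArg Subtype.val (hz (ConjAct.toConjAct g))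
    rwa [ConjAct.Subgroup.val_conj_smul, ConjAct.toConjAct_smul, mul_inv_eq_iff_eq_mul] at h
  intro n hn
  obtain ⟨k, hk⟩ := Subgroup.mem_zpowers_iff.1
    (mem_zpowers_of_prime_card hN hz1.symm : (⟨n, hn⟩ : N) ∈ Subgroup.zpowers z)
  have h : (z : G) ^ k = n := congrArg Subtype.val hk
  exact h ▸ zpow_mem hzc k

/-- If the derived subgroup is central, then commutation with `a` is a homomorphism. -/
def commutatorHomOfLeCenter {G : Type*} [Group G] (h : commutator G ≤ Subgroup.center G) (a : G) :
    G →* commutator G where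
  toFun g := ⟨⁅g, a⁆, Subgroup.commutator_mem_commutator (Subgroup.mem_top _) (Subgroup.mem_top _)⟩
  map_one' := Subtype.ext (commutatorElement_one_left a)
  map_mul' g k := Subtype.ext <| by
    have hk : ⁅k, a⁆ ∈ Subgroup.center G :=
      h (Subgroup.commutator_mem_commutator (Subgroup.mem_top _) (Subgroup.mem_top _))
    have hc := Subgroup.mem_center_iff.1 hk
    change ⁅g * k, a⁆ = ⁅g, a⁆ * ⁅k, a⁆
    rw [commutatorElement_mul_left_eq_conj_mul, hc g, mul_inv_cancel_right, hc]

theorem commutatorHomOfLeCenter_eq_one_iff {G : Type*} [Group G]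
    (h : commutator G ≤ Subgroup.center G) (a g : G) :
    commutatorHomOfLeCenter h a g = 1 ↔ Commute g a :=
  Subtype.ext_iff.trans (commutatorElement_eq_one_iff_commute (g₁ := g) (g₂ := a))

theorem mem_center_of_commute_of_closure_pair_eq_top {G : Type*} [Group G] {x y g : G}
    (hxy : Subgroup.closure {x, y} = ⊤) (hx : Commute g x) (hy : Commute g y) :
    g ∈ Subgroup.center G := by
  have h : Subgroup.closure {x, y} ≤ Subgroup.centralizer {g} := by
    rw [Subgroup.closure_le]
    rintro _ (rfl | rfl) <;> rw [SetLike.mem_coe, Subgroup.mem_centralizer_singleton_iff]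
    exacts [hx.symm, hy.symm]
  rw [hxy] at h
  exact Subgroup.mem_center_iff.2 fun k =>
    Subgroup.mem_centralizer_singleton_iff.1 (h (Subgroup.mem_top k))

theorem commutator_eq_bot_of_commute_of_closure_pair_eq_top {G : Type*} [Group G] {x y : G}
    (hxy : Subgroup.closure {x, y} = ⊤) (h : Commute x y) : commutator G = ⊥ := by
  rw [commutator_eq_bot_iff_center_eq_top, eq_top_iff, ← hxy, Subgroup.closure_le]
  rintro _ (rfl | rfl)
  exacts [mem_center_of_commute_of_closure_pair_eq_top hxy (.refl _) h,
    mem_center_of_commute_of_closure_pair_eq_top hxy h.symm (.refl _)]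

/-- If `G` is a finite two-generated `p`-group whose derived subgroup has order exactly `p`,
then `G/Z(G)` is elementary abelian of rank `2`, i.e. isomorphic to `C_p × C_p`. -/
theorem quotient_center_elementary_abelian_rank_two (p : ℕ) [Fact p.Prime]
    (G : Type*) [Group G] [Finite G] (hG : IsPGroup p G)
    (hG' : Nat.card (commutator G) = p)
    (hgen : ∃ x y : G, Subgroup.closure {x, y} = ⊤) :
    Nonempty ((G ⧸ Subgroup.center G) ≃*
      (Multiplicative (ZMod p) × Multiplicative (ZMod p))) := by
  obtain ⟨x, y, hxy⟩ := hgen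
  have hp : p.Prime := Fact.out
  have hc := hG.le_center_of_normal_of_card_eq_prime (commutator G) hG'
  let f := commutatorHomOfLeCenter hc
  have hfy : f y x ≠ 1 := fun h => by
    rw [commutator_eq_bot_of_commute_of_closure_pair_eq_top hxy
      ((commutatorHomOfLeCenter_eq_one_iff hc y x).1 h), Subgroup.card_bot] at hG'
    exact hp.one_lt.ne hG'
  have hfx : f x y ≠ 1 := fun h =>
    hfy ((commutatorHomOfLeCenter_eq_one_iff hc y x).2
      ((commutatorHomOfLeCenter_eq_one_iff hc x y).1 h).symm)
  have hself (a : G) : f a a = 1 := (commutatorHomOfLeCenter_eq_one_iff hc a a).2 (.refl a)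
  have hker : ((f x).prod (f y)).ker = Subgroup.center G := by
    ext g
    rw [MonoidHom.mem_ker, MonoidHom.prod_apply, Prod.mk_eq_one,
      commutatorHomOfLeCenter_eq_one_iff, commutatorHomOfLeCenter_eq_one_iff]
    exact ⟨fun h => mem_center_of_commute_of_closure_pair_eq_top hxy h.1 h.2, fun h =>
      ⟨(Subgroup.mem_center_iff.1 h x).symm, (Subgroup.mem_center_iff.1 h y).symm⟩⟩
  have hsurj : Function.Surjective ((f x).prod (f y)) := by
    rintro ⟨u, v⟩
    obtain ⟨k, hk⟩ := Subgroup.mem_zpowers_iff.1 (mem_zpowers_of_prime_card hG' hfx (g' := u))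
    obtain ⟨l, hl⟩ := Subgroup.mem_zpowers_iff.1 (mem_zpowers_of_prime_card hG' hfy (g' := v))
    exact ⟨y ^ k * x ^ l, by simp [hself, hk, hl]⟩
  have e : commutator G ≃* Multiplicative (ZMod p) :=
    mulEquivOfPrimeCardEq hG' (by simp)
  exact ⟨(QuotientGroup.quotientMulEquivOfEq hker.symm).trans <|
    (QuotientGroup.quotientKerEquivOfSurjective _ hsurj).trans <| e.prodCongr e⟩
end

section
/- Let p be a prime, F a field of characteristic p, G a finite p-group whose derived subgroup G' is cyclic, and H a finite group. If the group algebras F[G] and F[H] are isomorphic as F-algebras, then the derived subgroup H' of H is cyclic and G' is isomorphic to H'. -/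
namespace MonoidAlgebra

variable {F G H Q : Type*} [Field F] [Group G] [Group H] [Group Q]

theorem mapDomainAlgHom_single_sub_one (f : G →* Q) (n : f.ker) :
    mapDomainAlgHom F F f (single (n : G) 1 - 1) = 0 := by
  have hn : f n = 1 := n.2
  rw [map_sub, map_one]
  simp [hn, one_def]

/-- The kernel of `F[G] → F[Q]` is spanned by the elements `g * n - g` with `n` in the kernel
of `G → Q`. -/
theorem mem_span_of_mapDomainAlgHom_eq_zero (f : G →* Q) {k : MonoidAlgebra F G}
    (hk : mapDomainAlgHom F F f k = 0) :
    k ∈ Submodule.span F (Set.range fun x : G × f.ker ↦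
      (single (x.1 * x.2) 1 - single x.1 1 : MonoidAlgebra F G)) := by
  set S := Submodule.span F (Set.range fun x : G × f.ker ↦
      (single (x.1 * x.2) 1 - single x.1 1 : MonoidAlgebra F G))
  let s : Q → G := Function.invFun f
  have hs (g : G) : f (s (f g)) = f g := Function.invFun_eq ⟨g, rfl⟩
  have key (a : MonoidAlgebra F G) : a - mapDomain s (mapDomainAlgHom F F f a) ∈ S := by
    induction a using MonoidAlgebra.induction_linear with
    | zero => simp
    | add a b ha hb =>
      rw [map_add, mapDomain_add, add_sub_add_comm]
      exact S.add_mem ha hb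
    | single g r =>
      have h : (s (f g))⁻¹ * g ∈ f.ker := by simp [MonoidHom.mem_ker, hs]
      have := S.smul_mem r (Submodule.subset_span ⟨(s (f g), ⟨_, h⟩), rfl⟩)
      simpa [smul_sub] using this
  simpa [hk] using key k

/-- If the kernel of `G → Q` is generated by `c`, then the kernel of `F[G] → F[Q]` is generated
by `c - 1` as a left ideal. -/
theorem exists_eq_mul_of_mapDomainAlgHom_eq_zero [Finite G] (f : G →* Q) {c : f.ker}
    (hc : ∀ n, n ∈ Subgroup.zpowers c) {k : MonoidAlgebra F G}
    (hk : mapDomainAlgHom F F f k = 0) :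
    ∃ a, k = a * (single (c : G) 1 - 1) := by
  have hmem := mem_span_of_mapDomainAlgHom_eq_zero f hk
  clear hk
  induction hmem using Submodule.span_induction with
  | mem x hx =>
    obtain ⟨⟨g, n⟩, rfl⟩ := hx
    obtain ⟨m, rfl⟩ := mem_powers_iff_mem_zpowers.2 (hc n)
    refine ⟨single g 1 * ∑ i ∈ Finset.range m, single (c : G) 1 ^ i, ?_⟩
    rw [mul_assoc, geom_sum_mul, mul_sub, mul_one]
    simp [single_pow, single_mul_single]
  | zero => exact ⟨0, by simp⟩
  | add x y _ _ hx hy =>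
    obtain ⟨a, ha⟩ := hx
    obtain ⟨b, hb⟩ := hy
    exact ⟨a + b, by rw [add_mul, ← ha, ← hb]⟩
  | smul r x _ hx =>
    obtain ⟨a, ha⟩ := hx
    exact ⟨r • a, by rw [smul_mul_assoc, ← ha]⟩

/-- A homomorphism from the kernel of `G → Q` to the additive group of `F` extends to a linear
functional on `F[G]` which is semi-invariant on the kernel of `F[G] → F[Q]`. -/
theorem exists_linearMap_extending_hom (f : G →* Q) (φ : f.ker →* Multiplicative F) :
    ∃ D : MonoidAlgebra F G →ₗ[F] F,
      (∀ n : f.ker, D (single (n : G) 1 - 1) = (φ n).toAdd) ∧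
      ∀ b k, mapDomainAlgHom F F f k = 0 →
        D (b * k) = lift F F G (1 : G →* F) b * D k := by
  let s : Q → G := Function.invFun f
  have hs (g : G) : f (s (f g)) = f g := Function.invFun_eq ⟨g, rfl⟩
  have hmem (g : G) : (s (f g))⁻¹ * g ∈ f.ker := by simp [MonoidHom.mem_ker, hs]
  let d (g : G) : F := (φ ⟨_, hmem g⟩).toAdd
  have hd (g : G) (n : f.ker) : d (g * n) = d g + (φ n).toAdd := by
    have hn : f n = 1 := n.2
    simp only [d, ← toAdd_mul, ← map_mul]
    congr 2
    ext
    simp [hn, mul_assoc]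
  let D : MonoidAlgebra F G →ₗ[F] F := (basis G F).constr F d
  have hD (g : G) : D (single g 1) = d g := by
    rw [← basis_apply]
    exact (basis G F).constr_basis F d g
  have hDn (g : G) (n : f.ker) : D (single (g * n) 1 - single g 1) = (φ n).toAdd := by
    rw [map_sub, hD, hD, hd, add_sub_cancel_left]
  refine ⟨D, fun n ↦ by simpa [one_def] using hDn 1 n, fun b k hk ↦ ?_⟩
  have hspan := mem_span_of_mapDomainAlgHom_eq_zero f hk
  clear hk
  induction hspan using Submodule.span_induction with
  | mem x hx =>
    obtain ⟨⟨g, n⟩, rfl⟩ := hx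
    induction b using MonoidAlgebra.induction_linear with
    | zero => simp
    | add a b ha hb => rw [add_mul, map_add, map_add, ha, hb, add_mul]
    | single h r =>
      have : (single h r : MonoidAlgebra F G) * (single (g * n) 1 - single g 1) =
          r • (single (h * g * n) 1 - single (h * g) 1) := by
        simp [mul_sub, smul_sub, single_mul_single, mul_assoc]
      rw [this, map_smul, hDn, hDn]
      simp
  | zero => simp
  | add x y _ _ hx hy => rw [mul_add, map_add, map_add, hx, hy, mul_add]
  | smul r x _ hx => rw [mul_smul_comm, map_smul, map_smul, hx, mul_smul_comm]

/-- An algebra homomorphism between group algebras descends to the group algebras of the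
abelianizations. -/
theorem exists_algHom_abelianization (e : MonoidAlgebra F G →ₐ[F] MonoidAlgebra F H) :
    ∃ e' : MonoidAlgebra F (Abelianization G) →ₐ[F] MonoidAlgebra F (Abelianization H),
      ∀ a, e' (mapDomainAlgHom F F Abelianization.of a) =
        mapDomainAlgHom F F Abelianization.of (e a) := by
  let π := (mapDomainAlgHom F F (Abelianization.of (G := H))).comp e
  let u : G →* (MonoidAlgebra F (Abelianization H))ˣ :=
    ((π : MonoidAlgebra F G →* _).comp (of F G)).toHomUnits
  let v : Abelianization G →* MonoidAlgebra F (Abelianization H) :=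
    (Units.coeHom _).comp (Abelianization.lift u)
  refine ⟨lift F _ _ v, fun a ↦ ?_⟩
  induction a using MonoidAlgebra.induction_linear with
  | zero => simp
  | add a b ha hb => simp only [map_add, ha, hb]
  | single g r =>
    have : (single g r : MonoidAlgebra F G) = r • of F G g := by simp
    rw [this]
    simp only [map_smul]
    congr 1
    simp [v, u, π]

theorem card_abelianization_le [Finite G]
    {e : MonoidAlgebra F G →ₐ[F] MonoidAlgebra F H} (he : Function.Surjective e) :
    Nat.card (Abelianization H) ≤ Nat.card (Abelianization G) := by
  obtain ⟨e', he'⟩ := exists_algHom_abelianization e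
  have hsurj : Function.Surjective e' := fun y ↦ by
    obtain ⟨b, rfl⟩ : ∃ b, mapDomainAlgHom F F (Abelianization.of (G := H)) b = y := by
      induction y using MonoidAlgebra.induction_linear with
      | zero => exact ⟨0, map_zero _⟩
      | add x y hx hy =>
        obtain ⟨a, rfl⟩ := hx
        obtain ⟨b, rfl⟩ := hy
        exact ⟨a + b, map_add _ _ _⟩
      | single q r =>
        obtain ⟨h, rfl⟩ := QuotientGroup.mk_surjective q
        exact ⟨single h r, by simp; rfl⟩
    obtain ⟨a, rfl⟩ := he b
    exact ⟨_, he' a⟩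
  have : Finite (Abelianization G) := Quotient.finite _
  have : Module.Finite F (MonoidAlgebra F (Abelianization G)) := .of_basis (basis _ F)
  have := e'.toLinearMap.finrank_le_finrank_of_surjective hsurj
  rwa [Module.finrank_eq_nat_card_basis (basis _ F),
    Module.finrank_eq_nat_card_basis (basis _ F)] at this

end MonoidAlgebra

namespace IsPGroup

variable {p : ℕ} [hp : Fact p.Prime] (F : Type*) [Field F] [CharP F p]

theorem exists_hom_ker_eq_of_isCoatom {N : Type*} [Group N] [Finite N] (hN : IsPGroup p N)
    {M : Subgroup N} (hM : IsCoatom M) : ∃ φ : N →* Multiplicative F, φ.ker = M := by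
  have := hN.isNilpotent
  have : M.Normal := Subgroup.NormalizerCondition.normal_of_coatom M
    Group.normalizerCondition_of_isNilpotent hM
  have : Nontrivial (N ⧸ M) := QuotientGroup.nontrivial_iff.2 hM.1
  obtain ⟨x, hx⟩ := exists_prime_orderOf_dvd_card' p
    ((hN.to_quotient M).card_eq_or_dvd.resolve_left Finite.one_lt_card.ne')
  have hxtop : Subgroup.zpowers x = ⊤ := by
    have hlt : M < (Subgroup.zpowers x).comap (QuotientGroup.mk' M) := by
      refine lt_of_le_of_ne (fun m hm ↦ ?_) fun h ↦ hp.out.one_lt.ne' ?_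
      · rw [Subgroup.mem_comap, QuotientGroup.mk'_apply, (QuotientGroup.eq_one_iff m).2 hm]
        exact one_mem _
      · obtain ⟨y, rfl⟩ := QuotientGroup.mk_surjective x
        rw [← hx, orderOf_eq_one_iff, QuotientGroup.eq_one_iff, h]
        exact Subgroup.mem_zpowers _
    rw [← Subgroup.map_comap_eq_self_of_surjective (QuotientGroup.mk'_surjective M)
      (Subgroup.zpowers x), hM.2 _ hlt, ← MonoidHom.range_eq_map,
      MonoidHom.range_eq_top.2 (QuotientGroup.mk'_surjective M)]
  have hcard : Nat.card (N ⧸ M) = p := by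
    rw [← hx, ← Nat.card_zpowers, hxtop, Subgroup.card_top]
  have hcyc : IsCyclic (N ⧸ M) := isCyclic_of_prime_card hcard
  let ι : N ⧸ M ≃* Multiplicative (ZMod p) :=
    mulEquivOfCyclicCardEq (by simp [hcard])
  let j : Multiplicative (ZMod p) →* Multiplicative F :=
    AddMonoidHom.toMultiplicative (ZMod.castHom dvd_rfl F : ZMod p →+* F).toAddMonoidHom
  have hj : Function.Injective (j.comp ι.toMonoidHom) :=
    (show Function.Injective j from (ZMod.castHom dvd_rfl F : ZMod p →+* F).injective).comp
      ι.injective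
  refine ⟨(j.comp ι.toMonoidHom).comp (QuotientGroup.mk' M), ?_⟩
  rw [MonoidHom.ker_comp_of_injective _ _ hj, QuotientGroup.ker_mk']

/-- A finite `p`-group is cyclic if any two nontrivial homomorphisms to the additive group of a
field of characteristic `p` have the same kernel. -/
theorem isCyclic_of_hom_ker_le {N : Type*} [Group N] [Finite N] (hN : IsPGroup p N)
    (h : ∀ φ ψ : N →* Multiplicative F, φ ≠ 1 → φ.ker ≤ ψ.ker) : IsCyclic N := by
  have huniq {M₁ M₂ : Subgroup N} (h₁ : IsCoatom M₁) (h₂ : IsCoatom M₂) : M₁ = M₂ := by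
    obtain ⟨φ, rfl⟩ := hN.exists_hom_ker_eq_of_isCoatom F h₁
    obtain ⟨ψ, rfl⟩ := hN.exists_hom_ker_eq_of_isCoatom F h₂
    exact (h₁.le_iff_eq h₂.1).1 (h φ ψ fun h ↦ h₁.1 (by simp [h])) |>.symm
  rcases eq_top_or_exists_le_coatom (⊥ : Subgroup N) with htop | ⟨M, hM, -⟩
  · refine ⟨1, fun x ↦ ?_⟩
    have : x ∈ (⊥ : Subgroup N) := htop ▸ Subgroup.mem_top x
    exact ⟨0, by simp [Subgroup.mem_bot.1 this]⟩
  · obtain ⟨g, hg⟩ : ∃ g, g ∉ M := by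
      by_contra! hall
      exact hM.1 (eq_top_iff.2 fun x _ ↦ hall x)
    refine ⟨g, fun x ↦ ?_⟩
    rcases eq_top_or_exists_le_coatom (Subgroup.zpowers g) with htop | ⟨M', hM', hle⟩
    · exact Subgroup.mem_zpowers_iff.1 (htop ▸ Subgroup.mem_top x)
    · exact absurd (huniq hM' hM ▸ hle (Subgroup.mem_zpowers g)) hg

open MonoidAlgebra in
theorem isCyclic_ker_of_principal {G Q : Type*} [Group G] [Finite G] [Group Q]
    (hG : IsPGroup p G) (f : G →* Q) {x : MonoidAlgebra F G}
    (hx : mapDomainAlgHom F F f x = 0)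
    (h : ∀ k, mapDomainAlgHom F F f k = 0 → ∃ a, k = a * x) : IsCyclic f.ker := by
  refine (hG.to_subgroup f.ker).isCyclic_of_hom_ker_le F fun φ ψ hφ n hn ↦ ?_
  obtain ⟨D, hD, hDm⟩ := exists_linearMap_extending_hom f φ
  obtain ⟨E, hE, hEm⟩ := exists_linearMap_extending_hom f ψ
  have hmul (n : f.ker) : ∃ r : F, (φ n).toAdd = r * D x ∧ (ψ n).toAdd = r * E x := by
    obtain ⟨a, ha⟩ := h _ (mapDomainAlgHom_single_sub_one f n)
    exact ⟨_, by rw [← hD, ha, hDm _ _ hx], by rw [← hE, ha, hEm _ _ hx]⟩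
  have hDx : D x ≠ 0 := fun h0 ↦ hφ <| by
    ext m
    obtain ⟨r, hr, -⟩ := hmul m
    simpa [h0] using hr
  obtain ⟨r, hr, hr'⟩ := hmul n
  rw [MonoidHom.mem_ker.1 hn, toAdd_one, eq_comm, mul_eq_zero, or_iff_left hDx] at hr
  simpa [hr] using hr'

end IsPGroup

open MonoidAlgebra

/-- If `G` is a finite `p`-group with cyclic derived subgroup and `F` is a field of
characteristic `p`, then the isomorphism type of the derived subgroup is an `F`-invariant:
if `F[G] ≅ F[H]` then `H'` is cyclic and `G' ≅ H'`. -/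
theorem derived_subgroup_cyclic_invariant (p : ℕ) [Fact p.Prime]
    (F : Type*) [Field F] [CharP F p]
    (G H : Type*) [Group G] [Finite G] [Group H] [Finite H]
    (hG : IsPGroup p G) (hG' : IsCyclic (commutator G))
    (hiso : Nonempty (MonoidAlgebra F G ≃ₐ[F] MonoidAlgebra F H)) :
    IsCyclic (commutator H) ∧ Nonempty ((commutator G) ≃* (commutator H)) := by
  obtain ⟨e⟩ := hiso
  have hcard : Nat.card G = Nat.card H := by
    have := e.toLinearEquiv.finrank_eq
    rwa [Module.finrank_eq_nat_card_basis (basis G F),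
      Module.finrank_eq_nat_card_basis (basis H F)] at this
  have hab : Nat.card (Abelianization G) = Nat.card (Abelianization H) :=
    le_antisymm (card_abelianization_le (e := e.symm.toAlgHom) e.symm.surjective)
      (card_abelianization_le (e := e.toAlgHom) e.surjective)
  have hH : IsPGroup p H := by
    obtain ⟨n, hn⟩ := IsPGroup.iff_card.1 hG
    exact IsPGroup.iff_card.2 ⟨n, hcard ▸ hn⟩
  have hcyc : IsCyclic (commutator H) := by
    rw [← Abelianization.ker_of] at hG' ⊢
    obtain ⟨c, hc⟩ := hG'.exists_generator
    obtain ⟨e₁, he₁⟩ := exists_algHom_abelianization e.toAlgHom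
    obtain ⟨e₂, he₂⟩ := exists_algHom_abelianization e.symm.toAlgHom
    refine hH.isCyclic_ker_of_principal F Abelianization.of
      (x := e (single (c : G) 1 - 1)) ?_ fun k hk ↦ ?_
    · refine (he₁ _).symm.trans ?_
      rw [mapDomainAlgHom_single_sub_one, map_zero]
    · obtain ⟨a, ha⟩ := exists_eq_mul_of_mapDomainAlgHom_eq_zero Abelianization.of hc
        (k := e.symm k) ((he₂ k).symm.trans (by rw [hk, map_zero]))
      exact ⟨e a, by rw [← map_mul, ← ha, e.apply_symm_apply]⟩
  refine ⟨hcyc, ⟨mulEquivOfCyclicCardEq ?_⟩⟩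
  have h₁ := (commutator G).card_mul_index
  have h₂ := (commutator H).card_mul_index
  rw [Subgroup.index_eq_card] at h₁ h₂
  change _ * Nat.card (Abelianization G) = _ at h₁
  change _ * Nat.card (Abelianization H) = _ at h₂
  have hpos : 0 < Nat.card (Abelianization H) :=
    have : Finite (Abelianization H) := Quotient.finite _
    Nat.card_pos
  rw [hab, hcard, ← h₂] at h₁
  exact Nat.eq_of_mul_eq_mul_right hpos h₁
end
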